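/- arXiv:2107.01250 — 4 statements merged into one kernel-verified Lean document; each statement's English description precedes it below -/
import Mathlib

section
/- Let $m = \Theta(n)$ balls be placed independently and uniformly at random into $n$ bins with $\mu = m/n$, and fix a bin index $j \in [n]$. For any $x > 1$ and $k \ge 1$, with probability $1 - 2^{-\Omega(k)}$, every interval $I \subseteq [n]$ of bins containing $j$ receives at most $(1 + 1/x)|I|\mu + xk$ balls. -/
open scoped Classical

/-- Number of balls (out of `m`) falling into the interval of bins `[a, b)`. -/
noncomputable def ballsInInterval {m n : ℕ} (ω : Fin m → Fin n) (a b : ℕ) : ℕ :=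
  (Finset.univ.filter (fun u => a ≤ (ω u : ℕ) ∧ (ω u : ℕ) < b)).card

/-- number of balls in the set `T`. -/
noncomputable def cnt {β : Type} {m : ℕ} (ω : Fin m → β) (T : Finset β) : ℕ :=
  ∑ u, if ω u ∈ T then 1 else 0

theorem cnt_insertNth {β : Type} {m : ℕ} (u : Fin (m+1)) (v : β) (ω : Fin m → β) (T : Finset β) :
    cnt (u.insertNth (α := fun _ => β) v ω) T = (if v ∈ T then 1 else 0) + cnt ω T := by
  unfold cnt
  rw [Fin.sum_univ_succAbove _ u]
  simp

theorem cnt_le {β : Type} {m : ℕ} (ω : Fin m → β) (T : Finset β) : cnt ω T ≤ m := by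
  unfold cnt
  calc _ ≤ ∑ u : Fin m, 1 := Finset.sum_le_sum (fun u _ => by split_ifs <;> simp)
    _ = m := by simp

theorem cnt_compl {β : Type} {m : ℕ} (ω : Fin m → β) (T : Finset β) :
    (∑ u, if ω u ∉ T then 1 else 0) + cnt ω T = m := by
  unfold cnt
  rw [← Finset.sum_add_distrib]
  calc _ = ∑ u : Fin m, 1 := Finset.sum_congr rfl (fun u _ => by split_ifs <;> simp)
    _ = m := by simp

/-- first passage event -/
noncomputable def evE {β : Type} [Fintype β] (S : ℕ → Finset β) (thr : ℕ → ℝ) (m t N : ℕ) :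
    Finset (Fin m → β) :=
  Finset.univ.filter (fun ω => cnt ω (S t) = N ∧ ∀ t' < t, (cnt ω (S t') : ℝ) ≤ thr t')

theorem evE_insert {β : Type} [Fintype β] (S : ℕ → Finset β) (hS : Monotone S) (thr : ℕ → ℝ)
    (m t N : ℕ) (u : Fin (m+1)) (v : β) (hv : v ∉ S t) (ω : Fin m → β) :
    (u.insertNth (α := fun _ => β) v ω) ∈ evE S thr (m+1) t N ↔ ω ∈ evE S thr m t N := by
  have h : ∀ t' ≤ t, cnt (u.insertNth (α := fun _ => β) v ω) (S t') = cnt ω (S t') := by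
    intro t' ht
    rw [cnt_insertNth, if_neg (fun h => hv (hS ht h)), zero_add]
  simp only [evE, Finset.mem_filter, Finset.mem_univ, true_and]
  rw [h t le_rfl]
  refine and_congr_right fun _ => forall_congr' fun t' => forall_congr' fun ht => ?_
  rw [h t' ht.le]

theorem evE_step {β : Type} [Fintype β] (S : ℕ → Finset β) (hS : Monotone S) (thr : ℕ → ℝ)
    (m t N : ℕ) :
    (m+1) * ((Fintype.card β - (S t).card) * (evE S thr m t N).card)
      = (m + 1 - N) * (evE S thr (m+1) t N).card := by
  have h1 : ∑ ω ∈ evE S thr (m+1) t N, ∑ u, (if ω u ∉ S t then 1 else 0)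
      = (m + 1 - N) * (evE S thr (m+1) t N).card := by
    rw [Finset.sum_congr rfl (g := fun _ => m + 1 - N), Finset.sum_const, smul_eq_mul, mul_comm]
    intro ω hω
    have := cnt_compl ω (S t)
    simp only [evE, Finset.mem_filter] at hω
    omega
  rw [← h1, Finset.sum_comm]
  have h2 : ∀ u : Fin (m+1), ∑ ω ∈ evE S thr (m+1) t N, (if ω u ∉ S t then 1 else 0)
      = (Fintype.card β - (S t).card) * (evE S thr m t N).card := by
    intro u
    rw [← Finset.card_compl, ← Finset.card_product, ← Finset.card_filter]
    symm
    refine Finset.card_bij (fun q _ => u.insertNth (α := fun _ => β) q.1 q.2) ?_ ?_ ?_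
    · rintro ⟨v, ω⟩ h
      simp only [Finset.mem_product, Finset.mem_compl] at h
      simp only [Finset.mem_filter, Fin.insertNth_apply_same]
      exact ⟨(evE_insert S hS thr m t N u v h.1 ω).2 h.2, h.1⟩
    · rintro ⟨v, ω⟩ _ ⟨v', ω'⟩ _ h
      have := (Fin.insertNthEquiv (fun _ : Fin (m+1) => β) u).injective (a₁ := (v, ω)) (a₂ := (v', ω')) h
      exact this
    · intro ω hω
      rw [Finset.mem_filter] at hω
      have e : u.insertNth (α := fun _ => β) (ω u) (u.removeNth ω) = ω := by simp
      refine ⟨(ω u, u.removeNth ω), ?_, e⟩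
      simp only [Finset.mem_product, Finset.mem_compl]
      exact ⟨hω.2, (evE_insert S hS thr m t N u _ hω.2 _).1 (by rw [e]; exact hω.1)⟩
  rw [Finset.sum_congr rfl (fun u _ => h2 u)]
  simp

theorem evE_iter {β : Type} [Fintype β] (S : ℕ → Finset β) (hS : Monotone S) (thr : ℕ → ℝ)
    (m t N : ℕ) (hN : N ≤ m) (hs : (S t).card < Fintype.card β) (r : ℕ) :
    ((evE S thr m t N).card : ℝ) / (Fintype.card β : ℝ)^m =
     (∏ i ∈ Finset.range r, (1 - N / ((m:ℝ) + i + 1)) / (1 - ((S t).card : ℝ) / Fintype.card β)) *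
      (((evE S thr (m+r) t N).card : ℝ) / (Fintype.card β : ℝ)^(m+r)) := by
  have hn : (0:ℝ) < Fintype.card β := by exact_mod_cast (Nat.zero_le _).trans_lt hs
  have hs' : ((S t).card : ℝ) < Fintype.card β := by exact_mod_cast hs
  induction r with
  | zero => simp
  | succ r ih =>
    rw [ih, Finset.prod_range_succ, mul_assoc]
    congr 1
    have h := evE_step S hS thr (m+r) t N
    have h' : ((m:ℝ)+r+1) * (((Fintype.card β : ℝ) - (S t).card) * (evE S thr (m+r) t N).card)
      = (m + r + 1 - N) * (evE S thr (m+r+1) t N).card := by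
      have := congrArg (Nat.cast (R := ℝ)) h
      push_cast [Nat.cast_sub hs.le, Nat.cast_sub (show N ≤ m + r + 1 by omega)] at this
      exact this
    have e1 : (Fintype.card β : ℝ) - (S t).card ≠ 0 := by linarith
    have e2 : (1 - ((S t).card : ℝ) / Fintype.card β) = (Fintype.card β - (S t).card : ℝ) / Fintype.card β := by
      field_simp
    have e3 : (m:ℝ)+r+1 ≠ 0 := by positivity
    rw [e2, ← add_assoc m r 1, pow_succ]
    field_simp
    linarith

theorem prod_bound (m r : ℕ) (x y p N : ℝ) (hm : 0 < m) (hx : 0 < x) (hy : 0 ≤ y)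
    (hr : (r:ℝ) + 1 ≤ 2 * m / x) (hp0 : 0 ≤ p) (hp1 : p < 1) (hNm : N ≤ m)
    (hN : (1 + 1/x) * (p * m) + y ≤ N) :
    ∏ i ∈ Finset.range r, (1 - N / ((m:ℝ) + i + 1)) / (1 - p)
      ≤ Real.exp (-(y * r / (m * (1 + 1/x)))) := by
  have hm' : (0:ℝ) < m := by exact_mod_cast hm
  set M : ℝ := m * (1 + 1/x) with hM
  have hMpos : 0 < M := by positivity
  have hq : 0 < 1 - p := by linarith
  have hfac : ∀ i ∈ Finset.range r, (1 - N / ((m:ℝ) + i + 1)) / (1 - p)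
      ≤ Real.exp (-(((y + p * M) * (1 / ((m:ℝ)+i+1)) - p) / (1-p))) := by
    intro i _
    refine le_trans ?_ (Real.add_one_le_exp _)
    have hz : (0:ℝ) < m + i + 1 := by positivity
    have : (1 - N / ((m:ℝ) + i + 1)) ≤ (1 - p) - ((y + p * M) * (1 / ((m:ℝ)+i+1)) - p) := by
      have : (y + p * M) * (1 / ((m:ℝ)+i+1)) ≤ N / ((m:ℝ) + i + 1) := by
        rw [mul_one_div]
        gcongr
        rw [hM]; linarith
      linarith
    calc _ ≤ ((1 - p) - ((y + p * M) * (1 / ((m:ℝ)+i+1)) - p)) / (1-p) := by gcongr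
      _ = _ := by field_simp; ring
  refine (Finset.prod_le_prod ?_ hfac).trans ?_
  · intro i _
    have hz : (0:ℝ) < m + i + 1 := by positivity
    have : N / ((m:ℝ) + i + 1) ≤ 1 := by
      rw [div_le_one hz]; have : (0:ℝ) ≤ i := by positivity
      linarith
    apply div_nonneg <;> linarith
  rw [← Real.exp_sum]
  apply Real.exp_le_exp.2
  rw [Finset.sum_neg_distrib]
  apply neg_le_neg
  rw [← Finset.sum_div, Finset.sum_sub_distrib, ← Finset.mul_sum]
  simp only [Finset.sum_const, Finset.card_range, nsmul_eq_mul]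
  have hsum : (r:ℝ) / M ≤ ∑ i ∈ Finset.range r, 1 / ((m:ℝ)+i+1) := by
    have h1 : ∀ i ∈ Finset.range r, 2 / M - ((m:ℝ)+i+1)/M^2 ≤ 1 / ((m:ℝ)+i+1) := by
      intro i _
      have hz : (0:ℝ) < m + i + 1 := by positivity
      rw [← sub_nonneg]
      have : 1 / ((m:ℝ)+i+1) - (2 / M - ((m:ℝ)+i+1)/M^2) = (M - (m+i+1))^2 / (M^2 * (m+i+1)) := by
        field_simp; ring
      rw [this]; positivity
    refine le_trans ?_ (Finset.sum_le_sum h1)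
    have h2 : ∀ r : ℕ, ∑ i ∈ Finset.range r, (2 / M - ((m:ℝ)+i+1)/M^2)
        = 2 * r / M - (r * (m + (r+1)/2)) / M^2 := by
      intro r
      induction r with
      | zero => simp
      | succ r ih => rw [Finset.sum_range_succ, ih]; push_cast; field_simp; ring
    rw [h2]
    have h3 : (m:ℝ) + (r+1)/2 ≤ M := by
      rw [hM]
      have : 2 * (m:ℝ) / x = 2 * (m * (1/x)) := by ring
      rw [this] at hr
      linarith
    have h4 : (r * ((m:ℝ) + (r+1)/2)) / M^2 ≤ (r * M) / M^2 := by gcongr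
    have h5 : (r * M) / M^2 = r / M := by field_simp
    have h6 : 2 * (r:ℝ) / M = 2 * (r / M) := by ring
    rw [h6]; linarith
  have h7 : (y + p * M) * (r / M) - r * p ≤ (y + p * M) * (∑ i ∈ Finset.range r, 1 / ((m:ℝ)+i+1)) - r * p := by
    gcongr
  have h8 : (y + p * M) * (r / M) - r * p = y * r / M := by field_simp; ring
  rw [h8] at h7
  rw [le_div_iff₀ hq]
  have : 0 ≤ y * r / M := by positivity
  nlinarith

theorem chain_bound {β : Type} [Fintype β] (S : ℕ → Finset β) (hS : Monotone S) (m r T : ℕ)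
    (x y : ℝ) (hm : 0 < m) (hx : 0 < x) (hy : 0 ≤ y) (hr : (r:ℝ) + 1 ≤ 2 * m / x)
    (hβ : 0 < Fintype.card β) :
    ((Finset.univ.filter (fun ω : Fin m → β => ∃ t < T,
      (1 + 1/x) * ((S t).card * ((m:ℝ) / Fintype.card β)) + y < cnt ω (S t))).card : ℝ)
      ≤ Real.exp (-(y * r / (m * (1 + 1/x)))) * (Fintype.card β : ℝ)^m := by
  set n := Fintype.card β with hn
  have hn' : (0:ℝ) < n := by exact_mod_cast hβ
  set thr : ℕ → ℝ := fun t => (1 + 1/x) * ((S t).card * ((m:ℝ) / n)) + y with hthr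
  set ρ := Real.exp (-(y * r / (m * (1 + 1/x)))) with hρ
  set I : Finset (ℕ × ℕ) := (Finset.range T ×ˢ Finset.range (m+1)).filter (fun q => thr q.1 < q.2) with hI
  have hsub : (Finset.univ.filter (fun ω : Fin m → β => ∃ t < T, thr t < cnt ω (S t)))
      ⊆ I.biUnion (fun q => evE S thr m q.1 q.2) := by
    intro ω hω
    simp only [Finset.mem_filter, Finset.mem_univ, true_and] at hω
    have hex : ∃ t, thr t < cnt ω (S t) := by obtain ⟨t, _, h⟩ := hω; exact ⟨t, h⟩
    obtain ⟨t0, ht0, h0⟩ := hω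
    simp only [Finset.mem_biUnion, hI, Finset.mem_filter, Finset.mem_product, Finset.mem_range, evE,
      Finset.mem_univ, true_and]
    refine ⟨(Nat.find hex, cnt ω (S (Nat.find hex))), ⟨⟨?_, ?_⟩, Nat.find_spec hex⟩, rfl, ?_⟩
    · exact (Nat.find_min' hex h0).trans_lt ht0
    · exact Nat.lt_succ_of_le (cnt_le _ _)
    · intro t' ht'
      exact not_lt.1 (Nat.find_min hex ht')
  have hdisj : (I : Set (ℕ × ℕ)).PairwiseDisjoint (fun q => evE S thr (m+r) q.1 q.2) := by
    rintro ⟨t, N⟩ h1 ⟨t', N'⟩ h2 hne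
    rw [Function.onFun, Finset.disjoint_left]
    intro ω hω hω'
    simp only [evE, Finset.mem_filter, Finset.mem_univ, true_and] at hω hω'
    simp only [hI, Finset.coe_filter, Set.mem_ofPred_eq] at h1 h2
    rcases lt_trichotomy t t' with h | h | h
    · have := hω'.2 t h
      rw [hω.1] at this
      linarith [h1.2]
    · subst h
      exact hne (by rw [← hω.1, ← hω'.1])
    · have := hω.2 t' h
      rw [hω'.1] at this
      linarith [h2.2]
  have hone : ∀ q ∈ I, ((evE S thr m q.1 q.2).card : ℝ) ≤
      ρ * n^m * (((evE S thr (m+r) q.1 q.2).card : ℝ) / (n:ℝ)^(m+r)) := by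
    rintro ⟨t, N⟩ hq
    simp only [hI, Finset.mem_filter, Finset.mem_product, Finset.mem_range] at hq
    obtain ⟨⟨_, hNm⟩, hN⟩ := hq
    have hNm' : N ≤ m := by omega
    have hNr : (N:ℝ) ≤ m := by exact_mod_cast hNm'
    have hm' : (0:ℝ) < m := by exact_mod_cast hm
    have hN2 : (1 + 1/x) * (((S t).card : ℝ) / n * m) + y ≤ N := by
      refine le_trans (le_of_eq ?_) hN.le
      simp only [hthr]; ring
    have hp1 : ((S t).card : ℝ) / n < 1 := by
      by_contra hcon
      push Not at hcon
      have : (m:ℝ) ≤ ((S t).card : ℝ) / n * m := by nlinarith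
      have h3 : 0 < 1/x := by positivity
      nlinarith
    have hs : (S t).card < n := by
      rw [div_lt_one hn'] at hp1; exact_mod_cast hp1
    have h1 := evE_iter S hS thr m t N hNm' hs r
    have h2 := prod_bound m r x y (((S t).card : ℝ) / n) N hm hx hy hr (by positivity) hp1 hNr hN2
    rw [div_eq_iff (by positivity)] at h1
    change ((evE S thr m t N).card : ℝ) ≤ _
    rw [h1]
    calc _ ≤ ρ * (((evE S thr (m+r) t N).card : ℝ) / (n:ℝ)^(m+r)) * n^m := by gcongr
      _ = _ := by ring
  calc _ ≤ ((I.biUnion (fun q => evE S thr m q.1 q.2)).card : ℝ) := by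
        exact_mod_cast Finset.card_le_card hsub
    _ ≤ ∑ q ∈ I, ((evE S thr m q.1 q.2).card : ℝ) := by exact_mod_cast Finset.card_biUnion_le
    _ ≤ ∑ q ∈ I, ρ * n^m * (((evE S thr (m+r) q.1 q.2).card : ℝ) / (n:ℝ)^(m+r)) :=
        Finset.sum_le_sum hone
    _ = ρ * n^m * (((I.biUnion (fun q => evE S thr (m+r) q.1 q.2)).card : ℝ) / (n:ℝ)^(m+r)) := by
        rw [← Finset.mul_sum, ← Finset.sum_div, Finset.card_biUnion hdisj]; push_cast; rfl
    _ ≤ ρ * n^m * 1 := by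
        gcongr
        rw [div_le_one (by positivity)]
        have : (I.biUnion (fun q => evE S thr (m+r) q.1 q.2)).card ≤ n^(m+r) := by
          refine (Finset.card_le_univ _).trans (le_of_eq ?_)
          simp [hn]
        exact_mod_cast this
    _ = _ := by rw [mul_one]

theorem cnt_union {β : Type} {m : ℕ} (ω : Fin m → β) (A B : Finset β) (hD : Disjoint A B) :
    cnt ω (A ∪ B) = cnt ω A + cnt ω B := by
  unfold cnt
  rw [← Finset.sum_add_distrib]
  refine Finset.sum_congr rfl fun u _ => ?_
  have hdd : ω u ∈ A → ω u ∉ B := fun h => Finset.disjoint_left.1 hD h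
  by_cases h1 : ω u ∈ A
  · simp [h1, hdd h1]
  · simp [h1]

/-- two sided bound -/
theorem two_sided {β : Type} [Fintype β] (f : β → ℕ) (m j B : ℕ)
    (x k : ℝ) (hx : 0 < x) (hk : 0 ≤ k) (hmx : x ≤ m) (hβ : 0 < Fintype.card β) :
    ((Finset.univ.filter (fun ω : Fin m → β => ∃ a b : ℕ, a ≤ j ∧ j < b ∧ b ≤ B ∧
      (1 + 1/x) * (((Finset.univ.filter (fun v => a ≤ f v ∧ f v < b)).card : ℝ) *
        ((m:ℝ) / Fintype.card β)) + x * k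
        < cnt ω (Finset.univ.filter (fun v => a ≤ f v ∧ f v < b)))).card : ℝ)
      ≤ 2 * Real.exp (-(k * (1 - x / m) / (1 + 1/x))) * (Fintype.card β : ℝ)^m := by
  have hm' : (0:ℝ) < m := hx.trans_le hmx
  have hm : 0 < m := by exact_mod_cast hm'
  set R : ℕ → Finset β := fun t => Finset.univ.filter (fun v => j ≤ f v ∧ f v < j + t) with hR
  set L : ℕ → Finset β := fun t => Finset.univ.filter (fun v => j ≤ f v + t ∧ f v < j) with hL
  have hRm : Monotone R := by
    intro s t hst v
    simp only [hR, Finset.mem_filter]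
    rintro ⟨h1, h2, h3⟩; exact ⟨h1, h2, by omega⟩
  have hLm : Monotone L := by
    intro s t hst v
    simp only [hL, Finset.mem_filter]
    rintro ⟨h1, h2, h3⟩; exact ⟨h1, by omega, h3⟩
  have hfl : 1 ≤ ⌊2 * (m:ℝ) / x⌋₊ := by
    apply Nat.le_floor
    rw [le_div_iff₀ hx]; push_cast; linarith
  obtain ⟨r, hrf⟩ : ∃ r, ⌊2 * (m:ℝ) / x⌋₊ = r + 1 := ⟨_, (Nat.sub_add_cancel hfl).symm⟩
  have hr1 : (r:ℝ) + 1 ≤ 2 * m / x := by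
    have := Nat.floor_le (show 0 ≤ 2 * (m:ℝ) / x by positivity)
    rw [hrf] at this; exact_mod_cast this
  have hr2 : 2 * m / x - 2 ≤ (r:ℝ) := by
    have := Nat.lt_floor_add_one (2 * (m:ℝ) / x)
    rw [hrf] at this; push_cast at this; linarith
  have hy : 0 ≤ x * k / 2 := by positivity
  have b1 := chain_bound R hRm m r (j+B+1) x (x*k/2) hm hx hy hr1 hβ
  have b2 := chain_bound L hLm m r (j+B+1) x (x*k/2) hm hx hy hr1 hβ
  have he : Real.exp (-(x*k/2 * r / (m * (1 + 1/x)))) ≤ Real.exp (-(k * (1 - x / m) / (1 + 1/x))) := by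
    apply Real.exp_le_exp.2
    apply neg_le_neg
    rw [mul_comm (m:ℝ), ← div_div, div_right_comm]
    gcongr
    rw [le_div_iff₀ hm']
    calc k * (1 - x/m) * m = x * k/2 * (2 * m / x - 2) := by field_simp
      _ ≤ _ := by gcongr
  refine le_trans (b := (((Finset.univ.filter (fun ω : Fin m → β => ∃ t < j+B+1,
      (1 + 1/x) * ((R t).card * ((m:ℝ) / Fintype.card β)) + x*k/2 < cnt ω (R t))) ∪
      (Finset.univ.filter (fun ω : Fin m → β => ∃ t < j+B+1,
      (1 + 1/x) * ((L t).card * ((m:ℝ) / Fintype.card β)) + x*k/2 < cnt ω (L t)))).card : ℝ)) ?_ ?_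
  · norm_cast
    apply Finset.card_le_card
    intro ω hω
    simp only [Finset.mem_filter, Finset.mem_univ, true_and, Finset.mem_union] at hω ⊢
    obtain ⟨a, b, ha, hb, hB, h⟩ := hω
    by_contra hcon
    push Not at hcon
    have h1 := hcon.1 (b - j) (by omega)
    have h2 := hcon.2 (j - a) (by omega)
    have hU : Finset.univ.filter (fun v => a ≤ f v ∧ f v < b) = R (b-j) ∪ L (j-a) := by
      ext v
      simp only [hR, hL, Finset.mem_filter, Finset.mem_univ, true_and, Finset.mem_union]
      omega
    have hD : Disjoint (R (b-j)) (L (j-a)) := by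
      rw [Finset.disjoint_left]
      intro v
      simp only [hR, hL, Finset.mem_filter, Finset.mem_univ, true_and]
      omega
    have hC : cnt ω (R (b-j) ∪ L (j-a)) = cnt ω (R (b-j)) + cnt ω (L (j-a)) := by
      exact cnt_union ω _ _ hD
    rw [hU, hC, Finset.card_union_of_disjoint hD] at h
    push_cast at h
    nlinarith
  · refine le_trans (b := _ + _) (by exact_mod_cast Finset.card_union_le _ _) ((add_le_add b1 b2).trans ?_)
    have : (0:ℝ) ≤ (Fintype.card β : ℝ)^m := by positivity
    nlinarith

/-- the bad event -/
noncomputable def badEv (n m j : ℕ) (x k : ℝ) : Finset (Fin m → Fin n) :=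
  Finset.univ.filter (fun ω : Fin m → Fin n =>
          ¬ (∀ a b : ℕ, a ≤ j → j < b → b ≤ n →
              (ballsInInterval ω a b : ℝ) ≤
                (1 + 1 / x) * ((b - a : ℕ) : ℝ) * ((m : ℝ) / n) + x * k))

theorem cnt_eq_balls {β : Type} [Fintype β] {m n : ℕ} (g : β → Fin n) (ω : Fin m → β) (a b : ℕ) :
    cnt ω (Finset.univ.filter (fun v => a ≤ (g v : ℕ) ∧ (g v : ℕ) < b))
      = ballsInInterval (fun u => g (ω u)) a b := by
  unfold cnt ballsInInterval
  rw [Finset.card_filter]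
  simp

theorem card_interval (n a b : ℕ) (hb : b ≤ n) :
    (Finset.univ.filter (fun v : Fin n => a ≤ (v : ℕ) ∧ (v : ℕ) < b)).card = b - a := by
  rw [← Nat.card_Ico a b]
  refine Finset.card_bij (fun v _ => (v : ℕ)) ?_ ?_ ?_
  · intro v hv; simpa using hv
  · intro v _ w _ h; exact Fin.ext h
  · intro i hi
    rw [Finset.mem_Ico] at hi
    exact ⟨⟨i, by omega⟩, by simpa using hi, rfl⟩

theorem bad_bound (n m j : ℕ) (hn : 0 < n) (x k : ℝ) (hx : 0 < x) (hk : 0 ≤ k) (hmx : x ≤ m) :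
    ((badEv n m j x k).card : ℝ) ≤ 2 * Real.exp (-(k * (1 - x / m) / (1 + 1/x))) * (n : ℝ)^m := by
  have h := two_sided (β := Fin n) (fun v => (v : ℕ)) m j n x k hx hk hmx (by simpa using hn)
  simp only [Fintype.card_fin] at h
  refine le_trans ?_ h
  norm_cast
  apply Finset.card_le_card
  intro ω hω
  simp only [badEv, Finset.mem_filter, Finset.mem_univ, true_and] at hω ⊢
  push Not at hω
  obtain ⟨a, b, ha, hb, hB, h⟩ := hω
  refine ⟨a, b, ha, hb, hB, ?_⟩
  rw [card_interval n a b hB, cnt_eq_balls (fun v : Fin n => v), ← mul_assoc]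
  exact h

theorem balls_le {m n : ℕ} (ω : Fin m → Fin n) (a b : ℕ) : ballsInInterval ω a b ≤ m := by
  unfold ballsInInterval
  exact (Finset.card_le_univ _).trans (by simp)

theorem bad_empty (n m j : ℕ) (x k : ℝ) (hx : 0 < x) (h : m ≤ x * k) : badEv n m j x k = ∅ := by
  rw [badEv, Finset.filter_eq_empty_iff]
  intro ω _ hcon
  apply hcon
  intro a b _ _ _
  have h1 : (ballsInInterval ω a b : ℝ) ≤ m := by exact_mod_cast balls_le ω a b
  have : 0 ≤ (1 + 1 / x) * ((b - a : ℕ) : ℝ) * ((m : ℝ) / n) := by positivity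
  linarith

theorem bad_mono (n m j : ℕ) (hn : 0 < n) (x k x' k' : ℝ) (hx' : 0 < x')
    (h : (m:ℝ) / x + x * k ≤ x' * k') (hx : 0 < x) : badEv n m j x' k' ⊆ badEv n m j x k := by
  intro ω
  simp only [badEv, Finset.mem_filter, Finset.mem_univ, true_and]
  intro hbad hgood
  apply hbad
  intro a b ha hb hB
  refine (hgood a b ha hb hB).trans ?_
  have hn' : (0:ℝ) < n := by exact_mod_cast hn
  have hs : ((b - a : ℕ) : ℝ) ≤ n := by exact_mod_cast (Nat.sub_le b a).trans hB
  set q : ℝ := ((b - a : ℕ) : ℝ) * ((m : ℝ) / n) with hq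
  have hq0 : 0 ≤ q := by positivity
  have hqm : q ≤ m := by
    calc q ≤ n * ((m:ℝ) / n) := by rw [hq]; gcongr
      _ = m := by field_simp
  rw [mul_assoc, mul_assoc, ← hq]
  have h1 : 1 / x * q ≤ m / x := by
    rw [one_div_mul_eq_div]; gcongr
  have h2 : 0 ≤ 1 / x' * q := by positivity
  nlinarith

/-- regime 1 -/
theorem large_k (n m j : ℕ) (hn : 0 < n) (x k : ℝ) (hx : 1 < x) (hk : 6 ≤ k) :
    ((badEv n m j x k).card : ℝ) ≤ Real.exp (-(k / 20)) * (n : ℝ)^m := by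
  rcases le_or_gt (m:ℝ) (x * k) with h | h
  · rw [bad_empty n m j x k (by linarith) h]
    simp; positivity
  have hm : 2 * x ≤ m := by nlinarith
  have hm0 : (0:ℝ) < m := by linarith
  refine (bad_bound n m j hn x k (by linarith) (by linarith) (by linarith)).trans ?_
  gcongr
  have h2 : (2:ℝ) ≤ Real.exp 1 := by linarith [Real.add_one_le_exp (1:ℝ)]
  have h3 : k / 4 ≤ k * (1 - x / m) / (1 + 1/x) := by
    have e1 : x / m ≤ 1/2 := by rw [div_le_iff₀ hm0]; linarith
    have e2 : 1/x ≤ 1 := by rw [div_le_one (by linarith)]; linarith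
    have e3 : 0 < 1/x := by positivity
    rw [le_div_iff₀ (by positivity)]
    nlinarith
  calc 2 * Real.exp (-(k * (1 - x / m) / (1 + 1/x))) ≤ Real.exp 1 * Real.exp (-(k/4)) := by gcongr
    _ = Real.exp (1 - k/4) := by rw [← Real.exp_add]; ring_nf
    _ ≤ _ := Real.exp_le_exp.2 (by linarith)

theorem two_le_exp : (2:ℝ) ≤ Real.exp 0.7 := by
  rw [← Real.log_le_iff_le_exp (by norm_num)]
  linarith [Real.log_two_lt_d9]

/-- regime 2 -/
theorem large_x (n m j : ℕ) (hn : 0 < n) (x k : ℝ) (hx : 200 ≤ x) (hk : 1 ≤ k) (hk6 : k ≤ 6) :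
    ((badEv n m j x k).card : ℝ) ≤ Real.exp (-(k / 20)) * (n : ℝ)^m := by
  rcases le_or_gt (m:ℝ) (x * k) with h | h
  · rw [bad_empty n m j x k (by linarith) h]
    simp; positivity
  have hm : x ≤ m := by nlinarith
  have hm0 : (0:ℝ) < m := by linarith
  rcases le_or_gt (m:ℝ) (6 * x) with h6 | h6
  · have hsub := bad_mono n m j hn 12 (x/24) x k (by linarith) (by nlinarith) (by norm_num)
    have h1 : ((badEv n m j x k).card : ℝ) ≤ ((badEv n m j 12 (x/24)).card : ℝ) := by
      exact_mod_cast Finset.card_le_card hsub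
    refine h1.trans ((bad_bound n m j hn 12 (x/24) (by norm_num) (by linarith) (by linarith)).trans ?_)
    gcongr
    have h3 : 2 ≤ x/24 * (1 - 12 / m) / (1 + 1/12) := by
      have e1 : 12 / (m:ℝ) ≤ 1/2 := by rw [div_le_iff₀ hm0]; linarith
      rw [le_div_iff₀ (by positivity)]
      nlinarith
    calc 2 * Real.exp (-(x/24 * (1 - 12 / m) / (1 + 1/12))) ≤ Real.exp 0.7 * Real.exp (-2) := by
          gcongr; exact two_le_exp
      _ = Real.exp (0.7 - 2) := by rw [← Real.exp_add]; ring_nf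
      _ ≤ _ := Real.exp_le_exp.2 (by linarith)
  · refine (bad_bound n m j hn x k (by linarith) (by linarith) (by linarith)).trans ?_
    gcongr
    have h3 : 0.8 * k ≤ k * (1 - x / m) / (1 + 1/x) := by
      have e1 : x / m ≤ 1/6 := by rw [div_le_iff₀ hm0]; linarith
      have e2 : 1/x ≤ 1/200 := by gcongr
      have e3 : 0 < 1/x := by positivity
      rw [le_div_iff₀ (by positivity)]
      nlinarith
    calc 2 * Real.exp (-(k * (1 - x / m) / (1 + 1/x))) ≤ Real.exp 0.7 * Real.exp (-(0.8 * k)) := by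
          gcongr; exact two_le_exp
      _ = Real.exp (0.7 - 0.8 * k) := by rw [← Real.exp_add]; ring_nf
      _ ≤ _ := Real.exp_le_exp.2 (by linarith)

/-- the balanced placement is good -/
theorem small_n (n m j : ℕ) (hn : 0 < n) (x k : ℝ) (hx : 1 < x) (hk : 1 ≤ k) :
    ((badEv n m j x k).card : ℝ) ≤ (n:ℝ)^m - 1 := by
  have hn' : (0:ℝ) < n := by exact_mod_cast hn
  have key : ∃ ω : Fin m → Fin n, ω ∉ badEv n m j x k := by
    refine ⟨fun u => ⟨u * n / m, ?_⟩, ?_⟩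
    · have hm : 0 < m := (Nat.zero_le _).trans_lt u.2
      rw [Nat.div_lt_iff_lt_mul hm, mul_comm]
      exact Nat.mul_lt_mul_of_pos_left u.2 hn
    · simp only [badEv, Finset.mem_filter, Finset.mem_univ, true_and, not_not]
      intro a b ha hb hB
      rcases Nat.eq_zero_or_pos m with rfl | hm
      · have : ballsInInterval (fun u : Fin 0 => (⟨u * n / 0, by simpa using hn⟩ : Fin n)) a b ≤ 0 := balls_le _ _ _
        have h2 : (ballsInInterval (fun u : Fin 0 => (⟨u * n / 0, by simpa using hn⟩ : Fin n)) a b : ℝ) ≤ 0 := by exact_mod_cast this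
        refine h2.trans ?_
        have : 0 ≤ x * k := by nlinarith
        positivity
      set A := ⌈(a:ℝ) * m / n⌉₊ with hA
      set B' := ⌈(b:ℝ) * m / n⌉₊ with hB'
      have hle : ∀ p : ∀ u : Fin m, (u:ℕ) * n / m < n, ballsInInterval (fun u : Fin m => (⟨u * n / m, p u⟩ : Fin n)) a b ≤ B' - A := by
        intro p
        rw [← Nat.card_Ico A B']
        unfold ballsInInterval
        refine Finset.card_le_card_of_injOn (fun u => (u:ℕ)) ?_ ?_
        · intro u hu
          simp only [Finset.coe_filter, Finset.mem_univ, true_and, Set.mem_ofPred_eq] at hu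
          rw [Nat.le_div_iff_mul_le hm, Nat.div_lt_iff_lt_mul hm] at hu
          simp only [Finset.coe_Ico, Set.mem_Ico]
          constructor
          · rw [hA, Nat.ceil_le, div_le_iff₀ hn']; exact_mod_cast hu.1
          · rw [hB', Nat.lt_ceil, lt_div_iff₀ hn']; exact_mod_cast hu.2
        · intro u _ v _ h; exact Fin.ext h
      have hAB : A ≤ B' := by
        apply Nat.ceil_mono; gcongr; omega
      have hle' := (Nat.cast_le (α := ℝ)).2 (hle (fun u => by
        rw [Nat.div_lt_iff_lt_mul hm, mul_comm]
        exact Nat.mul_lt_mul_of_pos_left u.2 hn))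
      refine hle'.trans ?_
      rw [Nat.cast_sub hAB, Nat.cast_sub (by omega)]
      have h1 := Nat.ceil_lt_add_one (show 0 ≤ (b:ℝ) * m / n by positivity)
      have h2 := Nat.le_ceil ((a:ℝ) * m / n)
      rw [← hA] at h2
      rw [← hB'] at h1
      have h3 : (0:ℝ) ≤ (b:ℝ) - a := by
        have : (a:ℝ) ≤ b := by exact_mod_cast (show a ≤ b by omega)
        linarith
      have h4 : 0 ≤ 1 / x * (((b:ℝ) - a) * (m/n)) := by positivity
      have h5 : 1 ≤ x * k := by nlinarith
      have h6 : (b:ℝ) * m / n - a * m / n = ((b:ℝ) - a) * (m/n) := by ring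
      nlinarith
  obtain ⟨ω, hω⟩ := key
  have h := Finset.card_le_univ (insert ω (badEv n m j x k))
  rw [Finset.card_insert_of_notMem hω] at h
  simp only [Fintype.card_fun, Fintype.card_fin] at h
  have h' : ((badEv n m j x k).card : ℝ) + 1 ≤ (n:ℝ)^m := by exact_mod_cast h
  linarith

theorem pow_window (n n' m K w : ℕ) (c₂ : ℝ) (hnr : (0:ℝ) < n) (hβ : n' + w = n)
    (hWc : w ≤ 2 * K + 1) (hn : 402 * (2 * K + 1) ≤ n) (h2 : (m:ℝ) ≤ c₂ * n) :
    Real.exp (-(2 * (2*K+1) * c₂)) * (n:ℝ)^m ≤ (n':ℝ)^m := by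
  set t : ℝ := (2 * K + 1) / n with ht
  have ht0 : 0 ≤ t := by positivity
  have hnc : 402 * (2 * (K:ℝ) + 1) ≤ n := by exact_mod_cast hn
  have ht2 : t ≤ 1/2 := by rw [ht, div_le_iff₀ hnr]; linarith
  have e1 : n * (1 - t) ≤ n' := by
    have e1 : (n' : ℝ) + w = n := by exact_mod_cast hβ
    have e2 : (w : ℝ) ≤ 2 * K + 1 := by exact_mod_cast hWc
    have : (n:ℝ) * t = 2 * K + 1 := by rw [ht]; field_simp
    linarith
  have e2 : Real.exp (-(2*t)) ≤ 1 - t := by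
    rw [Real.exp_neg, inv_le_comm₀ (Real.exp_pos _) (by linarith)]
    refine le_trans ?_ (Real.add_one_le_exp _)
    rw [inv_le_iff_one_le_mul₀ (by linarith)]
    nlinarith
  calc _ ≤ Real.exp (-(2*t)) ^ m * (n:ℝ)^m := by
        gcongr
        rw [← Real.exp_nat_mul]
        apply Real.exp_le_exp.2
        have : (m:ℝ) * t ≤ c₂ * (2 * K + 1) := by
          calc (m:ℝ) * t ≤ c₂ * n * t := by gcongr
            _ = _ := by rw [ht]; field_simp
        linarith
    _ ≤ (1 - t)^m * (n:ℝ)^m := by gcongr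
    _ = (n * (1-t))^m := by rw [mul_pow, mul_comm]
    _ ≤ _ := by
        have : 0 ≤ n * (1-t) := mul_nonneg hnr.le (by linarith)
        gcongr

/-- regime 3 with many bins -/
theorem small_x (c₁ c₂ : ℝ) (hc₁ : 0 < c₁) (n m j K : ℕ) (hK : 3200 ≤ K * c₁)
    (hn : 402 * (2 * K + 1) ≤ n) (h800 : (800:ℝ) ≤ m) (h1 : c₁ * n ≤ m) (h2 : (m:ℝ) ≤ c₂ * n)
    (hj : j < n) (x k : ℝ) (hx : 1 < x) (hx2 : x ≤ 200) (hk : 1 ≤ k) :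
    ((badEv n m j x k).card : ℝ) ≤ (1 - Real.exp (-(2 * (2*K+1) * c₂)) / 2) * (n:ℝ)^m := by
  set W : Finset (Fin n) := Finset.univ.filter (fun v => j ≤ (v:ℕ) + K ∧ (v:ℕ) ≤ j + K) with hW
  let β := {v : Fin n // v ∉ W}
  have hWc : W.card ≤ 2 * K + 1 := by
    have : W.card ≤ (Finset.Icc (j - K) (j+K)).card := by
      refine Finset.card_le_card_of_injOn (fun u => (u:ℕ)) ?_ ?_
      · intro v hv
        simp only [hW, Finset.coe_filter, Finset.mem_univ, true_and, Set.mem_ofPred_eq] at hv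
        simp only [Finset.coe_Icc, Set.mem_Icc]
        omega
      · intro u _ v _ h; exact Fin.ext h
    rw [Nat.card_Icc] at this
    omega
  have hβ : Fintype.card β + W.card = n := by
    have := Fintype.card_subtype_compl (fun v : Fin n => v ∈ W)
    have hle : W.card ≤ n := (Finset.card_le_univ W).trans (by simp)
    simp only [Fintype.card_fin, Fintype.card_coe] at this
    change Fintype.card {v : Fin n // v ∉ W} + W.card = n
    omega
  set n' := Fintype.card β with hn'
  have hn'0 : 0 < n' := by omega
  have hnr : (0:ℝ) < n := by exact_mod_cast (show 0 < n by omega)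
  have hn'r : (0:ℝ) < n' := by exact_mod_cast hn'0
  have hm0 : (0:ℝ) < m := by linarith
  have T := two_sided (β := β) (fun v => ((v : Fin n) : ℕ)) m j n (2*x) 8 (by linarith) (by norm_num)
    (by linarith) hn'0
  rw [← hn'] at T
  set Bad' := (Finset.univ.filter (fun ω : Fin m → β => ∃ a b : ℕ, a ≤ j ∧ j < b ∧ b ≤ n ∧
      (1 + 1/(2*x)) * (((Finset.univ.filter (fun v : β => a ≤ ((v:Fin n):ℕ) ∧ ((v:Fin n):ℕ) < b)).card : ℝ) *
        ((m:ℝ) / n')) + 2 * x * 8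
        < cnt ω (Finset.univ.filter (fun v : β => a ≤ ((v:Fin n):ℕ) ∧ ((v:Fin n):ℕ) < b)))) with hBad'
  have hhalf : (Bad'.card : ℝ) ≤ 1/2 * (n':ℝ)^m := by
    refine T.trans ?_
    gcongr
    have h3 : 2.1 ≤ 8 * (1 - 2 * x / m) / (1 + 1/(2*x)) := by
      have e1 : 2 * x / m ≤ 1/2 := by rw [div_le_iff₀ hm0]; linarith
      have e2 : 1/(2 * x) ≤ 1/2 := by gcongr; linarith
      have e3 : 0 < 1/(2*x) := by positivity
      rw [le_div_iff₀ (by positivity)]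
      nlinarith
    have h4 : Real.exp (-(8 * (1 - 2 * x / m) / (1 + 1/(2*x)))) ≤ Real.exp (-(0.7+0.7)) :=
      Real.exp_le_exp.2 (by linarith)
    have h5 : Real.exp (-(0.7+0.7)) ≤ 1/4 := by
      rw [Real.exp_neg, Real.exp_add, inv_eq_one_div]
      apply one_div_le_one_div_of_le (by norm_num)
      nlinarith [two_le_exp]
    linarith
  have hgood : ∀ ω : Fin m → β, ω ∉ Bad' → (fun u => (ω u : Fin n)) ∉ badEv n m j x k := by
    intro ω hω
    simp only [hBad', badEv, Finset.mem_filter, Finset.mem_univ, true_and, not_not] at hω ⊢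
    push Not at hω
    intro a b ha hb hB
    have h := hω a b ha hb hB
    rw [cnt_eq_balls (fun v : β => (v : Fin n))] at h
    set I' := (Finset.univ.filter (fun v : β => a ≤ ((v:Fin n):ℕ) ∧ ((v:Fin n):ℕ) < b)) with hI'
    have hxk : 0 ≤ x * k := by nlinarith
    rcases I'.eq_empty_or_nonempty with hemp | ⟨v, hv⟩
    · have h0 : ballsInInterval (fun u => (ω u : Fin n)) a b = 0 := by
        rw [← cnt_eq_balls (fun v : β => (v : Fin n)), ← hI', hemp]
        simp [cnt]
      rw [h0]
      push_cast
      positivity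
    have hcard : I'.card + K ≤ b - a := by
      have hvW := v.2
      simp only [hW, Finset.mem_filter, Finset.mem_univ, true_and] at hvW
      simp only [hI', Finset.mem_filter, Finset.mem_univ, true_and] at hv
      have hvn := (v : Fin n).2
      obtain ⟨l, hl1, hl2, hl3, hl4⟩ : ∃ l, a ≤ l ∧ l + K ≤ b ∧ j ≤ l + K ∧ l ≤ j + 1 := by
        rcases le_or_gt j (v : Fin n) with hjv | hjv
        · exact ⟨j, ha, by omega, by omega, by omega⟩
        · exact ⟨j - K, by omega, by omega, by omega, by omega⟩
      have hd : Disjoint (I'.image (fun v : β => ((v : Fin n) : ℕ))) (Finset.Ico l (l+K)) := by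
        rw [Finset.disjoint_left]
        intro i hi hi2
        rw [Finset.mem_image] at hi
        obtain ⟨w, _, rfl⟩ := hi
        rw [Finset.mem_Ico] at hi2
        have hwW := w.2
        simp only [hW, Finset.mem_filter, Finset.mem_univ, true_and] at hwW
        omega
      have hsub : (I'.image (fun v : β => ((v : Fin n) : ℕ))) ∪ (Finset.Ico l (l+K)) ⊆ Finset.Ico a b := by
        intro i hi
        rw [Finset.mem_union, Finset.mem_image, Finset.mem_Ico] at hi
        rw [Finset.mem_Ico]
        rcases hi with ⟨w, hw, rfl⟩ | hi
        · simpa [hI'] using hw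
        · omega
      have hc := Finset.card_le_card hsub
      rw [Finset.card_union_of_disjoint hd, Finset.card_image_of_injective, Nat.card_Ico, Nat.card_Ico] at hc
      · omega
      · intro w w' hww
        exact Subtype.ext (Fin.ext hww)
    refine h.trans ?_
    have hcr : (I'.card : ℝ) + K ≤ ((b - a : ℕ) : ℝ) := by exact_mod_cast hcard
    have hnn : (n:ℝ) * (2*x+1) ≤ n' * (2*x+2) := by
      have e1 : (n' : ℝ) + W.card = n := by exact_mod_cast hβ
      have e2 : 402 * (W.card : ℝ) ≤ n := by exact_mod_cast (Nat.mul_le_mul_left 402 hWc).trans hn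
      nlinarith
    have hslope : (1 + 1/(2*x)) * ((m:ℝ) / n') ≤ (1 + 1/x) * ((m:ℝ)/n) := by
      have e1 : (1 + 1/(2*x)) * ((m:ℝ) / n') = m * (2*x+1) / (2 * x * n') := by field_simp
      have e2 : (1 + 1/x) * ((m:ℝ)/n) = m * (2*x+2) / (2*x*n) := by field_simp
      rw [e1, e2, div_le_div_iff₀ (by positivity) (by positivity)]
      have : 0 ≤ (m:ℝ) * (2 * x) := by positivity
      nlinarith
    have hmu : c₁ ≤ (m:ℝ)/n := by rw [le_div_iff₀ hnr]; exact h1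
    have hKm : 2 * x * 8 ≤ (1 + 1/x) * K * ((m:ℝ)/n) := by
      have e1 : 3200 ≤ K * ((m:ℝ)/n) := hK.trans (by gcongr)
      have e3 : 0 < 1/x := by positivity
      nlinarith
    calc (1 + 1/(2*x)) * ((I'.card : ℝ) * ((m:ℝ) / n')) + 2 * x * 8
        = (I'.card : ℝ) * ((1 + 1/(2*x)) * ((m:ℝ) / n')) + 2 * x * 8 := by ring
      _ ≤ (I'.card : ℝ) * ((1 + 1/x) * ((m:ℝ)/n)) + (1 + 1/x) * K * ((m:ℝ)/n) := by gcongr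
      _ = (1 + 1/x) * ((I'.card : ℝ) + K) * ((m:ℝ)/n) := by ring
      _ ≤ (1 + 1/x) * ((b - a : ℕ) : ℝ) * ((m:ℝ)/n) := by gcongr
      _ ≤ _ := by linarith
  have hcount : Bad'ᶜ.card + (badEv n m j x k).card ≤ n^m := by
    have hinj : Function.Injective (fun (ω : Fin m → β) (u : Fin m) => (ω u : Fin n)) := by
      intro ω ω' h
      funext u
      exact Subtype.ext (congrFun h u)
    rw [← Finset.card_image_of_injective _ hinj, ← Finset.card_union_of_disjoint]
    · exact (Finset.card_le_univ _).trans (by simp)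
    · rw [Finset.disjoint_left]
      intro ω hω
      rw [Finset.mem_image] at hω
      obtain ⟨ω', h', rfl⟩ := hω
      exact hgood ω' (Finset.mem_compl.1 h')
  have hcompl : (Bad'ᶜ.card : ℝ) + Bad'.card = (n':ℝ)^m := by
    have := Finset.card_compl_add_card Bad'
    rw [Fintype.card_fun, Fintype.card_fin, ← hn'] at this
    exact_mod_cast this
  have hcount' : (Bad'ᶜ.card : ℝ) + (badEv n m j x k).card ≤ (n:ℝ)^m := by exact_mod_cast hcount
  have hpow : Real.exp (-(2 * (2*K+1) * c₂)) * (n:ℝ)^m ≤ (n':ℝ)^m := by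
    exact pow_window n n' m K W.card c₂ hnr hβ hWc hn h2
  linarith

theorem exp_to_two (c d k : ℝ) (hk : 0 ≤ k) (hc0 : 0 ≤ c) (h : c ≤ d) :
    Real.exp (-(d * k)) ≤ (2:ℝ) ^ (-(c * k)) := by
  rw [Real.rpow_def_of_pos (by norm_num)]
  apply Real.exp_le_exp.2
  have h1 : Real.log 2 ≤ 1 := by linarith [Real.log_two_lt_d9]
  have h2 : c * k ≤ d * k := by gcongr
  have h3 : 0 ≤ c * k := by positivity
  nlinarith

theorem stmt2 (c₁ c₂ : ℝ) (hc₁ : 0 < c₁) (hc₂ : 0 < c₂) :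
    ∃ c₃ : ℝ, 0 < c₃ ∧
      ∀ (n m : ℕ), 0 < n → c₁ * n ≤ m → (m : ℝ) ≤ c₂ * n →
      ∀ (j : ℕ), j < n →
      ∀ (x k : ℝ), 1 < x → 1 ≤ k →
      ((Finset.univ.filter (fun ω : Fin m → Fin n =>
          ¬ (∀ a b : ℕ, a ≤ j → j < b → b ≤ n →
              (ballsInInterval ω a b : ℝ) ≤
                (1 + 1 / x) * ((b - a : ℕ) : ℝ) * ((m : ℝ) / n) + x * k))).card : ℝ)
        ≤ (2 : ℝ) ^ (-(c₃ * k)) * (n : ℝ) ^ m := by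
  obtain ⟨K, hK⟩ := exists_nat_ge (3200 / c₁)
  rw [div_le_iff₀ hc₁] at hK
  obtain ⟨n0, hn0⟩ : ∃ n0 : ℕ, n0 = 402 * (2 * K + 1) := ⟨_, rfl⟩
  obtain ⟨M, hM⟩ := exists_nat_ge (c₂ * n0)
  set δ₁ : ℝ := Real.exp (-(2 * (2*K+1) * c₂)) / 2 with hδ₁
  set δ₂ : ℝ := 1 / (n0:ℝ)^M with hδ₂
  have hn0r : (1:ℝ) ≤ n0 := by exact_mod_cast (show 1 ≤ n0 by omega)
  have p1 : 0 < δ₁ := by positivity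
  have p2 : 0 < δ₂ := by positivity
  set c := min (1/20) (min (δ₁/6) (δ₂/6)) with hc
  have hcpos : 0 < c := by positivity
  have hca : c ≤ 1/20 := min_le_left _ _
  have hcb : c ≤ δ₁/6 := (min_le_right _ _).trans (min_le_left _ _)
  have hcc : c ≤ δ₂/6 := (min_le_right _ _).trans (min_le_right _ _)
  refine ⟨c, hcpos, ?_⟩
  intro n m hn h1 h2 j hj x k hx hk
  change ((badEv n m j x k).card : ℝ) ≤ _
  have hnr : (0:ℝ) < n := by exact_mod_cast hn
  have hA : Real.exp (-(k/20)) * (n:ℝ)^m ≤ (2 : ℝ) ^ (-(c * k)) * (n : ℝ) ^ m := by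
    gcongr
    have := exp_to_two c (1/20) k (by linarith) hcpos.le hca
    rwa [show 1/20 * k = k/20 by ring] at this
  rcases le_or_gt 6 k with hk6 | hk6
  · exact (large_k n m j hn x k hx hk6).trans hA
  rcases le_or_gt 200 x with hx2 | hx2
  · exact (large_x n m j hn x k hx2 hk hk6.le).trans hA
  have hB : ∀ δ, c ≤ δ/6 → (1 - δ) * (n:ℝ)^m ≤ (2 : ℝ) ^ (-(c * k)) * (n : ℝ) ^ m := by
    intro δ hδ
    gcongr
    refine le_trans ?_ (exp_to_two c c k (by linarith) hcpos.le le_rfl)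
    refine le_trans ?_ (Real.add_one_le_exp _)
    have : c * k ≤ c * 6 := by gcongr
    linarith
  rcases le_or_gt n0 n with hnn | hnn
  · have h800 : (800:ℝ) ≤ m := by
      have : (n0:ℝ) ≤ n := by exact_mod_cast hnn
      have e : (n0:ℝ) = 402 * (2 * K + 1) := by rw [hn0]; push_cast; ring
      have e2 : c₁ * n0 ≤ c₁ * n := by gcongr
      rw [e] at e2
      linarith
    exact (small_x c₁ c₂ hc₁ n m j K hK (hn0 ▸ hnn) h800 h1 h2 hj x k hx hx2.le hk).trans (hB _ hcb)
  · refine (small_n n m j hn x k hx hk).trans (le_trans ?_ (hB _ hcc))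
    have hle : (n:ℝ) ≤ n0 := by exact_mod_cast hnn.le
    have hmM : m ≤ M := by
      have : (m:ℝ) ≤ M := h2.trans (le_trans (by gcongr) hM)
      exact_mod_cast this
    have hp : (n:ℝ)^m ≤ (n0:ℝ)^M := by
      calc (n:ℝ)^m ≤ (n0:ℝ)^m := by gcongr
        _ ≤ _ := by gcongr
    have : δ₂ * (n:ℝ)^m ≤ 1 := by
      rw [hδ₂, one_div_mul_eq_div, div_le_one (by positivity)]; exact hp
    linarith
end

section
/- Consider a $\sqrt{\mu} \times \sqrt{\mu}$ grid in which each cell independently contains $\mathrm{Pois}(1)$ blue dots and $\mathrm{Pois}(1)$ red dots. With probability $1 - o(1)$ as $\mu \to \infty$, there exists a monotone lattice path through the grid whose blue-red deviation is $\Omega(\sqrt{\mu \log \log \mu})$. -/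
open scoped Classical
open ProbabilityTheory

/-- Joint probability mass of a configuration of an `s × s` grid in which each cell
independently contains `Pois(1)` blue dots (first coordinate) and `Pois(1)` red dots
(second coordinate). -/
noncomputable def gridPMF {s : ℕ} (ω : Fin s × Fin s → ℕ × ℕ) : ℝ :=
  ∏ c : Fin s × Fin s, poissonPMFReal 1 (ω c).1 * poissonPMFReal 1 (ω c).2

/-- Blue-red deviation of the monotone lattice path encoded by the monotone column
heights `h : Fin s → ℕ` (cell `(row i, column j)` lies below the path iff `i < h j`). -/
noncomputable def pathDeviation {s : ℕ} (ω : Fin s × Fin s → ℕ × ℕ)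
    (h : Fin s → ℕ) : ℤ :=
  ∑ c : Fin s × Fin s,
    if (c.1 : ℕ) < h c.2 then ((ω c).1 : ℤ) - ((ω c).2 : ℤ) else 0

open MeasureTheory

/-- The standing assumptions on the field of independent centered variables. -/
structure GridSys {Ω : Type} [MeasurableSpace Ω] (μ : Measure Ω) (X : ℕ × ℕ → Ω → ℝ)
    (σ κ : ℝ) : Prop where
  meas : ∀ c, Measurable (X c)
  indep : iIndepFun X μ
  lp4 : ∀ c, MemLp (X c) 4 μ
  mean : ∀ c, ∫ ω, X c ω ∂μ = 0
  var : ∀ c, ∫ ω, X c ω ^ 2 ∂μ = σ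
  four : ∀ c, ∫ ω, X c ω ^ 4 ∂μ = κ
  pos : 0 < σ
  le : σ ^ 2 ≤ κ

set_option linter.unusedSectionVars false

/-- The σ-algebra generated by the cells in `B`. -/
@[reducible]
def cellSig {Ω : Type} (X : ℕ × ℕ → Ω → ℝ) (B : Set (ℕ × ℕ)) : MeasurableSpace Ω :=
  ⨆ c ∈ B, MeasurableSpace.comap (X c) inferInstance

section
variable {Ω : Type} [mΩ : MeasurableSpace Ω] {μ : Measure Ω} [IsProbabilityMeasure μ]
  {X : ℕ × ℕ → Ω → ℝ} {σ κ : ℝ}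

lemma cellSig_mono {A B : Set (ℕ × ℕ)} (h : A ⊆ B) : cellSig X A ≤ cellSig X B :=
  biSup_mono h

lemma GridSys.sig_le (H : GridSys μ X σ κ) (A : Set (ℕ × ℕ)) : cellSig X A ≤ mΩ :=
  iSup₂_le fun c _ => (H.meas c).comap_le

lemma meas_cell {A : Set (ℕ × ℕ)} {c : ℕ × ℕ} (hc : c ∈ A) : Measurable[cellSig X A] (X c) := by
  rw [measurable_iff_comap_le]
  exact le_iSup₂_of_le c hc le_rfl

lemma meas_sum {A : Set (ℕ × ℕ)} {R : Finset (ℕ × ℕ)} (h : (R : Set (ℕ × ℕ)) ⊆ A) :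
    Measurable[cellSig X A] (fun ω => ∑ c ∈ R, X c ω) := by
  refine Finset.measurable_fun_sum _ fun c hc => meas_cell (h hc)

lemma GridSys.indepFun (H : GridSys μ X σ κ) {A B : Set (ℕ × ℕ)} (h : Disjoint A B)
    {f g : Ω → ℝ} (hf : Measurable[cellSig X A] f) (hg : Measurable[cellSig X B] g) :
    IndepFun f g μ := by
  have := indep_iSup_of_disjoint (fun c => (H.meas c).comap_le) H.indep h
  exact indep_of_indep_of_le_left (indep_of_indep_of_le_right this hg.comap_le) hf.comap_le

lemma GridSys.mul_eq (H : GridSys μ X σ κ) {A B : Set (ℕ × ℕ)} (h : Disjoint A B)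
    {f g : Ω → ℝ} (hf : Measurable[cellSig X A] f) (hg : Measurable[cellSig X B] g) :
    ∫ ω, f ω * g ω ∂μ = (∫ ω, f ω ∂μ) * ∫ ω, g ω ∂μ :=
  (H.indepFun h hf hg).integral_fun_mul_eq_mul_integral
    (hf.mono (H.sig_le _) le_rfl).aestronglyMeasurable
    (hg.mono (H.sig_le _) le_rfl).aestronglyMeasurable

lemma GridSys.mul_int (H : GridSys μ X σ κ) {A B : Set (ℕ × ℕ)} (h : Disjoint A B)
    {f g : Ω → ℝ} (hf : Measurable[cellSig X A] f) (hg : Measurable[cellSig X B] g)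
    (hf' : Integrable f μ) (hg' : Integrable g μ) :
    Integrable (fun ω => f ω * g ω) μ :=
  (H.indepFun h hf hg).integrable_mul hf' hg'

lemma pow_int {f : Ω → ℝ} (hf : MemLp f 4 μ) {k : ℕ} (hk : k ≤ 4) :
    Integrable (fun ω => f ω ^ k) μ := by
  have h1 : MemLp f k μ := hf.mono_exponent (by exact_mod_cast hk)
  rcases Nat.eq_zero_or_pos k with rfl | h0
  · simp
  have h2 := h1.integrable_norm_pow h0.ne'
  refine (integrable_norm_iff (hf.1.pow k)).1 ?_
  simpa [norm_pow] using h2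

lemma int_three {f g h : Ω → ℝ} (hf : Integrable f μ) (hg : Integrable g μ)
    (hh : Integrable h μ) :
    ∫ x, (f x + g x + h x) ∂μ = ∫ x, f x ∂μ + ∫ x, g x ∂μ + ∫ x, h x ∂μ := by
  have := integral_add (hf.add hg) hh
  simp only [Pi.add_apply] at this
  rw [this, integral_add hf hg]

lemma int_five {f g h k l : Ω → ℝ} (hf : Integrable f μ) (hg : Integrable g μ)
    (hh : Integrable h μ) (hk : Integrable k μ) (hl : Integrable l μ) :
    ∫ x, (f x + g x + h x + k x + l x) ∂μ =
      ∫ x, f x ∂μ + ∫ x, g x ∂μ + ∫ x, h x ∂μ + ∫ x, k x ∂μ + ∫ x, l x ∂μ := by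
  have := int_three ((hf.add hg).add hh) hk hl
  simp only [Pi.add_apply] at this
  rw [this, int_three hf hg hh]

lemma GridSys.sum_moments (H : GridSys μ X σ κ) (R : Finset (ℕ × ℕ)) :
    MemLp (fun ω => ∑ c ∈ R, X c ω) 4 μ ∧ ∫ ω, (∑ c ∈ R, X c ω) ∂μ = 0 ∧
    ∫ ω, (∑ c ∈ R, X c ω) ^ 2 ∂μ = σ * R.card ∧
    ∫ ω, (∑ c ∈ R, X c ω) ^ 4 ∂μ ≤ 3 * κ * R.card ^ 2 := by
  induction R using Finset.induction_on with
  | empty => simp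
  | insert a R ha ih =>
    obtain ⟨i1, i2, i3, i4⟩ := ih
    have hd : Disjoint ((R : Set (ℕ × ℕ))) {a} := by simpa using ha
    have mS : Measurable[cellSig X R] (fun ω => ∑ c ∈ R, X c ω) := meas_sum le_rfl
    have mD : Measurable[cellSig X {a}] (X a) := meas_cell rfl
    simp only [Finset.sum_insert ha, Finset.card_insert_of_notMem ha]
    set S := fun ω => ∑ c ∈ R, X c ω with hS
    have e : ∀ j k : ℕ, ∫ ω, S ω ^ j * X a ω ^ k ∂μ = (∫ ω, S ω ^ j ∂μ) * ∫ ω, X a ω ^ k ∂μ :=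
      fun j k => H.mul_eq hd (mS.pow_const j) (mD.pow_const k)
    have ii : ∀ j k : ℕ, j ≤ 4 → k ≤ 4 → Integrable (fun ω => S ω ^ j * X a ω ^ k) μ :=
      fun j k hj hk => H.mul_int hd (mS.pow_const j) (mD.pow_const k) (pow_int i1 hj)
        (pow_int (H.lp4 a) hk)
    have v := H.var a
    have f4 := H.four a
    have m := H.mean a
    refine ⟨(H.lp4 a).add i1, ?_, ?_, ?_⟩
    · rw [integral_add ((H.lp4 a).integrable (by norm_num)) (i1.integrable (by norm_num)), m, i2]
      simp
    · have : ∀ ω, (X a ω + S ω) ^ 2 = S ω ^ 0 * X a ω ^ 2 + 2 * (S ω ^ 1 * X a ω ^ 1)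
          + S ω ^ 2 * X a ω ^ 0 := fun ω => by ring
      change ∫ ω, (X a ω + S ω) ^ 2 ∂μ = _
      rw [integral_congr_ae (ae_of_all _ this), int_three (ii 0 2 (by norm_num) (by norm_num))
        ((ii 1 1 (by norm_num) (by norm_num)).const_mul 2) (ii 2 0 (by norm_num) (by norm_num)),
        integral_const_mul, e, e, e]
      change ∫ ω, S ω ^ 2 ∂μ = _ at i3
      simp [m, v, i3]
      ring
    · have : ∀ ω, (X a ω + S ω) ^ 4 = S ω ^ 0 * X a ω ^ 4 + 4 * (S ω ^ 1 * X a ω ^ 3)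
          + 6 * (S ω ^ 2 * X a ω ^ 2) + 4 * (S ω ^ 3 * X a ω ^ 1)
          + S ω ^ 4 * X a ω ^ 0 := fun ω => by ring
      have j0 := ii 0 4 (by norm_num) (by norm_num)
      have j1 := (ii 1 3 (by norm_num) (by norm_num)).const_mul 4
      have j2 := (ii 2 2 (by norm_num) (by norm_num)).const_mul 6
      have j3 := (ii 3 1 (by norm_num) (by norm_num)).const_mul 4
      have j4 := (ii 4 0 (by norm_num) (by norm_num))
      change ∫ ω, (X a ω + S ω) ^ 4 ∂μ ≤ _
      rw [integral_congr_ae (ae_of_all _ this), int_five j0 j1 j2 j3 j4]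
      change ∫ ω, S ω ^ 2 ∂μ = _ at i3
      change ∫ ω, S ω ^ 4 ∂μ ≤ _ at i4
      simp only [integral_const_mul]
      rw [e, e, e, e, e]
      simp only [pow_one, m, v, i3, f4, i2, pow_zero]
      have := H.le
      have hN : (0:ℝ) ≤ R.card := by positivity
      simp
      nlinarith [sq_nonneg σ]

/-- Lower bound for the mean positive part of a sum over `R`. -/
lemma GridSys.pos_part (H : GridSys μ X σ κ) :
    ∃ c > 0, ∀ R : Finset (ℕ × ℕ),
      c * Real.sqrt R.card ≤ ∫ ω, max (∑ c ∈ R, X c ω) 0 ∂μ := by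
  have hκ : 0 < κ := lt_of_lt_of_le (pow_pos H.pos 2) H.le
  -- choose `α` with `α ^ 2 = 3 κ / (2 σ)`
  obtain ⟨α, hα, hα2⟩ : ∃ α : ℝ, 0 < α ∧ α ^ 2 = 3 * κ / (2 * σ) := by
    have hq : 0 < 3 * κ / (2 * σ) := by have := H.pos; positivity
    exact ⟨Real.sqrt (3 * κ / (2 * σ)), Real.sqrt_pos.2 hq, Real.sq_sqrt hq.le⟩
  refine ⟨σ / (4 * α), div_pos H.pos (by positivity), fun R => ?_⟩
  obtain ⟨i1, i2, i3, i4⟩ := H.sum_moments R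
  set S := fun ω => ∑ c ∈ R, X c ω with hS
  rcases Nat.eq_zero_or_pos R.card with h0 | h0
  · rw [h0]; simp
    exact integral_nonneg fun ω => le_max_right _ _
  set N : ℝ := (R.card : ℝ) with hN
  have hNp : 0 < N := by rw [hN]; exact_mod_cast h0
  set t := Real.sqrt N with ht
  have htp : 0 < t := Real.sqrt_pos.2 hNp
  have ht2 : t ^ 2 = N := Real.sq_sqrt hNp.le
  set a := α * t with ha
  have hap : 0 < a := by positivity
  have hpt : ∀ ω, S ω / 2 + (1 / (2 * a)) * S ω ^ 2 - (1 / (8 * a ^ 3)) * S ω ^ 4 ≤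
      max (S ω) 0 := by
    intro ω
    have key : ∀ u : ℝ, u / 2 + u ^ 2 / 2 - u ^ 4 / 8 ≤ max u 0 := by
      intro u
      rcases le_total 0 u with hu | hu
      · rw [max_eq_left hu]
        have : 0 ≤ 1 - u + u ^ 3 / 4 := by
          nlinarith [mul_nonneg hu (sq_nonneg (u - 1)), sq_nonneg (u - 1), sq_nonneg (u-5/4), mul_nonneg hu (sq_nonneg (u - 6/5))]
        nlinarith [mul_nonneg hu this]
      · rw [max_eq_right hu]
        have : 0 ≤ 1 - (-u) + (-u) ^ 3 / 4 := by
          have hu' : 0 ≤ -u := by linarith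
          nlinarith [mul_nonneg hu' (sq_nonneg (-u - 1)), sq_nonneg (-u - 1), sq_nonneg (-u-5/4), mul_nonneg hu' (sq_nonneg (-u - 6/5))]
        nlinarith [mul_nonneg (neg_nonneg.2 hu) this]
    have := mul_le_mul_of_nonneg_left (key (S ω / a)) hap.le
    have e1 : a * max (S ω / a) 0 = max (S ω) 0 := by
      rw [mul_max_of_nonneg _ _ hap.le, mul_zero]; congr 1; field_simp
    rw [e1] at this
    refine le_trans (le_of_eq ?_) this
    field_simp
  have hi1 : Integrable S μ := i1.integrable (by norm_num)
  have hi2 : Integrable (fun ω => S ω ^ 2) μ := pow_int i1 (by norm_num)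
  have hi4 : Integrable (fun ω => S ω ^ 4) μ := pow_int i1 (by norm_num)
  have hle : ∫ ω, (S ω / 2 + (1 / (2 * a)) * S ω ^ 2 - (1 / (8 * a ^ 3)) * S ω ^ 4) ∂μ ≤
      ∫ ω, max (S ω) 0 ∂μ := by
    refine integral_mono (((hi1.div_const 2).add (hi2.const_mul _)).sub (hi4.const_mul _))
      (hi1.sup (integrable_zero _ _ _)) hpt
  have hsplit := int_three (hi1.div_const 2) (hi2.const_mul (1 / (2 * a)))
    (hi4.const_mul (1 / (8 * a ^ 3))).neg
  simp only [Pi.neg_apply, ← sub_eq_add_neg, integral_neg, integral_div, integral_const_mul]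
    at hsplit
  rw [hsplit] at hle
  change ∫ ω, S ω ∂μ = 0 at i2
  change ∫ ω, S ω ^ 2 ∂μ = _ at i3
  change ∫ ω, S ω ^ 4 ∂μ ≤ _ at i4
  rw [i2, i3] at hle
  refine le_trans ?_ hle
  have h8 : 1 / (8 * a ^ 3) * ∫ ω, S ω ^ 4 ∂μ ≤ 1 / (8 * a ^ 3) * (3 * κ * N ^ 2) :=
    mul_le_mul_of_nonneg_left i4 (by positivity)
  have hσ := H.pos
  have e3 : 3 * κ = 2 * σ * α ^ 2 := by rw [hα2]; field_simp
  have : 1 / (8 * a ^ 3) * (3 * κ * N ^ 2) = σ / (4 * α) * t := by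
    rw [e3, ← ht2, ha]; field_simp; norm_num
  have e5 : 1 / (2 * a) * (σ * N) = 2 * (σ / (4 * α) * t) := by
    rw [← ht2, ha]; field_simp; norm_num
  rw [e5]; linarith

/-- A centered square integrable variable depending only on the cells of `A`,
with second moment at most `v`. -/
def NiceVar (μ : Measure Ω) (X : ℕ × ℕ → Ω → ℝ) (A : Set (ℕ × ℕ)) (f : Ω → ℝ) (v : ℝ) : Prop :=
  Measurable[cellSig X A] f ∧ MemLp f 2 μ ∧ ∫ ω, f ω ∂μ = 0 ∧ ∫ ω, f ω ^ 2 ∂μ ≤ v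

lemma NiceVar.mono {A B : Set (ℕ × ℕ)} {f : Ω → ℝ} {v w : ℝ} (h : NiceVar μ X A f v)
    (hAB : A ⊆ B) (hvw : v ≤ w) : NiceVar μ X B f w :=
  ⟨h.1.mono (cellSig_mono hAB) le_rfl, h.2.1, h.2.2.1, h.2.2.2.trans hvw⟩

lemma niceVar_zero (A : Set (ℕ × ℕ)) : NiceVar μ X A (fun _ => 0) 0 :=
  ⟨measurable_const, MemLp.zero, by simp, by simp⟩

lemma NiceVar.add (H : GridSys μ X σ κ) {A B : Set (ℕ × ℕ)} {f g : Ω → ℝ} {v w : ℝ}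
    (hf : NiceVar μ X A f v) (hg : NiceVar μ X B g w) (hAB : Disjoint A B) :
    NiceVar μ X (A ∪ B) (fun ω => f ω + g ω) (v + w) := by
  obtain ⟨f1, f2, f3, f4⟩ := hf
  obtain ⟨g1, g2, g3, g4⟩ := hg
  refine ⟨(f1.mono (cellSig_mono Set.subset_union_left) le_rfl).add
    (g1.mono (cellSig_mono Set.subset_union_right) le_rfl), f2.add g2, ?_, ?_⟩
  · rw [integral_add (f2.integrable (by norm_num)) (g2.integrable (by norm_num)), f3, g3, add_zero]
  · have : ∀ ω, (f ω + g ω) ^ 2 = f ω ^ 2 + 2 * (f ω * g ω) + g ω ^ 2 := fun ω => by ring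
    rw [integral_congr_ae (ae_of_all _ this), int_three f2.integrable_sq
      ((H.mul_int hAB f1 g1 (f2.integrable (by norm_num)) (g2.integrable (by norm_num))).const_mul 2)
      g2.integrable_sq, integral_const_mul, H.mul_eq hAB f1 g1, f3]
    linarith

lemma NiceVar.sum (H : GridSys μ X σ κ) {A : ℕ → Set (ℕ × ℕ)} {f : ℕ → Ω → ℝ} {v : ℝ} (q : ℕ)
    (hf : ∀ i, NiceVar μ X (A i) (f i) v) (hA : ∀ i j, i < j → Disjoint (A i) (A j)) :
    NiceVar μ X (⋃ i < q, A i) (fun ω => ∑ i ∈ Finset.range q, f i ω) (q * v) := by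
  induction q with
  | zero => simpa using niceVar_zero _
  | succ q ih =>
    simp only [Finset.sum_range_succ]
    refine (ih.add H (hf q) ?_).mono ?_ ?_
    · simp only [Set.disjoint_iUnion_left]
      exact fun i hi => hA i q hi
    · refine Set.union_subset ?_ ?_
      · exact Set.biUnion_mono (fun i (hi : i < q) => (Nat.lt_succ_of_lt hi : i < q + 1))
          fun _ _ => le_rfl
      · exact Set.subset_biUnion_of_mem (u := A) (show q < q + 1 from Nat.lt_succ_self q)
    · push_cast; linarith

lemma niceVar_cells (H : GridSys μ X σ κ) (R : Finset (ℕ × ℕ)) :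
    NiceVar μ X R (fun ω => ∑ c ∈ R, X c ω) (σ * R.card) := by
  obtain ⟨i1, i2, i3, i4⟩ := H.sum_moments R
  exact ⟨meas_sum le_rfl, i1.mono_exponent (by norm_num), i2, i3.le⟩

lemma NiceVar.select (H : GridSys μ X σ κ) {A B : Set (ℕ × ℕ)} {S f g : Ω → ℝ} {s v : ℝ}
    (hS : NiceVar μ X A S s)
    (hf : NiceVar μ X B f v) (hg : NiceVar μ X B g v) (hAB : Disjoint A B) :
    NiceVar μ X (A ∪ B) (fun ω => (max (S ω) 0 - ∫ ω, max (S ω) 0 ∂μ) +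
      (if 0 ≤ S ω then f ω else g ω)) (s + v) := by
  obtain ⟨f1, f2, f3, f4⟩ := hf
  obtain ⟨g1, g2, g3, g4⟩ := hg
  obtain ⟨s1, s2, s3, s4⟩ := hS
  set e := ∫ ω, max (S ω) 0 ∂μ with he
  set Z : Ω → ℝ := fun ω => max (S ω) 0 - e with hZ
  set p : Ω → ℝ := fun ω => if 0 ≤ S ω then 1 else 0 with hp
  set n : Ω → ℝ := fun ω => if 0 ≤ S ω then 0 else 1 with hn
  have hP : MemLp (fun ω => max (S ω) 0) 2 μ := s2.sup MemLp.zero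
  have mset : MeasurableSet[cellSig X A] {ω | 0 ≤ S ω} :=
    s1 measurableSet_Ici
  have mp : Measurable[cellSig X A] p := Measurable.ite mset measurable_const measurable_const
  have mn : Measurable[cellSig X A] n := Measurable.ite mset measurable_const measurable_const
  have mZ : Measurable[cellSig X A] Z := (s1.max measurable_const).sub_const _
  have lZ : MemLp Z 2 μ := hP.sub (memLp_const e)
  have EZ : ∫ ω, Z ω ∂μ = 0 := by
    rw [hZ, integral_sub (hP.integrable (by norm_num)) (integrable_const _)]
    simp [he]
  have up : ∀ ω, ‖p ω‖ ≤ 1 := fun ω => by simp only [hp]; split_ifs <;> simp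
  have un : ∀ ω, ‖n ω‖ ≤ 1 := fun ω => by simp only [hn]; split_ifs <;> simp
  have ap := (mp.mono (H.sig_le _) le_rfl).aestronglyMeasurable (μ := μ)
  have an := (mn.mono (H.sig_le _) le_rfl).aestronglyMeasurable (μ := μ)
  have ip : Integrable p μ := Integrable.of_bound ap 1 (ae_of_all _ up)
  have i_n : Integrable n μ := Integrable.of_bound an 1 (ae_of_all _ un)
  have iZ : Integrable Z μ := lZ.integrable (by norm_num)
  have jf : Integrable f μ := f2.integrable (by norm_num)
  have jg : Integrable g μ := g2.integrable (by norm_num)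
  have iZp : Integrable (fun ω => Z ω * p ω) μ := iZ.mul_bdd ap (ae_of_all _ up)
  have iZn : Integrable (fun ω => Z ω * n ω) μ := iZ.mul_bdd an (ae_of_all _ un)
  have mZp : Measurable[cellSig X A] (fun ω => Z ω * p ω) := mZ.mul mp
  have mZn : Measurable[cellSig X A] (fun ω => Z ω * n ω) := mZ.mul mn
  have hpn : ∫ ω, p ω ∂μ + ∫ ω, n ω ∂μ = 1 := by
    rw [← integral_add ip i_n]
    have : ∀ ω, p ω + n ω = 1 := fun ω => by simp only [hp, hn]; split_ifs <;> simp
    simp [this]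
  have p0 : 0 ≤ ∫ ω, p ω ∂μ := integral_nonneg fun ω => by
    simp only [hp]; split_ifs <;> simp
  have n0 : 0 ≤ ∫ ω, n ω ∂μ := integral_nonneg fun ω => by
    simp only [hn]; split_ifs <;> simp
  have eV : (fun ω => (max (S ω) 0 - e) + (if 0 ≤ S ω then f ω else g ω)) =
      fun ω => Z ω + p ω * f ω + n ω * g ω := by
    funext ω
    simp only [hZ, hp, hn]; split_ifs <;> simp
  rw [eV]
  have lpf : MemLp (fun ω => p ω * f ω) 2 μ := by
    refine f2.mono (ap.mul f2.1) (ae_of_all _ fun ω => ?_)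
    rw [norm_mul]
    exact mul_le_of_le_one_left (norm_nonneg _) (up ω)
  have lng : MemLp (fun ω => n ω * g ω) 2 μ := by
    refine g2.mono (an.mul g2.1) (ae_of_all _ fun ω => ?_)
    rw [norm_mul]
    exact mul_le_of_le_one_left (norm_nonneg _) (un ω)
  have LA : cellSig X A ≤ cellSig X (A ∪ B) := cellSig_mono Set.subset_union_left
  have LB : cellSig X B ≤ cellSig X (A ∪ B) := cellSig_mono Set.subset_union_right
  refine ⟨((mZ.mono LA le_rfl).add ((mp.mono LA le_rfl).mul (f1.mono LB le_rfl))).add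
    ((mn.mono LA le_rfl).mul (g1.mono LB le_rfl)), (lZ.add lpf).add lng, ?_, ?_⟩
  · rw [int_three iZ (lpf.integrable (by norm_num)) (lng.integrable (by norm_num)),
      H.mul_eq hAB mp f1, H.mul_eq hAB mn g1, f3, g3, EZ]
    simp
  · have : ∀ ω, (Z ω + p ω * f ω + n ω * g ω) ^ 2 = Z ω ^ 2 + 2 * ((Z ω * p ω) * f ω)
        + 2 * ((Z ω * n ω) * g ω) + p ω * f ω ^ 2 + n ω * g ω ^ 2 := by
      intro ω
      simp only [hp, hn]; split_ifs <;> ring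
    rw [integral_congr_ae (ae_of_all _ this), int_five lZ.integrable_sq
      ((H.mul_int hAB mZp f1 iZp jf).const_mul 2)
      ((H.mul_int hAB mZn g1 iZn jg).const_mul 2)
      (H.mul_int hAB mp (f1.pow_const 2) ip f2.integrable_sq)
      (H.mul_int hAB mn (g1.pow_const 2) i_n g2.integrable_sq), integral_const_mul,
      integral_const_mul, H.mul_eq hAB mZp f1, H.mul_eq hAB mZn g1, f3, g3,
      H.mul_eq hAB mp (f1.pow_const 2), H.mul_eq hAB mn (g1.pow_const 2)]
    have hZ2 : ∫ ω, Z ω ^ 2 ∂μ ≤ s := by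
      have h1 : ∀ ω, Z ω ^ 2 ≤ S ω ^ 2 - 2 * e * Z ω := by
        intro ω
        simp only [hZ]
        have : (max (S ω) 0) ^ 2 ≤ S ω ^ 2 := by
          rcases le_total 0 (S ω) with h | h
          · rw [max_eq_left h]
          · rw [max_eq_right h]; nlinarith [sq_nonneg (S ω)]
        nlinarith [sq_nonneg e]
      have h2 := integral_mono lZ.integrable_sq (s2.integrable_sq.sub (iZ.const_mul (2 * e))) h1
      simp only [Pi.sub_apply] at h2
      rw [integral_sub s2.integrable_sq (iZ.const_mul (2 * e)), integral_const_mul, EZ] at h2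
      linarith
    have k1 := mul_le_mul_of_nonneg_left f4 p0
    have k2 := mul_le_mul_of_nonneg_left g4 n0
    have k3 : (∫ ω, p ω ∂μ) * v + (∫ ω, n ω ∂μ) * v = v := by rw [← add_mul, hpn, one_mul]
    linarith

/-- The cells in columns `[a, b)` between the heights `lo` and `hi`. -/
def cellReg (a b : ℕ) (lo hi : ℕ → ℕ) : Finset (ℕ × ℕ) :=
  ((Finset.Ico a b).sigma fun x => Finset.Ico (lo x) (hi x)).map
    (Equiv.sigmaEquivProd ℕ ℕ).toEmbedding

lemma mem_cellReg {a b : ℕ} {lo hi : ℕ → ℕ} {c : ℕ × ℕ} :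
    c ∈ cellReg a b lo hi ↔ (a ≤ c.1 ∧ c.1 < b) ∧ lo c.1 ≤ c.2 ∧ c.2 < hi c.1 := by
  simp only [cellReg, Finset.mem_map_equiv, Finset.mem_sigma, Finset.mem_Ico,
    Equiv.sigmaEquivProd_symm_apply]

lemma sum_cellReg {a b : ℕ} {lo hi : ℕ → ℕ} (f : ℕ × ℕ → ℝ) :
    ∑ c ∈ cellReg a b lo hi, f c =
      ∑ x ∈ Finset.Ico a b, ∑ y ∈ Finset.Ico (lo x) (hi x), f (x, y) := by
  refine Finset.sum_finset_product _ _ _ fun p => ?_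
  simp [mem_cellReg]

lemma card_cellReg {a b : ℕ} {lo hi : ℕ → ℕ} :
    (cellReg a b lo hi).card = ∑ x ∈ Finset.Ico a b, (hi x - lo x) := by
  simp [cellReg]

lemma sum_blocks (g : ℕ → ℝ) (x₀ w q : ℕ) :
    ∑ x ∈ Finset.Ico x₀ (x₀ + q * w), g x =
      ∑ i ∈ Finset.range q, ∑ x ∈ Finset.Ico (x₀ + i * w) (x₀ + i * w + w), g x := by
  induction q with
  | zero => simp
  | succ q ih =>
    rw [Finset.sum_range_succ, ← ih,
      show x₀ + (q + 1) * w = x₀ + q * w + w by ring,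
      Finset.sum_Ico_consecutive _ (by omega) (by omega)]

/-- The cells of a box of width `w` and height `T`. -/
def boxSet (x₀ y₀ w T : ℕ) : Set (ℕ × ℕ) :=
  {c | x₀ ≤ c.1 ∧ c.1 < x₀ + w ∧ y₀ ≤ c.2 ∧ c.2 < y₀ + T}

/-- There are strategies for boxes of size `w × T` with mean gain `M` and variance at most `v`. -/
def Strat (μ : Measure Ω) (X : ℕ × ℕ → Ω → ℝ) (w T : ℕ) (M v : ℝ) : Prop :=
  ∀ x₀ y₀ : ℕ, ∃ V : Ω → ℝ, NiceVar μ X (boxSet x₀ y₀ w T) V v ∧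
    ∀ ω, ∃ h : ℕ → ℕ, Monotone h ∧ (∀ x, y₀ ≤ h x ∧ h x ≤ y₀ + T) ∧
      V ω + M ≤ ∑ x ∈ Finset.Ico x₀ (x₀ + w), ∑ y ∈ Finset.Ico y₀ (h x), X (x, y) ω

lemma blk_div {x₀ w i x : ℕ} (h1 : x₀ + i * w ≤ x) (h2 : x < x₀ + i * w + w) :
    (x - x₀) / w = i := by
  apply Nat.div_eq_of_lt_le
  · omega
  · rw [Nat.succ_mul]; omega

/-- Diagonal chain of sub-boxes. -/
lemma Strat.chain (H : GridSys μ X σ κ) {w T q : ℕ} {M v : ℝ} (hS : Strat μ X w T M v)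
    (hq : 1 ≤ q) (hw : 1 ≤ w) (d' d : ℕ) (hd : d' ≤ d) (hdT : d' ≤ T) (x₀ y₀ : ℕ) :
    ∃ Y : Ω → ℝ, NiceVar μ X {c | x₀ ≤ c.1 ∧ c.1 < x₀ + q * w ∧ y₀ ≤ c.2 ∧
        (c.2 < y₀ + (c.1 - x₀) / w * T + d' ∨
          (y₀ + (c.1 - x₀) / w * T + d ≤ c.2 ∧ c.2 < y₀ + (c.1 - x₀) / w * T + d + T))}
        Y (σ * (q * w * (q * T)) + q * v) ∧
      ∀ ω, ∃ h : ℕ → ℕ, Monotone h ∧ (∀ x, y₀ ≤ h x ∧ h x ≤ y₀ + q * T + d) ∧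
        (∀ x, x₀ ≤ x → x < x₀ + q * w → y₀ + (x - x₀) / w * T + d ≤ h x) ∧
        Y ω + q * M ≤ ∑ x ∈ Finset.Ico x₀ (x₀ + q * w),
          (∑ y ∈ Finset.Ico y₀ (y₀ + (x - x₀) / w * T + d'), X (x, y) ω +
            ∑ y ∈ Finset.Ico (y₀ + (x - x₀) / w * T + d) (h x), X (x, y) ω) := by
  choose V hV hh using fun i : ℕ => hS (x₀ + i * w) (y₀ + i * T + d)
  set R := cellReg x₀ (x₀ + q * w) (fun _ => y₀) (fun x => y₀ + (x - x₀) / w * T + d') with hR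
  have hdivlt : ∀ x, x < x₀ + q * w → (x - x₀) / w < q := by
    intro x hx
    rw [Nat.div_lt_iff_lt_mul hw]
    rcases Nat.eq_zero_or_pos (q * w) with h | h
    · have := Nat.mul_pos hq hw; omega
    · omega
  have hcard : (R.card : ℝ) ≤ q * w * (q * T) := by
    rw [hR, card_cellReg]
    have : ∑ x ∈ Finset.Ico x₀ (x₀ + q * w), (y₀ + (x - x₀) / w * T + d' - y₀) ≤
        ∑ x ∈ Finset.Ico x₀ (x₀ + q * w), q * T := by
      refine Finset.sum_le_sum fun x hx => ?_
      rw [Finset.mem_Ico] at hx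
      have h1 : ((x - x₀) / w + 1) * T ≤ q * T := Nat.mul_le_mul_right _ (hdivlt x hx.2)
      rw [Nat.succ_mul] at h1
      omega
    rw [Finset.sum_const, Nat.card_Ico, smul_eq_mul, Nat.add_sub_cancel_left] at this
    exact_mod_cast this
  have hsum := NiceVar.sum H q hV (by
    intro i j hij
    rw [Set.disjoint_left]
    rintro c ⟨a1, a2, -, -⟩ ⟨b1, b2, -, -⟩
    have : (i + 1) * w ≤ j * w := Nat.mul_le_mul_right _ hij
    rw [Nat.succ_mul] at this
    omega)
  refine ⟨fun ω => ∑ c ∈ R, X c ω + ∑ i ∈ Finset.range q, V i ω,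
    ((niceVar_cells H R).add H hsum ?_).mono ?_ ?_, fun ω => ?_⟩
  · rw [Set.disjoint_left]
    intro c hc hc'
    simp only [Set.mem_iUnion] at hc'
    obtain ⟨i, hi, b1, b2, b3, b4⟩ := hc'
    have hc2 := mem_cellReg.1 (Finset.mem_coe.1 hc)
    rw [blk_div b1 b2] at hc2
    omega
  · refine Set.union_subset ?_ ?_
    · intro c hc
      have hc2 := mem_cellReg.1 (Finset.mem_coe.1 hc)
      exact ⟨hc2.1.1, hc2.1.2, hc2.2.1, Or.inl hc2.2.2⟩
    · intro c hc
      simp only [Set.mem_iUnion] at hc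
      obtain ⟨i, hi, b1, b2, b3, b4⟩ := hc
      have : (i + 1) * w ≤ q * w := Nat.mul_le_mul_right _ hi
      rw [Nat.succ_mul] at this
      refine ⟨by omega, by omega, by omega, Or.inr ?_⟩
      rw [blk_div b1 b2]
      exact ⟨b3, b4⟩
  · have := mul_le_mul_of_nonneg_left hcard H.pos.le
    linarith
  · choose h h1 h2 h3 using fun i => hh i ω
    have hidx : ∀ x, x₀ ≤ x → x < x₀ + q * w → min ((x - x₀) / w) (q - 1) = (x - x₀) / w := by
      intro x _ hx
      have := hdivlt x hx
      omega
    refine ⟨fun x => h (min ((x - x₀) / w) (q - 1)) x, ?_, ?_, ?_, ?_⟩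
    · intro x x' hxx
      have hi : min ((x - x₀) / w) (q - 1) ≤ min ((x' - x₀) / w) (q - 1) :=
        min_le_min_right _ (Nat.div_le_div_right (by omega))
      change h (min ((x - x₀) / w) (q - 1)) x ≤ h (min ((x' - x₀) / w) (q - 1)) x'
      generalize min ((x - x₀) / w) (q - 1) = i at *
      generalize min ((x' - x₀) / w) (q - 1) = j at *
      rcases hi.eq_or_lt with rfl | hlt
      · exact h1 _ hxx
      · refine (h2 i x).2.trans (le_trans ?_ (h2 j x').1)
        have : (i + 1) * T ≤ j * T := Nat.mul_le_mul_right _ hlt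
        rw [Nat.succ_mul] at this
        omega
    · intro x
      have hi : min ((x - x₀) / w) (q - 1) + 1 ≤ q := by omega
      change y₀ ≤ h (min ((x - x₀) / w) (q - 1)) x ∧ h (min ((x - x₀) / w) (q - 1)) x ≤ _
      generalize min ((x - x₀) / w) (q - 1) = i at *
      have := h2 i x
      have h4 : (i + 1) * T ≤ q * T := Nat.mul_le_mul_right _ hi
      rw [Nat.succ_mul] at h4
      omega
    · intro x hx hx'
      change _ ≤ h (min ((x - x₀) / w) (q - 1)) x
      rw [hidx x hx hx']
      exact (h2 _ x).1
    · rw [Finset.sum_add_distrib]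
      beta_reduce
      rw [hR, sum_cellReg]
      have e2 : ∑ i ∈ Finset.range q, V i ω + q * M ≤
          ∑ x ∈ Finset.Ico x₀ (x₀ + q * w),
            ∑ y ∈ Finset.Ico (y₀ + (x - x₀) / w * T + d)
              (h (min ((x - x₀) / w) (q - 1)) x), X (x, y) ω := by
        rw [sum_blocks]
        have : ∑ i ∈ Finset.range q, V i ω + q * M = ∑ i ∈ Finset.range q, (V i ω + M) := by
          rw [Finset.sum_add_distrib]; simp
        rw [this]
        refine Finset.sum_le_sum fun i hi => (h3 i).trans (le_of_eq ?_)
        refine Finset.sum_congr rfl fun x hx => ?_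
        rw [Finset.mem_Ico] at hx
        rw [Finset.mem_range] at hi
        rw [blk_div hx.1 hx.2, min_eq_left (by omega)]
      linarith

lemma Strat.step (H : GridSys μ X σ κ) {w T q r : ℕ} {M v c : ℝ} (hS : Strat μ X w T M v)
    (hc : ∀ R : Finset (ℕ × ℕ), c * Real.sqrt R.card ≤ ∫ ω, max (∑ c ∈ R, X c ω) 0 ∂μ)
    (hq : 1 ≤ q) (hw : 1 ≤ w) :
    Strat μ X (q * w) ((q + 1) * T + r) (q * M + c * Real.sqrt (q * w * r))
      (q * v + σ * (q * w * ((q + 1) * T + r))) := by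
  intro x₀ y₀
  obtain ⟨Yu, hYu, hu⟩ := hS.chain H hq hw T (T + r) (by omega) le_rfl x₀ y₀
  obtain ⟨Yl, hYl, hl⟩ := hS.chain H hq hw 0 0 le_rfl (by omega) x₀ y₀
  set R := cellReg x₀ (x₀ + q * w) (fun x => y₀ + (x - x₀) / w * T + T)
    (fun x => y₀ + (x - x₀) / w * T + (T + r)) with hR
  have hcard : R.card = q * w * r := by
    rw [hR, card_cellReg]
    have : ∀ x ∈ Finset.Ico x₀ (x₀ + q * w),
      (y₀ + (x - x₀) / w * T + (T + r) - (y₀ + (x - x₀) / w * T + T)) = r := fun x _ => by omega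
    rw [Finset.sum_congr rfl this]
    simp
  have hdivlt : ∀ x, x < x₀ + q * w → (x - x₀) / w < q := by
    intro x hx
    rw [Nat.div_lt_iff_lt_mul hw]
    have := Nat.mul_pos hq hw; omega
  have hmul : ∀ x, x < x₀ + q * w → (x - x₀) / w * T + T ≤ q * T := by
    intro x hx
    have := Nat.mul_le_mul_right T (hdivlt x hx)
    rwa [Nat.succ_mul] at this
  set B : Set (ℕ × ℕ) := boxSet x₀ y₀ (q * w) ((q + 1) * T + r) \ (R : Set (ℕ × ℕ)) with hB
  have hqT : (q + 1) * T = q * T + T := by ring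
  have hRbox : (R : Set (ℕ × ℕ)) ⊆ boxSet x₀ y₀ (q * w) ((q + 1) * T + r) := by
    intro z hz
    have hz2 := mem_cellReg.1 (Finset.mem_coe.1 hz)
    have := hmul z.1 hz2.1.2
    refine ⟨hz2.1.1, hz2.1.2, by omega, by omega⟩
  have nu := hYu.mono (B := B) (by
    rintro z ⟨z1, z2, z3, z4⟩
    have := hmul z.1 z2
    refine ⟨⟨z1, z2, z3, by omega⟩, fun hz => ?_⟩
    have hz2 := mem_cellReg.1 (Finset.mem_coe.1 hz)
    omega) le_rfl
  have nl := hYl.mono (B := B) (by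
    rintro z ⟨z1, z2, z3, z4⟩
    have := hmul z.1 z2
    refine ⟨⟨z1, z2, z3, by omega⟩, fun hz => ?_⟩
    have hz2 := mem_cellReg.1 (Finset.mem_coe.1 hz)
    omega) le_rfl
  have key := (niceVar_cells H R).select H nu nl Set.disjoint_sdiff_right
  have hce := hc R
  have hcr : (R.card : ℝ) = q * w * r := by rw [hcard]; push_cast; ring
  refine ⟨_, key.mono (Set.union_subset hRbox Set.sdiff_subset) ?_, fun ω => ?_⟩
  · rw [hcr]
    have : 0 ≤ σ * (q * w * T) := mul_nonneg H.pos.le (by positivity)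
    nlinarith
  · rw [hcr] at hce
    set e := ∫ ω, max (∑ c ∈ R, X c ω) 0 ∂μ with he
    by_cases h0 : 0 ≤ ∑ c ∈ R, X c ω
    · obtain ⟨h, h1, h2, h3, h4⟩ := hu ω
      refine ⟨h, h1, fun x => ?_, ?_⟩
      · have := h2 x; omega
      · simp only [h0, if_true, max_eq_left h0]
        have e1 : ∑ x ∈ Finset.Ico x₀ (x₀ + q * w), ∑ y ∈ Finset.Ico y₀ (h x), X (x, y) ω =
            ∑ c ∈ R, X c ω + ∑ x ∈ Finset.Ico x₀ (x₀ + q * w),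
          (∑ y ∈ Finset.Ico y₀ (y₀ + (x - x₀) / w * T + T), X (x, y) ω +
            ∑ y ∈ Finset.Ico (y₀ + (x - x₀) / w * T + (T + r)) (h x), X (x, y) ω) := by
          rw [hR, sum_cellReg, ← Finset.sum_add_distrib]
          refine Finset.sum_congr rfl fun x hx => ?_
          rw [Finset.mem_Ico] at hx
          have := h3 x hx.1 hx.2
          rw [← Finset.sum_Ico_consecutive _
            (show y₀ ≤ y₀ + (x - x₀) / w * T + T by omega)
            (show y₀ + (x - x₀) / w * T + T ≤ h x by omega),
            ← Finset.sum_Ico_consecutive _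
            (show y₀ + (x - x₀) / w * T + T ≤ y₀ + (x - x₀) / w * T + (T + r) by omega) this]
          ring
        rw [e1]
        linarith
    · obtain ⟨h, h1, h2, h3, h4⟩ := hl ω
      refine ⟨h, h1, fun x => ?_, ?_⟩
      · have := h2 x; omega
      · simp only [h0, if_false, max_eq_right (not_le.1 h0).le]
        have e1 : ∑ x ∈ Finset.Ico x₀ (x₀ + q * w), ∑ y ∈ Finset.Ico y₀ (h x), X (x, y) ω =
            ∑ x ∈ Finset.Ico x₀ (x₀ + q * w),
          (∑ y ∈ Finset.Ico y₀ (y₀ + (x - x₀) / w * T + 0), X (x, y) ω +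
            ∑ y ∈ Finset.Ico (y₀ + (x - x₀) / w * T + 0) (h x), X (x, y) ω) := by
          refine Finset.sum_congr rfl fun x hx => ?_
          rw [Finset.mem_Ico] at hx
          have := h3 x hx.1 hx.2
          rw [Finset.sum_Ico_consecutive _ (by omega) this]
        rw [e1]
        linarith

lemma strat_zero (w : ℕ) : Strat μ X w 0 0 0 := fun x₀ y₀ =>
  ⟨fun _ => 0, niceVar_zero _, fun ω => ⟨fun _ => y₀, monotone_const, by simp, by simp⟩⟩

lemma Strat.mono {w T : ℕ} {M M' v v' : ℝ} (h : Strat μ X w T M v) (hM : M' ≤ M) (hv : v ≤ v') :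
    Strat μ X w T M' v' := by
  intro x₀ y₀
  obtain ⟨V, h1, h2⟩ := h x₀ y₀
  refine ⟨V, h1.mono le_rfl hv, fun ω => ?_⟩
  obtain ⟨h, a, b, c⟩ := h2 ω
  exact ⟨h, a, b, by linarith⟩

/-- Iterating the step. -/
lemma strat_iter (H : GridSys μ X σ κ) {c : ℝ}
    (hc : ∀ R : Finset (ℕ × ℕ), c * Real.sqrt R.card ≤ ∫ ω, max (∑ c ∈ R, X c ω) 0 ∂μ)
    (q m : ℕ) (hq : 2 ≤ q) (hm : 1 ≤ m) (n : ℕ) (hn : n ≤ q) :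
    ∃ T : ℕ, T + m * q ^ (n + 1) = m * q * (q + 1) ^ n ∧
      Strat μ X (q ^ n * (3 * q * m)) T
        (c * (n * q ^ n * (m * Real.sqrt (3 * q))))
        (2 * σ * (q ^ n * (3 * q * m)) ^ 2) := by
  induction n with
  | zero => exact ⟨0, by ring, (strat_zero _).mono (by simp) (by have := H.pos; positivity)⟩
  | succ n ih =>
    obtain ⟨T, hT, hS⟩ := ih (by omega)
    refine ⟨(q + 1) * T + m * q ^ (n + 1), ?_, ?_⟩
    · have : (q + 1) * (T + m * q ^ (n + 1)) = (q + 1) * (m * q * (q + 1) ^ n) := by rw [hT]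
      calc _ = (q + 1) * (T + m * q ^ (n + 1)) := by ring
        _ = _ := by rw [this]; ring
    · have hst := hS.step (q := q) (r := m * q ^ (n + 1)) H hc (by omega)
        (Nat.mul_pos (by positivity) (by positivity))
      rw [show q ^ (n + 1) * (3 * q * m) = q * (q ^ n * (3 * q * m)) by ring]
      refine hst.mono (le_of_eq ?_) ?_
      · have : Real.sqrt (q * ((q ^ n * (3 * q * m) : ℕ) : ℝ) * ((m * q ^ (n + 1) : ℕ) : ℝ)) =
            q ^ (n + 1) * (m * Real.sqrt (3 * q)) := by
          push_cast
          rw [show (q : ℝ) * (q ^ n * (3 * q * m)) * (m * q ^ (n + 1)) =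
            (q ^ (n + 1) * m) ^ 2 * (3 * q) by ring, Real.sqrt_mul (by positivity),
            Real.sqrt_sq (by positivity)]
          ring
        rw [this]; push_cast; ring
      · -- the variance bound
        have hpow : ((q : ℝ) + 1) ^ (n + 1) ≤ 3 * q ^ (n + 1) := by
          have hq0 : (0 : ℝ) < q := by positivity
          have h1 : ((q : ℝ) + 1) ^ (n + 1) = q ^ (n + 1) * (1 + 1 / q) ^ (n + 1) := by
            rw [← mul_pow]; congr 1; field_simp
          have h2 : (1 + 1 / (q : ℝ)) ^ (n + 1) ≤ 3 := by
            calc (1 + 1 / (q : ℝ)) ^ (n + 1) ≤ (1 + 1 / (q : ℝ)) ^ q :=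
                  pow_le_pow_right₀ (by simp) hn
              _ ≤ (Real.exp (1 / q)) ^ q := by
                  refine pow_le_pow_left₀ (by positivity) ?_ _
                  have := Real.add_one_le_exp (1 / (q : ℝ)); linarith
              _ = Real.exp 1 := by rw [← Real.exp_nat_mul]; congr 1; field_simp
              _ ≤ 3 := by have := Real.exp_one_lt_d9; linarith
          rw [h1]
          nlinarith [pow_pos hq0 (n + 1)]
        have hTr : (T : ℝ) + m * q ^ (n + 1) = m * q * (q + 1) ^ n := by exact_mod_cast hT
        have hbd : ((q : ℝ) + 1) * T + ((m * q ^ (n + 1) : ℕ) : ℝ) ≤ q * (q ^ n * (3 * q * m)) := by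
          push_cast
          have h3 : ((q : ℝ) + 1) * (T + m * q ^ (n + 1)) = m * q * (q + 1) ^ (n + 1) := by
            rw [hTr]; ring
          have h4 : (m : ℝ) * q * (q + 1) ^ (n + 1) ≤ m * q * (3 * q ^ (n + 1)) :=
            mul_le_mul_of_nonneg_left hpow (by positivity)
          have h5 : (0:ℝ) ≤ q * (m * q ^ (n + 1)) := by positivity
          have h6 : (m : ℝ) * q * (3 * q ^ (n + 1)) = q * (q ^ n * (3 * q * m)) := by ring
          linarith
        have hσ := H.pos
        set W : ℝ := q ^ n * (3 * q * m) with hW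
        have hW0 : 0 ≤ W := by positivity
        push_cast
        push_cast at hbd
        rw [← hW, show (q : ℝ) ^ (n + 1) * (3 * q * m) = q * W by rw [hW]; ring]
        have h7 : q * W * (((q : ℝ) + 1) * T + m * q ^ (n + 1)) ≤ q * W * (q * W) :=
          mul_le_mul_of_nonneg_left hbd (by positivity)
        have h8 := mul_le_mul_of_nonneg_left h7 hσ.le
        have h9 : (2 : ℝ) ≤ q := by exact_mod_cast hq
        have h10 : 0 ≤ σ * W ^ 2 * q * (q - 2) :=
          mul_nonneg (by positivity) (by linarith)
        nlinarith
end

lemma succ_pow_le_three (q : ℕ) (hq : 1 ≤ q) : (q + 1) ^ q ≤ 3 * q ^ q := by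
  have hq0 : (0 : ℝ) < q := by exact_mod_cast hq
  have h1 : ((q : ℝ) + 1) ^ q = q ^ q * (1 + 1 / q) ^ q := by
    rw [← mul_pow]; congr 1; field_simp
  have h2 : (1 + 1 / (q : ℝ)) ^ q ≤ 3 := by
    calc (1 + 1 / (q : ℝ)) ^ q ≤ (Real.exp (1 / q)) ^ q := by
          refine pow_le_pow_left₀ (by positivity) ?_ _
          have := Real.add_one_le_exp (1 / (q : ℝ)); linarith
      _ = Real.exp 1 := by rw [← Real.exp_nat_mul]; congr 1; field_simp
      _ ≤ 3 := by have := Real.exp_one_lt_d9; linarith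
  have h3 : ((q : ℝ) + 1) ^ q ≤ 3 * q ^ q := by
    rw [h1]; nlinarith [pow_pos hq0 q]
  exact_mod_cast h3

/-- The law of one cell. -/
noncomputable def cellLaw : Measure (ℕ × ℕ) := (poissonMeasure 1).prod (poissonMeasure 1)

instance : IsProbabilityMeasure cellLaw := by unfold cellLaw; infer_instance

/-- Blue minus red in one cell. -/
def cellDiff (p : ℕ × ℕ) : ℝ := (p.1 : ℝ) - p.2

lemma poisson_memLp : MemLp (fun n : ℕ => (n : ℝ)) 4 (poissonMeasure 1) := by
  have h : Integrable (fun n : ℕ => (n : ℝ) ^ 4) (poissonMeasure 1) := by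
    rw [integrable_poissonMeasure_iff]
    have hs := (Real.summable_pow_div_factorial (Real.exp 1)).mul_left (24 * Real.exp (-1))
    refine Summable.of_nonneg_of_le (fun n => by positivity) (fun n => ?_) hs
    have h1 : (n : ℝ) ^ 4 ≤ 24 * Real.exp 1 ^ n := by
      have := Real.pow_div_factorial_le_exp (x := (n : ℝ)) (by positivity) 4
      rw [div_le_iff₀ (by positivity)] at this
      rw [← Real.exp_nat_mul, mul_one]
      have h24 : ((Nat.factorial 4 : ℕ) : ℝ) = 24 := by norm_num [Nat.factorial]
      rw [h24] at this
      linarith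
    simp only [norm_pow, RCLike.norm_natCast, NNReal.coe_one, one_pow, mul_one]
    calc Real.exp (-1) / (n.factorial : ℝ) * (n : ℝ) ^ 4
        ≤ Real.exp (-1) / (n.factorial : ℝ) * (24 * Real.exp 1 ^ n) :=
          mul_le_mul_of_nonneg_left h1 (by positivity)
      _ = _ := by ring
  have h4 : (4 : ENNReal) = ((4 : ℕ) : ENNReal) := by norm_num
  rw [← integrable_norm_rpow_iff (by fun_prop) (by norm_num) (by norm_num)]
  refine h.congr (ae_of_all _ fun n => ?_)
  simp only [RCLike.norm_natCast, ENNReal.toReal_ofNat]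
  norm_cast

lemma cellDiff_memLp : MemLp cellDiff 4 cellLaw :=
  (poisson_memLp.comp_fst _).sub (poisson_memLp.comp_snd _)

lemma cellDiff_mean : ∫ p, cellDiff p ∂cellLaw = 0 := by
  have h1 : Integrable (fun n : ℕ => (n : ℝ)) (poissonMeasure 1) :=
    poisson_memLp.integrable (by norm_num)
  unfold cellDiff cellLaw
  rw [integral_sub (h1.comp_fst _) (h1.comp_snd _), integral_fun_fst (fun n : ℕ => (n : ℝ)),
    integral_fun_snd (fun n : ℕ => (n : ℝ))]
  simp

lemma cellLaw_singleton (p : ℕ × ℕ) :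
    cellLaw {p} = ENNReal.ofReal (poissonPMFReal 1 p.1 * poissonPMFReal 1 p.2) := by
  obtain ⟨a, b⟩ := p
  rw [← Set.singleton_prod_singleton, cellLaw, Measure.prod_prod, poissonMeasure_singleton,
    poissonMeasure_singleton, ENNReal.ofReal_mul poissonPMFReal_nonneg]
  rfl

lemma cellDiff_var_pos : 0 < ∫ p, cellDiff p ^ 2 ∂cellLaw := by
  rw [integral_pos_iff_support_of_nonneg (fun p => sq_nonneg _)
    (pow_int cellDiff_memLp (by norm_num))]
  have hsub : ({((1 : ℕ), (0 : ℕ))} : Set (ℕ × ℕ)) ⊆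
      Function.support (fun p => cellDiff p ^ 2) := by
    rintro p rfl
    simp [cellDiff]
  refine lt_of_lt_of_le ?_ (measure_mono hsub)
  rw [cellLaw_singleton, ENNReal.ofReal_pos]
  exact mul_pos (poissonPMFReal_pos one_pos) (poissonPMFReal_pos one_pos)

lemma cellDiff_le : (∫ p, cellDiff p ^ 2 ∂cellLaw) ^ 2 ≤ ∫ p, cellDiff p ^ 4 ∂cellLaw := by
  set s := ∫ p, cellDiff p ^ 2 ∂cellLaw with hs
  have i2 : Integrable (fun p => cellDiff p ^ 2) cellLaw := pow_int cellDiff_memLp (by norm_num)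
  have i4 : Integrable (fun p => cellDiff p ^ 4) cellLaw := pow_int cellDiff_memLp (by norm_num)
  have h0 : 0 ≤ ∫ p, (cellDiff p ^ 2 - s) ^ 2 ∂cellLaw := integral_nonneg fun p => sq_nonneg _
  have e : ∀ p, (cellDiff p ^ 2 - s) ^ 2 = cellDiff p ^ 4 + (-2 * s) * cellDiff p ^ 2 + s ^ 2 :=
    fun p => by ring
  rw [integral_congr_ae (ae_of_all _ e), int_three i4 (i2.const_mul _) (integrable_const _),
    integral_const_mul, ← hs] at h0
  simp at h0
  linarith

/-- The infinite grid. -/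
noncomputable def gridLaw : Measure (ℕ × ℕ → ℕ × ℕ) := Measure.infinitePi fun _ => cellLaw

instance : IsProbabilityMeasure gridLaw := by unfold gridLaw; infer_instance

lemma gridSys : GridSys gridLaw (fun c ω => cellDiff (ω c)) (∫ p, cellDiff p ^ 2 ∂cellLaw)
    (∫ p, cellDiff p ^ 4 ∂cellLaw) := by
  have hm : Measurable cellDiff := .of_discrete
  have mp : ∀ c : ℕ × ℕ, MeasurePreserving (fun ω : ℕ × ℕ → ℕ × ℕ => ω c) gridLaw cellLaw :=
    fun c => measurePreserving_eval_infinitePi (fun _ => cellLaw) c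
  have hint : ∀ (c : ℕ × ℕ) (F : ℕ × ℕ → ℝ), ∫ ω, F (ω c) ∂gridLaw = ∫ p, F p ∂cellLaw := by
    intro c F
    rw [← (mp c).map_eq, integral_map (mp c).measurable.aemeasurable
      (Measurable.of_discrete (f := F)).aestronglyMeasurable]
  exact
  { meas := fun c => hm.comp (measurable_pi_apply c)
    indep := iIndepFun_infinitePi (P := fun _ : ℕ × ℕ => cellLaw) (X := fun _ => cellDiff)
      (fun _ => hm)
    lp4 := fun c => cellDiff_memLp.comp_measurePreserving (mp c)
    mean := fun c => (hint c cellDiff).trans cellDiff_mean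
    var := fun c => hint c fun p => cellDiff p ^ 2
    four := fun c => hint c fun p => cellDiff p ^ 4
    pos := cellDiff_var_pos
    le := cellDiff_le }

lemma gridPMF_tsum {s : ℕ} (P : (Fin s × Fin s → ℕ × ℕ) → Prop) :
    (∑' ω : Fin s × Fin s → ℕ × ℕ, if P ω then gridPMF ω else 0) =
      gridLaw.real {ω | P fun c => ω ((c.2 : ℕ), (c.1 : ℕ))} := by
  have hinj : Function.Injective (fun c : Fin s × Fin s => ((c.2 : ℕ), (c.1 : ℕ))) := by
    rintro ⟨a, b⟩ ⟨a', b'⟩ h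
    simp only [Prod.mk.injEq] at h
    ext
    · exact h.2
    · exact h.1
  have hmap := Measure.map_infinitePi_infinitePi_of_inj (P := fun _ : ℕ × ℕ => cellLaw) hinj
  rw [Measure.infinitePi_eq_pi (ι := Fin s × Fin s)] at hmap
  have hmeas : Measurable (fun (ω : ℕ × ℕ → ℕ × ℕ) (c : Fin s × Fin s) =>
    ω ((c.2 : ℕ), (c.1 : ℕ))) := by fun_prop
  have hE : MeasurableSet {ω | P ω} := Set.Countable.measurableSet (Set.to_countable _)
  have e1 : gridLaw {ω | P fun c => ω ((c.2 : ℕ), (c.1 : ℕ))} =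
      (Measure.pi fun _ : Fin s × Fin s => cellLaw) {ω | P ω} := by
    rw [← hmap, Measure.map_apply hmeas hE]; rfl
  rw [measureReal_def, e1, ← Measure.tsum_indicator_apply_singleton _ _ hE,
    ENNReal.tsum_toReal_eq]
  · refine tsum_congr fun ω => ?_
    simp only [Set.indicator_apply, Set.mem_setOf_eq]
    split_ifs with h
    · rw [Measure.pi_singleton]
      simp only [cellLaw_singleton]
      rw [ENNReal.toReal_prod]
      unfold gridPMF
      refine Finset.prod_congr rfl fun c _ => ?_
      rw [ENNReal.toReal_ofReal (mul_nonneg poissonPMFReal_nonneg poissonPMFReal_nonneg)]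
    · simp
  · intro ω
    simp only [Set.indicator_apply]
    split_ifs
    · exact measure_ne_top _ _
    · simp

lemma pathDeviation_eq {s : ℕ} (ω : ℕ × ℕ → ℕ × ℕ) (h : ℕ → ℕ) (hs : ∀ x, h x ≤ s) :
    (pathDeviation (s := s) (fun c => ω ((c.2 : ℕ), (c.1 : ℕ))) (fun j => h j) : ℝ) =
      ∑ x ∈ Finset.range s, ∑ y ∈ Finset.Ico 0 (h x), cellDiff (ω (x, y)) := by
  unfold pathDeviation
  rw [Fintype.sum_prod_type_right]
  push_cast
  rw [← Fin.sum_univ_eq_sum_range (fun x => ∑ y ∈ Finset.Ico 0 (h x), cellDiff (ω (x, y))) s]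
  refine Finset.sum_congr rfl fun x _ => ?_
  rw [Fin.sum_univ_eq_sum_range (fun y => if y < h x then
    (((ω (x, y)).1 : ℝ) - ((ω (x, y)).2 : ℝ)) else 0) s, ← Finset.sum_filter]
  refine Finset.sum_congr ?_ fun _ _ => rfl
  ext y
  have := hs x
  simp
  omega

lemma grid_numbers (s K : ℕ) (hK : K = Nat.log 2 (Nat.log 2 s)) (h5 : 5 ≤ K) :
    3 * K ^ (K + 1) ≤ s ∧ Real.log (Real.log ((s : ℝ) ^ 2)) ≤ 3 * K := by
  set L := Nat.log 2 s with hL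
  have hL0 : L ≠ 0 := by rintro h; rw [h] at hK; simp at hK; omega
  have hs0 : s ≠ 0 := by rintro h; rw [h] at hL; simp at hL; omega
  have a1 : 2 ^ K ≤ L := by rw [hK]; exact Nat.pow_log_le_self 2 hL0
  have a2 : L < 2 ^ (K + 1) := by rw [hK]; exact Nat.lt_pow_succ_log_self (by norm_num) L
  have b1 : 2 ^ L ≤ s := Nat.pow_log_le_self 2 hs0
  have b2 : s < 2 ^ (L + 1) := Nat.lt_pow_succ_log_self (by norm_num) s
  constructor
  · have hk : K * (K + 1) + 2 ≤ 2 ^ K := by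
      clear * - h5
      induction K, h5 using Nat.le_induction with
      | base => norm_num
      | succ n hn ih => rw [pow_succ]; nlinarith
    calc 3 * K ^ (K + 1) ≤ 2 ^ 2 * (2 ^ K) ^ (K + 1) :=
          Nat.mul_le_mul (by norm_num) (Nat.pow_le_pow_left Nat.lt_two_pow_self.le _)
      _ = 2 ^ (K * (K + 1) + 2) := by rw [← pow_mul, ← pow_add, add_comm]
      _ ≤ 2 ^ L := Nat.pow_le_pow_right (by norm_num) (hk.trans a1)
      _ ≤ s := b1
  · have hl2 : Real.log 2 ≤ 1 := by have := Real.log_two_lt_d9; linarith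
    have hl0 : 0 < Real.log 2 := Real.log_pos (by norm_num)
    have hs1 : (2 : ℝ) ≤ s := by
      have : 2 ^ 1 ≤ 2 ^ L := Nat.pow_le_pow_right (by norm_num) (Nat.one_le_iff_ne_zero.2 hL0)
      exact_mod_cast (this.trans b1)
    have hlogs : 0 < Real.log s := Real.log_pos (by linarith)
    have c1 : Real.log s ≤ L + 1 := by
      have : Real.log s ≤ Real.log ((2 : ℝ) ^ (L + 1)) :=
        Real.log_le_log (by linarith) (by exact_mod_cast b2.le)
      rw [Real.log_pow] at this
      push_cast at this
      nlinarith [(Nat.cast_nonneg L : (0 : ℝ) ≤ L)]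
    have c2 : (L : ℝ) + 1 ≤ 2 ^ (K + 1) := by exact_mod_cast a2
    have c3 : Real.log ((s : ℝ) ^ 2) ≤ 2 ^ (K + 2) := by
      rw [Real.log_pow]; push_cast; rw [pow_succ (2 : ℝ) (K + 1)]; linarith
    have c4 : Real.log (Real.log ((s : ℝ) ^ 2)) ≤ Real.log ((2 : ℝ) ^ (K + 2)) := by
      refine Real.log_le_log ?_ c3
      rw [Real.log_pow]; positivity
    rw [show Real.log ((2 : ℝ) ^ (K + 2)) = ((K + 2 : ℕ) : ℝ) * Real.log 2 from Real.log_pow _ _] at c4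
    push_cast at c4
    have hK5 : (5 : ℝ) ≤ K := by exact_mod_cast h5
    nlinarith


/-- In a `√μ × √μ` grid (`s = √μ`, `μ = s²`) with independent
`Pois(1)` blue and red dots per cell, with probability `1 - o(1)` as `μ → ∞` there
exists a monotone lattice path whose blue-red deviation is `Ω(√(μ log log μ))`. -/
theorem stmt10 :
    ∃ c : ℝ, 0 < c ∧
      ∀ ε : ℝ, 0 < ε →
      ∃ M : ℕ, ∀ s : ℕ, M ≤ s →
      (∑' ω : Fin s × Fin s → ℕ × ℕ,
          if (∃ h : Fin s → ℕ, Monotone h ∧ (∀ j, h j ≤ s) ∧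
              c * Real.sqrt ((s : ℝ) ^ 2 * Real.log (Real.log ((s : ℝ) ^ 2)))
                ≤ (pathDeviation ω h : ℝ))
            then gridPMF ω else 0)
        ≥ 1 - ε := by
  obtain ⟨c, hc, hcR⟩ := gridSys.pos_part
  have hσ := gridSys.pos
  set σ := ∫ p, cellDiff p ^ 2 ∂cellLaw with hσdef
  refine ⟨c / 12, by positivity, fun ε hε => ?_⟩
  obtain ⟨K0, hK0⟩ := exists_nat_ge (24 * σ / (c ^ 2 * ε))
  refine ⟨2 ^ 2 ^ (max 5 K0), fun s hs => ?_⟩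
  rw [gridPMF_tsum]
  obtain ⟨K, hK⟩ : ∃ K, K = Nat.log 2 (Nat.log 2 s) := ⟨_, rfl⟩
  have hmaxK : max 5 K0 ≤ K := by
    rw [hK]
    exact Nat.le_log_of_pow_le (by norm_num) (Nat.le_log_of_pow_le (by norm_num) hs)
  have h5 : 5 ≤ K := (le_max_left _ _).trans hmaxK
  have hKr : (K0 : ℝ) ≤ K := by exact_mod_cast (le_max_right _ _).trans hmaxK
  have hK5 : (5 : ℝ) ≤ K := by exact_mod_cast h5
  obtain ⟨n1, n2⟩ := grid_numbers s K hK h5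
  have hD : 0 < 3 * K ^ (K + 1) := by positivity
  obtain ⟨m, hm⟩ : ∃ m, m = s / (3 * K ^ (K + 1)) := ⟨_, rfl⟩
  have hm1 : 1 ≤ m := by rw [hm]; exact (Nat.one_le_div_iff hD).2 n1
  obtain ⟨W, hW⟩ : ∃ W, W = K ^ K * (3 * K * m) := ⟨_, rfl⟩
  have hW2 : W = 3 * K ^ (K + 1) * m := by rw [hW]; ring
  have hWs : W ≤ s := by rw [hW2, hm]; exact Nat.mul_div_le _ _
  have hsW : s ≤ 2 * W := by
    have h1 : s < 3 * K ^ (K + 1) * m + 3 * K ^ (K + 1) := by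
      have := Nat.lt_mul_div_succ s hD
      rw [← hm] at this
      linarith [this]
    have h2 : 3 * K ^ (K + 1) * 1 ≤ W := by rw [hW2]; exact Nat.mul_le_mul le_rfl hm1
    omega
  have hW0 : 0 < W := by rw [hW2]; positivity
  obtain ⟨T, hT, hS⟩ := strat_iter gridSys hcR K m (by omega) hm1 K le_rfl
  have hTs : T ≤ s := by
    have h3 := succ_pow_le_three K (by omega)
    have : m * K * (K + 1) ^ K ≤ W := by
      calc m * K * (K + 1) ^ K ≤ m * K * (3 * K ^ K) := Nat.mul_le_mul le_rfl h3
        _ = W := by rw [hW]; ring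
    omega
  rw [← hW] at hS
  obtain ⟨V, hV, hpath⟩ := hS (s - W) 0
  have hWr : ((K : ℝ) ^ K * (3 * K * m)) = W := by rw [hW]; push_cast; ring
  rw [hWr] at hV
  have hgain : c * ((K : ℝ) * K ^ K * (m * Real.sqrt (3 * K))) = c * Real.sqrt (3 * K) * W / 3 := by
    rw [← hWr]; ring
  rw [hgain] at hpath
  set M := c * Real.sqrt (3 * K) * W / 3 with hM
  have hW0r : (0 : ℝ) < W := by exact_mod_cast hW0
  have hM0 : 0 < M := by positivity
  have hMsq : M ^ 2 = c ^ 2 * K * W ^ 2 / 3 := by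
    rw [hM, div_pow, mul_pow, mul_pow, Real.sq_sqrt (by positivity)]; ring
  have hVm : Measurable V := hV.1.mono (gridSys.sig_le _) le_rfl
  have hVi : Integrable (fun ω => V ω ^ 2) gridLaw := hV.2.1.integrable_sq
  have hmk := mul_meas_ge_le_integral_of_nonneg (ae_of_all gridLaw fun ω => sq_nonneg (V ω)) hVi
    (M ^ 2 / 4)
  have hbad : gridLaw.real {ω | M ^ 2 / 4 ≤ V ω ^ 2} ≤ ε := by
    have h1 : M ^ 2 / 4 * gridLaw.real {ω | M ^ 2 / 4 ≤ V ω ^ 2} ≤ 2 * σ * (W : ℝ) ^ 2 :=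
      hmk.trans hV.2.2.2
    have h2 : 2 * σ * (W : ℝ) ^ 2 ≤ M ^ 2 / 4 * ε := by
      have h3 : 24 * σ / (c ^ 2 * ε) ≤ K := hK0.trans hKr
      rw [div_le_iff₀ (by positivity)] at h3
      rw [hMsq]
      nlinarith [mul_le_mul_of_nonneg_right h3 (sq_nonneg (W : ℝ))]
    exact le_of_mul_le_mul_left (h1.trans h2) (by positivity)
  have hmeasbad : MeasurableSet {ω | M ^ 2 / 4 ≤ V ω ^ 2} :=
    measurableSet_le measurable_const (hVm.pow_const 2)
  have hcompl := probReal_compl_eq_one_sub (μ := gridLaw) hmeasbad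
  have hsub : {ω | M ^ 2 / 4 ≤ V ω ^ 2}ᶜ ⊆ {ω : ℕ × ℕ → ℕ × ℕ | ∃ h : Fin s → ℕ, Monotone h ∧
      (∀ j, h j ≤ s) ∧ c / 12 * Real.sqrt ((s : ℝ) ^ 2 * Real.log (Real.log ((s : ℝ) ^ 2)))
        ≤ (pathDeviation (fun c : Fin s × Fin s => ω ((c.2 : ℕ), (c.1 : ℕ))) h : ℝ)} := by
    intro ω hω
    simp only [Set.mem_compl_iff, Set.mem_setOf_eq, not_le] at hω
    obtain ⟨h, hmono, hb, hdev⟩ := hpath ω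
    have hVlow : -(M / 2) < V ω :=
      (abs_lt_of_sq_lt_sq' (by linarith [show (M / 2) ^ 2 = M ^ 2 / 4 by ring])
        (by positivity)).1
    set g : ℕ → ℕ := fun x => if x < s - W then 0 else h x with hg
    have hgs : ∀ x, g x ≤ s := by
      intro x
      have := (hb x).2
      simp only [hg]; split_ifs <;> omega
    refine ⟨fun j => g j, ?_, fun j => hgs j, ?_⟩
    · intro a b hab
      have hab' : (a : ℕ) ≤ b := hab
      have := hmono hab'
      simp only [hg]
      split_ifs <;> omega
    · rw [pathDeviation_eq ω g hgs]
      have e1 : ∑ x ∈ Finset.range s, ∑ y ∈ Finset.Ico 0 (g x), cellDiff (ω (x, y)) =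
          ∑ x ∈ Finset.Ico (s - W) (s - W + W), ∑ y ∈ Finset.Ico 0 (h x), cellDiff (ω (x, y)) := by
        rw [Nat.sub_add_cancel hWs, Finset.range_eq_Ico,
          ← Finset.sum_Ico_consecutive _ (Nat.zero_le (s - W)) (Nat.sub_le s W),
          Finset.sum_eq_zero, zero_add]
        · refine Finset.sum_congr rfl fun x hx => ?_
          rw [Finset.mem_Ico] at hx
          simp only [hg]
          rw [if_neg (by omega)]
        · intro x hx
          rw [Finset.mem_Ico] at hx
          simp only [hg]
          rw [if_pos hx.2]
          simp
      rw [e1]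
      refine le_trans ?_ hdev
      have e2 : Real.sqrt ((s : ℝ) ^ 2 * Real.log (Real.log ((s : ℝ) ^ 2))) ≤
          2 * W * Real.sqrt (3 * K) := by
        rw [Real.sqrt_mul (by positivity), Real.sqrt_sq (by positivity)]
        exact mul_le_mul (by exact_mod_cast hsW) (Real.sqrt_le_sqrt n2) (Real.sqrt_nonneg _)
          (by positivity)
      have e3 := mul_le_mul_of_nonneg_left e2 (show 0 ≤ c / 12 by positivity)
      have e4 : c / 12 * (2 * W * Real.sqrt (3 * K)) = M / 2 := by rw [hM]; ring
      linarith
  have := measureReal_mono (μ := gridLaw) hsub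
  linarith
end

section
/- Consider a linear-probing hash table with $n$ slots filled by $(1-1/x)n$ uniformly random insertions starting from empty. The running time $T$ of the final insertion satisfies $\Pr[T \ge k x^2] \le 2^{-\Omega(k)}$ for all $k \ge 1$. -/
open scoped Classical

/-- Linear probing placement: a key with hash `h` lands in the first free position
at or after `h` (positions are natural numbers; the table is extended to the right,
so a free position always exists). -/
noncomputable def placePos (occ : Finset ℕ) (h : ℕ) : ℕ :=
  sInf {p | h ≤ p ∧ p ∉ occ}

/-- The set of occupied positions after linear-probing insertions of a list of
hashes. -/
noncomputable def occAfter : List ℕ → Finset ℕ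
  | [] => ∅
  | h :: rest => insert (placePos (occAfter rest) h) (occAfter rest)

/-- number of coordinates with value below `L` -/
noncomputable def cntB {n m : ℕ} (g : Fin m → Fin n) (L : ℕ) : ℕ :=
  (Finset.univ.filter (fun i => (g i).val < L)).card

noncomputable def prj {n m : ℕ} (L : ℕ) (g : Fin m → Fin n) : Fin m → Option (Fin n) :=
  fun i => if (g i).val < L then none else some (g i)

lemma prj_eq_iff {n m : ℕ} (L : ℕ) (g g0 : Fin m → Fin n) :
    prj L g = prj L g0 ↔
      ∀ i, g i ∈ (if (g0 i).val < L then Finset.univ.filter (fun v : Fin n => v.val < L) else {g0 i}) := by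
  unfold prj
  rw [funext_iff]
  refine forall_congr' fun i => ?_
  by_cases h0 : (g0 i).val < L <;> by_cases h : (g i).val < L <;> simp [h0, h]
  intro h2
  rw [h2] at h
  exact h0 h

lemma cntB_congr {n m : ℕ} {L L' : ℕ} (hL : L ≤ L') {g g0 : Fin m → Fin n}
    (h : prj L g = prj L g0) : cntB g L' = cntB g0 L' := by
  unfold cntB
  congr 1
  ext i
  rw [prj_eq_iff] at h
  have := h i
  simp only [Finset.mem_filter, Finset.mem_univ, true_and]
  split_ifs at this with h0
  · simp at this
    omega
  · simp at this
    rw [this]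

lemma card_lt {n L : ℕ} (hL : L ≤ n) :
    (Finset.univ.filter (fun v : Fin n => v.val < L)).card = L := by
  rw [Fin.card_filter_val_lt]
  exact min_eq_right hL

lemma sum_wt {n L s : ℕ} (hL : L ≤ n) (hs : s ≤ L) (y : ℝ) :
    ∑ v ∈ Finset.univ.filter (fun v : Fin n => v.val < L), (if v.val < s then y else 1)
      = L + s * (y - 1) := by
  have : ∀ v : Fin n, (if v.val < s then y else 1) = 1 + (if v.val < s then (y-1) else 0) := by
    intro v; split_ifs <;> ring
  simp_rw [this]
  rw [Finset.sum_add_distrib, ← Finset.sum_filter, Finset.filter_filter]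
  have h2 : (Finset.univ.filter (fun v : Fin n => v.val < L ∧ v.val < s))
      = Finset.univ.filter (fun v : Fin n => v.val < s) := by
    ext v; simp; omega
  rw [h2]
  simp only [Finset.sum_const, card_lt hL, card_lt (hs.trans hL), nsmul_eq_mul, mul_one]

lemma wt_eq {n m : ℕ} (g : Fin m → Fin n) (s : ℕ) (y : ℝ) :
    y ^ (cntB g s) = ∏ i, (if (g i).val < s then y else 1) := by
  unfold cntB
  rw [Finset.prod_ite]
  simp

lemma fiber_ineq {n m L s : ℕ} (hL : L ≤ n) (hs : s ≤ L) (hL0 : 0 < L) (y : ℝ) (hy : 1 ≤ y)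
    (g0 : Fin m → Fin n) (h0 : L ≤ cntB g0 L) :
    y ^ s * ((Finset.univ.filter (fun g : Fin m → Fin n => prj L g = prj L g0)).card : ℝ)
      ≤ ∑ g ∈ Finset.univ.filter (fun g : Fin m → Fin n => prj L g = prj L g0), y ^ (cntB g s) := by
  have hF : (Finset.univ.filter (fun g : Fin m → Fin n => prj L g = prj L g0))
      = Fintype.piFinset (fun i => if (g0 i).val < L then
          Finset.univ.filter (fun v : Fin n => v.val < L) else {g0 i}) := by
    ext g
    simp only [Finset.mem_filter, Finset.mem_univ, true_and, Fintype.mem_piFinset, prj_eq_iff]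
  rw [hF]
  simp_rw [wt_eq]
  rw [← Finset.prod_univ_sum _ (fun (_ : Fin m) (v : Fin n) => if v.val < s then y else (1:ℝ)), Fintype.card_piFinset]
  have e1 : ∀ i, (∑ v ∈ (if (g0 i).val < L then
          Finset.univ.filter (fun v : Fin n => v.val < L) else {g0 i}), (if v.val < s then y else (1:ℝ)))
      = if (g0 i).val < L then (L + s * (y - 1)) else 1 := by
    intro i
    by_cases h : (g0 i).val < L
    · simp only [h, if_true]
      exact sum_wt hL hs y
    · simp only [h, if_false, Finset.sum_singleton]
      rw [if_neg (by omega)]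
  have e2 : ∀ i, (if (g0 i).val < L then
          Finset.univ.filter (fun v : Fin n => v.val < L) else {g0 i}).card
      = if (g0 i).val < L then L else 1 := by
    intro i
    by_cases h : (g0 i).val < L
    · simp only [h, if_true]
      exact card_lt hL
    · simp only [h, if_false, Finset.card_singleton]
  simp_rw [e1, e2]
  rw [Finset.prod_ite, Finset.prod_ite]
  simp only [Finset.prod_const, one_pow, mul_one]
  change y ^ s * ((L ^ cntB g0 L : ℕ) : ℝ) ≤ (L + s * (y-1)) ^ cntB g0 L
  set N := cntB g0 L
  have hLr : (0:ℝ) < L := by exact_mod_cast hL0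
  have hsL : (s:ℝ) / L ≤ 1 := by
    rw [div_le_one hLr]; exact_mod_cast hs
  have hb := rpow_one_add_le_one_add_mul_self (s := y - 1) (by linarith) (p := (s:ℝ)/L) (by positivity) hsL
  rw [add_sub_cancel] at hb
  set r := y ^ ((s:ℝ)/L) with hr
  have hr1 : 1 ≤ r := Real.one_le_rpow hy (by positivity)
  have hrL : r ^ L = y ^ s := by
    rw [hr, ← Real.rpow_natCast, ← Real.rpow_mul (by linarith), div_mul_cancel₀ _ hLr.ne', Real.rpow_natCast]
  have e3 : (L + s * (y-1) : ℝ) = (1 + s / L * (y-1)) * L := by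
    field_simp
  rw [e3, mul_pow, ← hrL]
  push_cast
  gcongr
  calc r ^ L ≤ r ^ N := pow_le_pow_right₀ hr1 h0
    _ ≤ _ := by gcongr

lemma stop_ineq {n m L s : ℕ} (hL : L ≤ n) (hs : s ≤ L) (hL0 : 0 < L) (y : ℝ) (hy : 1 ≤ y)
    (A : Finset (Fin m → Fin n)) (hA : ∀ g ∈ A, L ≤ cntB g L)
    (hc : ∀ g ∈ A, ∀ g', prj L g' = prj L g → g' ∈ A) :
    y ^ s * (A.card : ℝ) ≤ ∑ g ∈ A, y ^ (cntB g s) := by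
  have h1 : (A.card : ℝ) = ∑ b ∈ A.image (prj L), ((A.filter (fun g => prj L g = b)).card : ℝ) := by
    rw [Finset.card_eq_sum_card_image (prj L) A]
    push_cast
    rfl
  rw [h1, Finset.mul_sum,
    ← Finset.sum_fiberwise_of_maps_to (s := A) (t := A.image (prj L)) (g := prj L)
      (fun g hg => Finset.mem_image_of_mem _ hg)]
  refine Finset.sum_le_sum fun b hb => ?_
  obtain ⟨g0, hg0, rfl⟩ := Finset.mem_image.1 hb
  have : A.filter (fun g => prj L g = prj L g0) = Finset.univ.filter (fun g => prj L g = prj L g0) := by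
    ext g
    simp only [Finset.mem_filter, Finset.mem_univ, true_and, and_iff_right_iff_imp]
    exact hc g0 hg0 g
  rw [this]
  exact fiber_ineq hL hs hL0 y hy g0 (hA g0 hg0)

noncomputable def badB (n m s : ℕ) : Finset (Fin m → Fin n) :=
  Finset.univ.filter (fun g => ∃ L, s ≤ L ∧ L ≤ n ∧ L ≤ cntB g L)

lemma maximal_ineq {n m s : ℕ} (hs : 0 < s) (hsn : s ≤ n) (y : ℝ) (hy : 1 ≤ y) :
    y ^ s * ((badB n m s).card : ℝ) ≤ (n + s * (y - 1)) ^ m := by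
  let A : ℕ → Finset (Fin m → Fin n) := fun L => Finset.univ.filter (fun g =>
    L ≤ cntB g L ∧ ∀ L', L < L' → L' ≤ n → cntB g L' < L')
  have hsub : badB n m s ⊆ (Finset.Icc s n).biUnion A := by
    intro g hg
    simp only [badB, Finset.mem_filter, Finset.mem_univ, true_and] at hg
    obtain ⟨L, h1, h2, h3⟩ := hg
    let S := (Finset.Icc s n).filter (fun L => L ≤ cntB g L)
    have hne : S.Nonempty := ⟨L, by simp [S, h1, h2, h3]⟩
    have hm := Finset.max'_mem S hne
    have hm' := hm
    simp only [S, Finset.mem_filter, Finset.mem_Icc] at hm'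
    refine Finset.mem_biUnion.2 ⟨S.max' hne, by simp only [Finset.mem_Icc]; exact hm'.1, ?_⟩
    simp only [A, Finset.mem_filter, Finset.mem_univ, true_and]
    refine ⟨hm'.2, fun L' hl hn => ?_⟩
    by_contra hcon
    have : L' ∈ S := by
      simp only [S, Finset.mem_filter, Finset.mem_Icc]
      exact ⟨⟨hm'.1.1.trans hl.le, hn⟩, by omega⟩
    have := Finset.le_max' S L' this
    omega
  have hdisj : (↑(Finset.Icc s n) : Set ℕ).PairwiseDisjoint A := by
    intro a ha b hb hab
    rw [Function.onFun, Finset.disjoint_left]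
    intro g h1 h2
    simp only [A, Finset.mem_filter, Finset.mem_univ, true_and] at h1 h2
    simp only [Finset.coe_Icc, Set.mem_Icc] at ha hb
    rcases lt_or_gt_of_ne hab with h | h
    · have := h1.2 b h hb.2
      omega
    · have := h2.2 a h ha.2
      omega
  have hA : ∀ L ∈ Finset.Icc s n, y ^ s * ((A L).card : ℝ) ≤ ∑ g ∈ A L, y ^ (cntB g s) := by
    intro L hL
    rw [Finset.mem_Icc] at hL
    refine stop_ineq hL.2 hL.1 (by omega) y hy _ ?_ ?_
    · intro g hg
      simp only [A, Finset.mem_filter, Finset.mem_univ, true_and] at hg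
      exact hg.1
    · intro g hg g' hgg
      simp only [A, Finset.mem_filter, Finset.mem_univ, true_and] at hg ⊢
      refine ⟨by rw [cntB_congr le_rfl hgg]; exact hg.1, fun L' h1 h2 => ?_⟩
      rw [cntB_congr h1.le hgg]
      exact hg.2 L' h1 h2
  have htot : ∑ g : Fin m → Fin n, y ^ (cntB g s) = (n + s * (y - 1)) ^ m := by
    simp_rw [wt_eq]
    rw [← Fintype.prod_sum (fun (_ : Fin m) (v : Fin n) => if v.val < s then y else (1:ℝ))]
    rw [← sum_wt le_rfl hsn y]
    simp
  calc y ^ s * ((badB n m s).card : ℝ)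
      ≤ y ^ s * (((Finset.Icc s n).biUnion A).card : ℝ) := by
        gcongr
    _ = ∑ L ∈ Finset.Icc s n, y ^ s * ((A L).card : ℝ) := by
        rw [Finset.card_biUnion hdisj, ← Finset.mul_sum]; push_cast; rfl
    _ ≤ ∑ L ∈ Finset.Icc s n, ∑ g ∈ A L, y ^ (cntB g s) := Finset.sum_le_sum hA
    _ = ∑ g ∈ (Finset.Icc s n).biUnion A, y ^ (cntB g s) := (Finset.sum_biUnion hdisj).symm
    _ ≤ ∑ g : Fin m → Fin n, y ^ (cntB g s) := by
        apply Finset.sum_le_sum_of_subset_of_nonneg (Finset.subset_univ _)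
        intros; positivity
    _ = _ := htot

lemma bad_bound_s15 {n m s : ℕ} (hs : 0 < s) (hn : 0 < n) (u : ℝ) (hu : 0 < u)
    (hm : (m:ℝ) ≤ (1 - u) * n) :
    ((badB n m s).card : ℝ) ≤ Real.exp (-(s * u ^ 2 / 2)) * n ^ m := by
  have hnr : (0:ℝ) < n := by exact_mod_cast hn
  by_cases hsn : s ≤ n
  · have h := maximal_ineq (m := m) hs hsn (1 + u) (by linarith)
    rw [add_sub_cancel_left] at h
    have hlog : u - u ^ 2 / 2 ≤ Real.log (1 + u) := by
      have h3 := Real.le_log_one_add_of_nonneg hu.le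
      refine le_trans ?_ h3
      rw [le_div_iff₀ (by linarith)]
      nlinarith [pow_pos hu 3]
    have hy : Real.exp (s * (u - u^2/2)) ≤ (1 + u) ^ s := by
      have : (1 + u) ^ s = Real.exp (s * Real.log (1 + u)) := by
        rw [mul_comm, Real.exp_mul, Real.exp_log (by linarith), Real.rpow_natCast]
      rw [this]
      gcongr
    have h4 : ((n:ℝ) + s * u) ^ m ≤ n ^ m * Real.exp (s * (u - u^2)) := by
      have : (n:ℝ) + s * u = n * (s * u / n + 1) := by field_simp; ring
      rw [this, mul_pow]
      gcongr
      calc (s * u / n + 1) ^ m ≤ (Real.exp (s * u / n)) ^ m := by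
            gcongr; exact Real.add_one_le_exp _
        _ = Real.exp (m * (s * u / n)) := by rw [Real.exp_nat_mul]
        _ ≤ _ := by
            apply Real.exp_le_exp.2
            calc m * (s * u / n) ≤ ((1-u)*n) * (s * u / n) := by gcongr
              _ = s * (u - u^2) := by field_simp
    have h5 : Real.exp (s * (u - u^2/2)) * ((badB n m s).card : ℝ)
        ≤ Real.exp (s * (u - u^2/2)) * (Real.exp (-(s * u ^ 2 / 2)) * n ^ m) := by
      calc _ ≤ (1 + u) ^ s * ((badB n m s).card : ℝ) := by gcongr
        _ ≤ _ := h.trans h4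
        _ = _ := by
          rw [← mul_assoc, ← Real.exp_add, mul_comm]
          congr 2
          ring
    exact le_of_mul_le_mul_left h5 (Real.exp_pos _)
  · have : badB n m s = ∅ := by
      ext g
      simp [badB]
      intros; omega
    rw [this]
    simp
    positivity

lemma occ_count (l : List ℕ) (a e : ℕ) (ha : ∀ b, b + 1 = a → b ∉ occAfter l) :
    ((occAfter l).filter (fun p => a ≤ p ∧ p < e)).card
      ≤ (l.map (fun h => if a ≤ h ∧ h < e then 1 else 0)).sum := by
  induction l with
  | nil => simp [occAfter]
  | cons h rest ih =>
    have ih' := ih (fun b hb hmem => ha b hb (by simp [occAfter, hmem]))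
    simp only [occAfter, List.map_cons, List.sum_cons]
    rw [Finset.filter_insert]
    have hne : {p | h ≤ p ∧ p ∉ occAfter rest}.Nonempty := by
      obtain ⟨p, hp⟩ := Infinite.exists_notMem_finset (occAfter rest ∪ Finset.range h)
      simp at hp
      exact ⟨p, hp.2, hp.1⟩
    have hmem := Nat.sInf_mem hne
    by_cases hp : a ≤ placePos (occAfter rest) h ∧ placePos (occAfter rest) h < e
    · rw [if_pos hp]
      have hh : a ≤ h ∧ h < e := by
        have h1 : h ≤ placePos (occAfter rest) h := hmem.1
        refine ⟨?_, by omega⟩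
        by_contra hcon
        have hb : a - 1 + 1 = a := by omega
        have := ha (a-1) hb
        simp only [occAfter, Finset.mem_insert, not_or] at this
        have h2 : placePos (occAfter rest) h ≤ a - 1 := Nat.sInf_le ⟨by omega, this.2⟩
        omega
      rw [if_pos hh]
      have := Finset.card_insert_le (placePos (occAfter rest) h) ((occAfter rest).filter (fun p => a ≤ p ∧ p < e))
      omega
    · rw [if_neg hp]
      omega

lemma run_exists (l : List ℕ) (h s : ℕ) (hT : s ≤ placePos (occAfter l) h - h) :
    ∃ a, a ≤ h ∧ h + s - a ≤ (l.map (fun q => if a ≤ q ∧ q < h + s then 1 else 0)).sum := by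
  have hocc : ∀ q, h ≤ q → q < h + s → q ∈ occAfter l := by
    intro q h1 h2
    by_contra hq
    have : placePos (occAfter l) h ≤ q := Nat.sInf_le ⟨h1, hq⟩
    omega
  have hex : ∃ a, ∀ q, a ≤ q → q < h + s → q ∈ occAfter l := ⟨h, hocc⟩
  have hsp := Nat.find_spec hex
  have hle : Nat.find hex ≤ h := Nat.find_min' hex hocc
  have hmin : ∀ b, b + 1 = Nat.find hex → b ∉ occAfter l := by
    intro b hb hmem
    refine Nat.find_min hex (m := b) (by omega) ?_
    intro q h1 h2
    rcases Nat.eq_or_lt_of_le h1 with h3 | h3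
    · rwa [← h3]
    · exact hsp q (by omega) h2
  refine ⟨Nat.find hex, hle, le_trans ?_ (occ_count l _ (h+s) hmin)⟩
  rw [← Nat.card_Ico]
  apply Finset.card_le_card
  intro q hq
  rw [Finset.mem_Ico] at hq
  simp only [Finset.mem_filter]
  exact ⟨hsp q hq.1 hq.2, hq⟩

lemma event_card {n m s : ℕ} (hs : 0 < s) (hn : 0 < n) (hmn : m < n) :
    (Finset.univ.filter (fun ω : Fin (m + 1) → Fin n =>
      s ≤ placePos (occAfter (List.ofFn fun i : Fin m => (ω i.castSucc : ℕ)))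
                  (ω (Fin.last m) : ℕ) - (ω (Fin.last m) : ℕ))).card ≤ n * (badB n m s).card := by
  have : NeZero n := ⟨hn.ne'⟩
  have hcard : n * (badB n m s).card = ((Finset.univ : Finset (Fin n)) ×ˢ badB n m s).card := by
    rw [Finset.card_product]; simp
  rw [hcard]
  let Φ : (Fin (m+1) → Fin n) → Fin n × (Fin m → Fin n) := fun ω =>
    (ω (Fin.last m), fun i => Fin.ofNat n ((ω (Fin.last m)).val + s - 1) - ω i.castSucc)
  refine Finset.card_le_card_of_injOn Φ ?_ ?_
  · intro ω hω
    simp only [Finset.coe_filter, Finset.mem_univ, true_and, Set.mem_ofPred_eq] at hω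
    obtain ⟨a, ha, hc⟩ := run_exists _ _ _ hω
    rw [List.map_ofFn, List.sum_ofFn] at hc
    simp only [Function.comp_def, Finset.sum_boole, Nat.cast_id] at hc
    simp only [Finset.coe_product, Set.mem_prod, Finset.mem_coe, Finset.mem_univ, true_and, badB,
      Finset.mem_filter]
    set h0 := (ω (Fin.last m)).val with hh0
    refine ⟨h0 + s - a, by omega, ?_, ?_⟩
    · refine hc.trans ((Finset.card_le_univ _).trans ?_)
      simp; omega
    · refine hc.trans ?_
      unfold cntB
      apply Finset.card_le_card
      intro i hi
      simp only [Finset.mem_filter, Finset.mem_univ, true_and] at hi ⊢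
      simp only [Φ]
      have : Fin.ofNat n (h0 + s - 1) - ω i.castSucc = Fin.ofNat n (h0 + s - 1 - (ω i.castSucc).val) := by
        rw [sub_eq_iff_eq_add]
        apply Fin.ext
        simp only [Fin.val_add, Fin.val_ofNat, Nat.mod_add_mod]
        congr 1
        omega
      rw [this, Fin.val_ofNat]
      refine lt_of_le_of_lt (Nat.mod_le _ _) ?_
      omega
  · intro ω _ ω' _ hE
    simp only [Φ, Prod.mk.injEq] at hE
    obtain ⟨h1, h2⟩ := hE
    rw [h1] at h2
    funext i
    refine Fin.lastCases h1 (fun j => ?_) i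
    have := congrFun h2 j
    simpa using this

/-- Fill a linear-probing hash table with `n` slots by `m + 1 =
(1-1/x)n` insertions with i.i.d. uniform hashes. The running time `T` of the final
insertion (the number of probed slots, i.e. distance from its hash to the first free
slot plus one) satisfies `Pr[T ≥ k x²] ≤ 2^{-Ω(k)}` for all `k ≥ 1`. -/
theorem stmt15 :
    ∃ c : ℝ, 0 < c ∧
      ∀ (n m : ℕ) (x k : ℝ), 0 < n → 1 < x → 1 ≤ k →
        ((m : ℝ) + 1 = (1 - 1 / x) * n) →
        ((Finset.univ.filter (fun ω : Fin (m + 1) → Fin n =>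
            k * x ^ 2 ≤
              ((placePos (occAfter (List.ofFn fun i : Fin m => (ω i.castSucc : ℕ)))
                  (ω (Fin.last m) : ℕ) - (ω (Fin.last m) : ℕ) + 1 : ℕ) : ℝ))).card : ℝ)
          ≤ (2 : ℝ) ^ (-(c * k)) * (n : ℝ) ^ (m + 1) := by
  refine ⟨1/4, by norm_num, ?_⟩
  intro n m x k hn hx hk hm
  have hnr : (0:ℝ) < n := by exact_mod_cast hn
  have hu : 0 < 1 / x := by positivity
  have hmn : m < n := by
    have : (m:ℝ) < n := by nlinarith
    exact_mod_cast this
  have hkx : 1 < k * x ^ 2 := by nlinarith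
  set t := ⌈k * x ^ 2⌉₊ with ht
  have ht1 : k * x ^ 2 ≤ t := Nat.le_ceil _
  have ht2 : 2 ≤ t := by
    have : (1:ℝ) < t := by linarith
    have : 1 < t := by exact_mod_cast this
    omega
  obtain ⟨s, hts⟩ : ∃ s, t = s + 1 := ⟨t - 1, by omega⟩
  have hs : 0 < s := by omega
  have hs1 : (1:ℝ) ≤ s := by exact_mod_cast hs
  have hsk : k * x ^ 2 / 2 ≤ s := by
    have : (t : ℝ) = s + 1 := by exact_mod_cast hts
    linarith
  have hb := bad_bound_s15 (m := m) hs hn (1/x) hu (by linarith)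
  have hev := event_card hs hn hmn
  have hexp : Real.exp (-(s * (1/x) ^ 2 / 2)) ≤ (2:ℝ) ^ (-(1/4 * k)) := by
    rw [Real.rpow_def_of_pos (by norm_num)]
    apply Real.exp_le_exp.2
    have h1 : k / 2 ≤ s * (1/x)^2 := by
      calc k / 2 = (k * x^2/2) * (1/x)^2 := by field_simp
        _ ≤ _ := by gcongr
    have h2 : Real.log 2 ≤ 1 := by linarith [Real.log_two_lt_d9]
    nlinarith
  calc _ ≤ ((n * (badB n m s).card : ℕ) : ℝ) := by
        refine Nat.cast_le.2 (le_trans (Finset.card_le_card ?_) hev)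
        intro ω hω
        simp only [Finset.mem_filter, Finset.mem_univ, true_and] at hω ⊢
        have := Nat.ceil_le.2 hω
        omega
    _ = n * ((badB n m s).card : ℝ) := by push_cast; rfl
    _ ≤ n * (Real.exp (-(s * (1/x) ^ 2 / 2)) * n ^ m) := by gcongr
    _ ≤ n * ((2:ℝ) ^ (-(1/4 * k)) * n ^ m) := by gcongr
    _ = _ := by ring
end

section
/- In a graveyard hash table with rebuild windows of $n/(4x)$ operations, started after a rebuild that placed primitive tombstones at every hash in $\{2ix : i \in [n/(2x)]\}$, any insertion $u$ during the window has displacement $d$ satisfying $\Pr[d \ge rx] \le \exp(-\Omega(r))$ for all $r > 1$. -/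
open scoped Classical

/-- An operation on an ordered linear probing hash table. -/
inductive LPOp
  | ins (h : ℕ)
  | del (h : ℕ)

/-- The peak of an insertion with hash `h` given the multiset `a` of currently
available resources (hashes of unused tombstones, positions of unused free slots):
the insertion uses the smallest available resource of value at least `h`. -/
noncomputable def LPpeak (a : Multiset ℕ) (h : ℕ) : ℕ :=
  sInf {v | v ∈ a ∧ h ≤ v}

/-- The trace of `(hash, peak)` pairs of the insertions of an operation sequence:
a deletion adds a tombstone resource at its hash; an insertion consumes the
resource given by its peak. -/
noncomputable def LPtrace : Multiset ℕ → List LPOp → List (ℕ × ℕ)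
  | _, [] => []
  | a, .del h :: rest => LPtrace (h ::ₘ a) rest
  | a, .ins h :: rest => (h, LPpeak a h) :: LPtrace (a.erase (LPpeak a h)) rest

/-- The primitive tombstones laid down by a graveyard-hashing rebuild at load factor
`1 - 1/x`: one tombstone at each hash in `{2ix : i ∈ [n/(2x)]}`. -/
def graveyardTombstones (n x : ℕ) : Multiset ℕ :=
  (Finset.Icc 1 (n / (2 * x))).val.map (fun i => 2 * i * x)

/-- Resources available after running the operations. -/
noncomputable def LPst : Multiset ℕ → List LPOp → Multiset ℕ
  | a, [] => a
  | a, .del h :: rest => LPst (h ::ₘ a) rest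
  | a, .ins h :: rest => LPst (a.erase (LPpeak a h)) rest

/-- Surviving primitive tombstones. -/
noncomputable def LPsurv : Multiset ℕ → Finset ℕ → List LPOp → Finset ℕ
  | _, S, [] => S
  | a, S, .del h :: rest => LPsurv (h ::ₘ a) S rest
  | a, S, .ins h :: rest => LPsurv (a.erase (LPpeak a h)) (S.erase (LPpeak a h)) rest

/-- The hash of an operation. -/
def LPhash : LPOp → ℕ
  | .ins h => h
  | .del h => h

/-- The operation list. -/
def LPops {L n : ℕ} (types : Fin L → Bool) (ω : Fin L → Fin n) : List LPOp :=
  List.ofFn fun i => if types i then LPOp.ins (ω i : ℕ) else LPOp.del (ω i : ℕ)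

lemma LPpeak_le {a : Multiset ℕ} {h v : ℕ} (hv : v ∈ a) (hh : h ≤ v) : LPpeak a h ≤ v :=
  Nat.sInf_le ⟨hv, hh⟩

lemma LPpeak_mem {a : Multiset ℕ} {h : ℕ} (hp : 0 < LPpeak a h) :
    LPpeak a h ∈ a ∧ h ≤ LPpeak a h := by
  have hne : {v | v ∈ a ∧ h ≤ v}.Nonempty := by
    by_contra hc
    rw [Set.not_nonempty_iff_eq_empty] at hc
    simp [LPpeak, hc] at hp
  exact Nat.sInf_mem hne

lemma LPsurv_subset (ops : List LPOp) : ∀ a S, LPsurv a S ops ⊆ S := by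
  induction ops with
  | nil => intro a S; simp [LPsurv]
  | cons o rest ih =>
    intro a S
    cases o with
    | ins h => exact (ih _ _).trans (Finset.erase_subset _ _)
    | del h => exact ih _ _

lemma LPerase_inv {a : Multiset ℕ} {S : Finset ℕ} (hS : ∀ v ∈ S, v ∈ a) (p : ℕ) :
    ∀ v ∈ S.erase p, v ∈ a.erase p := by
  intro v hv
  rw [Finset.mem_erase] at hv
  exact (Multiset.mem_erase_of_ne hv.1).2 (hS v hv.2)

lemma LPsurv_mem (ops : List LPOp) : ∀ a S, (∀ v ∈ S, v ∈ a) →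
    ∀ v ∈ LPsurv a S ops, v ∈ LPst a ops := by
  induction ops with
  | nil => intro a S h; simpa [LPsurv, LPst] using h
  | cons o rest ih =>
    intro a S hS
    cases o with
    | ins h => exact ih _ _ (LPerase_inv hS _)
    | del h => exact ih _ _ (fun v hv => Multiset.mem_cons_of_mem (hS v hv))

lemma LPsurv_card (ops : List LPOp) : ∀ a S, S.card ≤ (LPsurv a S ops).card + ops.length := by
  induction ops with
  | nil => intro a S; simp [LPsurv]
  | cons o rest ih =>
    intro a S
    cases o with
    | ins h =>
      have h1 := ih (a.erase (LPpeak a h)) (S.erase (LPpeak a h))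
      have h2 := Finset.pred_card_le_card_erase (s := S) (a := LPpeak a h)
      simp only [LPsurv, List.length_cons]
      omega
    | del h =>
      have h1 := ih (h ::ₘ a) S
      simp only [LPsurv, List.length_cons]
      omega

lemma LPst_le (n : ℕ) (ops : List LPOp) : ∀ a, (∀ v ∈ a, v ≤ n) → (∀ o ∈ ops, LPhash o ≤ n) →
    ∀ v ∈ LPst a ops, v ≤ n := by
  induction ops with
  | nil => intro a h _; simpa [LPst] using h
  | cons o rest ih =>
    intro a ha ho
    have ho' : ∀ o ∈ rest, LPhash o ≤ n := fun o h => ho o (List.mem_cons_of_mem _ h)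
    have hh := ho o List.mem_cons_self
    cases o with
    | ins h => exact ih _ (fun v hv => ha v (Multiset.mem_of_mem_erase hv)) ho'
    | del h =>
      refine ih _ (fun v hv => ?_) ho'
      rcases Multiset.mem_cons.1 hv with rfl | hv
      · exact hh
      · exact ha v hv

lemma LPsurv_count (lo p : ℕ) (ops : List LPOp) : ∀ a S, (∀ v ∈ S, v ∈ a) →
    (lo = 0 ∨ lo ∈ LPsurv a S ops) →
    (S.filter (fun v => lo < v ∧ v < p)).card ≤
      ((LPsurv a S ops).filter (fun v => lo < v ∧ v < p)).card +
      ops.countP (fun o => decide (lo ≤ LPhash o ∧ LPhash o < p)) := by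
  induction ops with
  | nil => intro a S _ _; simp [LPsurv]
  | cons o rest ih =>
    intro a S hS hlo
    cases o with
    | del h =>
      have h1 := ih (h ::ₘ a) S (fun v hv => Multiset.mem_cons_of_mem (hS v hv)) hlo
      rw [List.countP_cons]
      simp only [LPsurv]
      omega
    | ins h =>
      have h1 := ih (a.erase (LPpeak a h)) (S.erase (LPpeak a h)) (LPerase_inv hS _) hlo
      rw [List.countP_cons]
      simp only [LPsurv]
      rw [Finset.filter_erase] at h1
      by_cases hv : LPpeak a h ∈ S.filter (fun v => lo < v ∧ v < p)
      · have h2 := Finset.pred_card_le_card_erase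
          (s := S.filter (fun v => lo < v ∧ v < p)) (a := LPpeak a h)
        rw [Finset.mem_filter] at hv
        obtain ⟨hvS, hv1, hv2⟩ := hv
        have h3 := (LPpeak_mem (a := a) (h := h) (by omega)).2
        have h4 : lo ≤ h := by
          rcases hlo with h0 | h0
          · omega
          · by_contra hc
            have h5 : lo ∈ S := LPsurv_subset (LPOp.ins h :: rest) a S h0
            have := LPpeak_le (hS _ h5) (le_of_lt (not_le.1 hc))
            omega
        have h6 : (decide (lo ≤ LPhash (LPOp.ins h) ∧ LPhash (LPOp.ins h) < p)) = true := by
          apply decide_eq_true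
          simp only [LPhash]
          omega
        rw [if_pos h6]
        omega
      · rw [Finset.erase_eq_of_notMem hv] at h1
        omega

lemma LPtrace_spec (n L : ℕ) : ∀ (types : Fin L → Bool) (j : ℕ),
    (∀ a (ω : Fin L → Fin n), (LPtrace a (LPops types ω)).getD j (0, 0) = (0, 0)) ∨
    ∃ k : Fin L, ∀ a (ω : Fin L → Fin n), (LPtrace a (LPops types ω)).getD j (0, 0) =
      ((ω k : ℕ), LPpeak (LPst a ((LPops types ω).take k)) (ω k)) := by
  induction L with
  | zero => intro types j; left; intro a ω; simp [LPops, LPtrace]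
  | succ L ih =>
    intro types j
    have key : ∀ ω : Fin (L+1) → Fin n, LPops types ω =
        (if types 0 then LPOp.ins (ω 0 : ℕ) else LPOp.del (ω 0 : ℕ)) ::
          LPops (fun i => types i.succ) (fun i => ω i.succ) := by
      intro ω
      simp [LPops, List.ofFn_succ]
    by_cases h0 : types 0 = true
    · cases j with
      | zero =>
        right
        refine ⟨0, fun a ω => ?_⟩
        rw [key, if_pos h0]
        simp [LPtrace, LPst]
      | succ j =>
        rcases ih (fun i => types i.succ) j with h | ⟨k, h⟩
        · left
          intro a ω
          rw [key, if_pos h0]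
          simp only [LPtrace, List.getD_cons_succ]
          exact h _ _
        · right
          refine ⟨k.succ, fun a ω => ?_⟩
          rw [key, if_pos h0]
          simp only [LPtrace, List.getD_cons_succ, Fin.val_succ, List.take_succ_cons, LPst]
          exact h _ _
    · rcases ih (fun i => types i.succ) j with h | ⟨k, h⟩
      · left
        intro a ω
        rw [key, if_neg h0]
        simp only [LPtrace]
        exact h _ _
      · right
        refine ⟨k.succ, fun a ω => ?_⟩
        rw [key, if_neg h0]
        simp only [LPtrace, Fin.val_succ, List.take_succ_cons, LPst]
        exact h _ _

lemma LPops_length {L n : ℕ} (types : Fin L → Bool) (ω : Fin L → Fin n) :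
    (LPops types ω).length = L := by simp [LPops]

lemma LPops_hash {L n : ℕ} (types : Fin L → Bool) (ω : Fin L → Fin n) :
    (LPops types ω).map LPhash = List.ofFn (fun i => (ω i : ℕ)) := by
  rw [LPops, List.map_ofFn]
  congr 1
  funext i
  simp only [Function.comp]
  split_ifs <;> rfl

lemma LPofFn_count {L : ℕ} (f : Fin L → ℕ) (Q : ℕ → Bool) :
    (List.ofFn f).countP Q = (Finset.univ.filter (fun i => Q (f i) = true)).card := by
  induction L with
  | zero => simp
  | succ L ih =>
    rw [List.ofFn_succ, List.countP_cons, ih, Fin.card_filter_univ_succ]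
    split_ifs <;> simp_all

lemma LPops_count {L n : ℕ} (types : Fin L → Bool) (ω : Fin L → Fin n) (k : Fin L) (lo p : ℕ)
    (h1 : lo ≤ ω k) (h2 : (ω k : ℕ) < p) :
    ((LPops types ω).take k).countP (fun o => decide (lo ≤ LPhash o ∧ LPhash o < p)) + 1 ≤
      (Finset.univ.filter (fun i => lo ≤ (ω i : ℕ) ∧ (ω i : ℕ) < p)).card := by
  set Q : ℕ → Bool := fun h => decide (lo ≤ h ∧ h < p) with hQ
  have e1 : ((LPops types ω).take k).countP (fun o => decide (lo ≤ LPhash o ∧ LPhash o < p)) =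
      ((List.ofFn (fun i => (ω i : ℕ))).take k).countP Q := by
    rw [← LPops_hash types ω, ← List.map_take, List.countP_map]
    rfl
  have e2 := LPofFn_count (fun i => (ω i : ℕ)) Q
  have e3 : (List.ofFn (fun i => (ω i : ℕ))).countP Q =
      ((List.ofFn (fun i => (ω i : ℕ))).take k).countP Q +
      ((List.ofFn (fun i => (ω i : ℕ))).drop k).countP Q := by
    rw [← List.countP_append, List.take_append_drop]
  have e4 : 1 ≤ ((List.ofFn (fun i => (ω i : ℕ))).drop k).countP Q := by
    rw [List.drop_eq_getElem_cons (by simp), List.countP_cons, if_pos]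
    · omega
    · simp [hQ, h1, h2]
  have e5 : (Finset.univ.filter (fun i => Q (ω i : ℕ) = true)).card =
      (Finset.univ.filter (fun i => lo ≤ (ω i : ℕ) ∧ (ω i : ℕ) < p)).card := by
    congr 1
    ext i
    simp [hQ]
  omega

lemma LPops_take_congr {L n : ℕ} (types : Fin L → Bool) (ω ω' : Fin L → Fin n) (k : Fin L)
    (h : ∀ i, i ≠ k → ω i = ω' i) : (LPops types ω).take k = (LPops types ω').take k := by
  apply List.ext_getElem
  · simp [LPops_length]
  · intro i h1 h2
    simp only [List.length_take, LPops_length] at h1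
    simp only [List.getElem_take, LPops, List.getElem_ofFn]
    rw [h]
    intro hc
    rw [← hc] at h1
    simp at h1

/-- The primitive tombstones as a finset. -/
def LPprim (n x : ℕ) : Finset ℕ := (Finset.Icc 1 (n / (2 * x))).image (fun i => 2 * i * x)

lemma LPprim_mem {n x v : ℕ} : v ∈ LPprim n x ↔ v ∈ graveyardTombstones n x := by
  simp [LPprim, graveyardTombstones]

lemma LPprim_iff {n x v : ℕ} : v ∈ LPprim n x ↔ ∃ i, (1 ≤ i ∧ i ≤ n / (2 * x)) ∧ 2 * i * x = v := by
  simp [LPprim]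

lemma LPinj {x : ℕ} (hx : 1 ≤ x) : Function.Injective (fun i : ℕ => 2 * i * x) := by
  intro a b h
  simp only at h
  have := Nat.eq_of_mul_eq_mul_right hx h
  omega

lemma LPprim_card {n x : ℕ} (hx : 1 ≤ x) : (LPprim n x).card = n / (2 * x) := by
  rw [LPprim, Finset.card_image_of_injective _ (LPinj hx)]
  simp

lemma LPprim_le {n x v : ℕ} (h : v ∈ LPprim n x) : v ≤ n := by
  obtain ⟨i, ⟨h1, h2⟩, rfl⟩ := LPprim_iff.1 h
  have h3 := Nat.div_mul_le_self n (2 * x)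
  have h4 := Nat.mul_le_mul_right (2 * x) h2
  calc 2 * i * x = i * (2 * x) := by ring
    _ ≤ n := h4.trans h3

/-- Displacement as a function of the hashes, for the insertion at position `k`. -/
noncomputable def LPdisp {L n : ℕ} (x : ℕ) (types : Fin L → Bool) (k : Fin L)
    (ω : Fin L → Fin n) : ℕ :=
  LPpeak (LPst (graveyardTombstones n x) ((LPops types ω).take k)) (ω k) - ω k

lemma LPevent {L n x : ℕ} (hx : 1 ≤ x) (types : Fin L → Bool) (k : Fin L) (ω : Fin L → Fin n)
    (hd : 0 < LPdisp x types k ω) :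
    ∃ i0 m : ℕ, i0 ≤ n / (2 * x) ∧ m ≤ n / (2 * x) + 1 ∧ LPdisp x types k ω ≤ 2 * x * m ∧
      2 * x * i0 ≤ ω k ∧ (ω k : ℕ) < 2 * x * (i0 + m) ∧
      m ≤ (Finset.univ.filter (fun i => 2 * x * i0 ≤ (ω i : ℕ) ∧
        (ω i : ℕ) < 2 * x * (i0 + m))).card := by
  set ops := (LPops types ω).take k with hops
  set b := LPst (graveyardTombstones n x) ops with hb
  set p := LPpeak b (ω k) with hp
  have hdd : LPdisp x types k ω = p - ω k := rfl
  rw [hdd] at hd ⊢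
  have hpm := LPpeak_mem (a := b) (h := ω k) (by omega)
  rw [← hp] at hpm
  have hpn : p ≤ n := by
    refine LPst_le n ops (graveyardTombstones n x) (fun v hv => LPprim_le (LPprim_mem.2 hv)) ?_ p hpm.1
    intro o ho
    have h1 : o ∈ LPops types ω := List.mem_of_mem_take ho
    have h2 : LPhash o ∈ (LPops types ω).map LPhash := List.mem_map_of_mem h1
    rw [LPops_hash, List.mem_ofFn] at h2
    obtain ⟨i, hi⟩ := h2
    rw [← hi]
    exact (ω i).2.le
  set S := LPsurv (graveyardTombstones n x) (LPprim n x) ops with hS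
  have hSsub : S ⊆ LPprim n x := LPsurv_subset _ _ _
  have hSb : ∀ v ∈ S, v ∈ b := LPsurv_mem _ _ _ (fun v hv => LPprim_mem.1 hv)
  -- choose the lower end
  obtain ⟨i0, hi0, hlo, hlok, hempty⟩ : ∃ i0, i0 ≤ n / (2 * x) ∧
      (2 * x * i0 = 0 ∨ 2 * x * i0 ∈ S) ∧ 2 * x * i0 ≤ ω k ∧
      ∀ v ∈ S, ¬ (2 * x * i0 < v ∧ v < p) := by
    have hbig : ∀ v ∈ S, (ω k : ℕ) ≤ v → p ≤ v := fun v hv hle => LPpeak_le (hSb v hv) hle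
    by_cases hne : (S.filter (fun v => v < (ω k : ℕ))).Nonempty
    · obtain ⟨v0, hv0, hmax⟩ := Finset.exists_max_image _ id hne
      rw [Finset.mem_filter] at hv0
      obtain ⟨i, ⟨hi1, hi2⟩, hi3⟩ := LPprim_iff.1 (hSsub hv0.1)
      have e : 2 * x * i = v0 := by rw [← hi3]; ring
      refine ⟨i, hi2, Or.inr (e ▸ hv0.1), by omega, ?_⟩
      rintro v hv ⟨h1, h2⟩
      by_cases hvk : v < ω k
      · have := hmax v (Finset.mem_filter.2 ⟨hv, hvk⟩)
        simp only [id] at this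
        omega
      · have := hbig v hv (by omega)
        omega
    · refine ⟨0, Nat.zero_le _, Or.inl (by simp), by simp, ?_⟩
      rintro v hv ⟨h1, h2⟩
      by_cases hvk : v < ω k
      · exact hne ⟨v, Finset.mem_filter.2 ⟨hv, hvk⟩⟩
      · have := hbig v hv (by omega)
        omega
  have hcount := LPsurv_count (2 * x * i0) p ops (graveyardTombstones n x) (LPprim n x)
    (fun v hv => LPprim_mem.1 hv) hlo
  rw [← hS, Finset.filter_eq_empty_iff.2 (fun v hv => hempty v hv), Finset.card_empty,
    Nat.zero_add] at hcount
  have hc2 := LPops_count types ω k (2 * x * i0) p hlok (by omega)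
  rw [← hops] at hc2
  -- upper end
  set q := (p - 1) / (2 * x) with hq
  have hq1 : 2 * x * q ≤ p - 1 := Nat.mul_div_le _ _
  have hq2 : p - 1 < 2 * x * (q + 1) := by
    have := Nat.lt_mul_div_succ (p - 1) (show 0 < 2 * x by omega)
    exact this
  have hqN : q ≤ n / (2 * x) := Nat.div_le_div_right (by omega)
  have hi0q : i0 ≤ q := by
    by_contra hc
    have : 2 * x * (q + 1) ≤ 2 * x * i0 := Nat.mul_le_mul_left _ (by omega)
    omega
  have hprim : q - i0 ≤ ((LPprim n x).filter (fun v => 2 * x * i0 < v ∧ v < p)).card := by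
    have : ((Finset.Ioc i0 q).image (fun i => 2 * i * x)).card = q - i0 := by
      rw [Finset.card_image_of_injective _ (LPinj hx)]
      simp
    rw [← this]
    apply Finset.card_le_card
    intro v hv
    rw [Finset.mem_image] at hv
    obtain ⟨i, hi, rfl⟩ := hv
    rw [Finset.mem_Ioc] at hi
    rw [Finset.mem_filter]
    refine ⟨LPprim_iff.2 ⟨i, ⟨by omega, by omega⟩, rfl⟩, ?_, ?_⟩
    · have : 2 * x * (i0 + 1) ≤ 2 * x * i := Nat.mul_le_mul_left _ (by omega)
      have e : 2 * i * x = 2 * x * i := by ring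
      rw [e]
      rw [mul_add] at this
      omega
    · have : 2 * x * i ≤ 2 * x * q := Nat.mul_le_mul_left _ hi.2
      have e : 2 * i * x = 2 * x * i := by ring
      rw [e]
      omega
  have eq1 : i0 + (q + 1 - i0) = q + 1 := by omega
  have hdle : 2 * x * (q + 1 - i0) = 2 * x * (q + 1) - 2 * x * i0 := Nat.mul_sub _ _ _
  refine ⟨i0, q + 1 - i0, hi0, by omega, by omega, hlok, by rw [eq1]; omega, ?_⟩
  rw [eq1]
  have hmono : (Finset.univ.filter (fun i => 2 * x * i0 ≤ (ω i : ℕ) ∧ (ω i : ℕ) < p)).card ≤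
      (Finset.univ.filter (fun i => 2 * x * i0 ≤ (ω i : ℕ) ∧ (ω i : ℕ) < 2 * x * (q + 1))).card := by
    apply Finset.card_le_card
    intro i
    simp only [Finset.mem_filter, Finset.mem_univ, true_and]
    omega
  omega

lemma LPchernoff {L n : ℕ} (k : Fin L) (s : Finset (Fin n)) (m : ℕ) :
    ((Finset.univ.filter (fun ω : Fin L → Fin n => ω k ∈ s ∧
      m ≤ (Finset.univ.filter (fun i => ω i ∈ s)).card)).card : ℝ) * 2 ^ m ≤
      (2 * s.card) * ((n : ℝ) + s.card) ^ (L - 1) := by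
  set w : Fin L → Fin n → ℝ := fun i a =>
    if i = k then (if a ∈ s then 2 else 0) else (if a ∈ s then 2 else 1) with hw
  have hw0 : ∀ i a, 0 ≤ w i a := by
    intro i a
    simp only [hw]
    split_ifs <;> norm_num
  have h1 : ∏ i, ∑ a, w i a = (2 * s.card) * ((n : ℝ) + s.card) ^ (L - 1) := by
    rw [← Finset.mul_prod_erase Finset.univ _ (Finset.mem_univ k)]
    congr 1
    · simp [hw, Finset.sum_ite_mem, mul_comm]
    · have : ∀ i ∈ Finset.univ.erase k, ∑ a, w i a = (n : ℝ) + s.card := by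
        intro i hi
        have hik := Finset.ne_of_mem_erase hi
        have e : ∀ a, w i a = 1 + (if a ∈ s then 1 else 0) := by
          intro a
          simp only [hw, if_neg hik]
          split_ifs <;> norm_num
        simp [e, Finset.sum_add_distrib]
      rw [Finset.prod_congr rfl this, Finset.prod_const, Finset.card_erase_of_mem (Finset.mem_univ k)]
      simp
  rw [← h1, Finset.prod_univ_sum, Fintype.piFinset_univ, ← nsmul_eq_mul]
  refine le_trans ?_ (Finset.sum_le_sum_of_subset_of_nonneg (Finset.subset_univ
      (Finset.univ.filter (fun ω : Fin L → Fin n => ω k ∈ s ∧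
        m ≤ (Finset.univ.filter (fun i => ω i ∈ s)).card)))
    (fun ω _ _ => Finset.prod_nonneg (fun i _ => hw0 _ _)))
  apply Finset.card_nsmul_le_sum
  intro ω hω
  rw [Finset.mem_filter] at hω
  obtain ⟨-, hk, hm⟩ := hω
  have e : ∀ i, w i (ω i) = if ω i ∈ s then 2 else 1 := by
    intro i
    simp only [hw]
    by_cases hik : i = k
    · subst hik; simp [hk]
    · simp [hik]
  rw [Finset.prod_congr rfl (fun i _ => e i), Finset.prod_ite]
  simp only [Finset.prod_const, one_pow, mul_one]
  exact pow_le_pow_right₀ (by norm_num) hm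

lemma LPinterval_card (n lo T : ℕ) :
    (Finset.univ.filter (fun a : Fin n => lo ≤ (a : ℕ) ∧ (a : ℕ) < lo + T)).card ≤ T := by
  have h := Finset.card_le_card_of_injOn (s := Finset.univ.filter
    (fun a : Fin n => lo ≤ (a : ℕ) ∧ (a : ℕ) < lo + T)) (t := Finset.Ico lo (lo + T))
    (fun a => (a : ℕ)) (by intro a; simp) (by intro a _ b _ h; exact Fin.ext h)
  simpa using h

lemma LPq : Real.exp (1 / 2) ≤ 33 / 20 := by
  have h1 := Real.exp_one_lt_d9
  have h2 : Real.exp (1 / 2) * Real.exp (1 / 2) = Real.exp 1 := by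
    rw [← Real.exp_add]; norm_num
  nlinarith [Real.exp_pos (1 / 2)]

lemma LPterm (m : ℕ) : (m : ℝ) * Real.exp (m / 2) ≤ 16 * (9 / 10) ^ m * 2 ^ m := by
  have h1 : (m : ℝ) ≤ 16 * (17 / 16) ^ m := by
    have := one_add_mul_le_pow (a := (1 / 16 : ℝ)) (by norm_num) m
    norm_num at this
    linarith
  have h2 : Real.exp (m / 2) ≤ (33 / 20) ^ m := by
    have : Real.exp ((m : ℝ) / 2) = Real.exp (1 / 2) ^ m := by
      rw [← Real.exp_nat_mul]; congr 1; ring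
    rw [this]
    exact pow_le_pow_left₀ (Real.exp_pos _).le LPq m
  calc (m : ℝ) * Real.exp (m / 2) ≤ (16 * (17 / 16) ^ m) * (33 / 20) ^ m := by gcongr
    _ = 16 * (561 / 320) ^ m := by rw [mul_assoc, ← mul_pow]; norm_num
    _ ≤ 16 * (9 / 5) ^ m := by
      have := pow_le_pow_left₀ (show (0 : ℝ) ≤ 561 / 320 by norm_num)
        (show (561 / 320 : ℝ) ≤ 9 / 5 by norm_num) m
      linarith
    _ = 16 * (9 / 10) ^ m * 2 ^ m := by rw [mul_assoc, ← mul_pow]; norm_num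

lemma LPA_bound {L n x : ℕ} (hn : 0 < n) (hL : L ≤ n / (4 * x)) (hx : 1 ≤ x)
    (k : Fin L) (lo m : ℕ) :
    ((Finset.univ.filter (fun ω : Fin L → Fin n =>
      (lo ≤ (ω k : ℕ) ∧ (ω k : ℕ) < lo + 2 * x * m) ∧
      m ≤ (Finset.univ.filter (fun i => lo ≤ (ω i : ℕ) ∧
        (ω i : ℕ) < lo + 2 * x * m)).card)).card : ℝ) ≤
      (4 * x / n) * (16 * (9 / 10) ^ m) * (n : ℝ) ^ L := by
  set s := Finset.univ.filter (fun a : Fin n => lo ≤ (a : ℕ) ∧ (a : ℕ) < lo + 2 * x * m) with hs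
  have h1 := LPchernoff k s m
  simp only [hs, Finset.mem_filter, Finset.mem_univ, true_and] at h1
  rw [← hs] at h1
  have hsc : (s.card : ℝ) ≤ 2 * x * m := by exact_mod_cast LPinterval_card n lo (2 * x * m)
  have hnR : (0 : ℝ) < n := by exact_mod_cast hn
  have hL0 : 1 ≤ L := by have := k.2; omega
  have hLx : (L : ℝ) * (4 * x) ≤ n := by
    have := (Nat.le_div_iff_mul_le (by omega)).1 hL
    exact_mod_cast this
  have h2 : ((n : ℝ) + s.card) ^ (L - 1) ≤ (n : ℝ) ^ (L - 1) * Real.exp (m / 2) := by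
    have e1 : (n : ℝ) + s.card ≤ n * Real.exp (2 * x * m / n) := by
      have := Real.add_one_le_exp (2 * x * m / n : ℝ)
      calc (n : ℝ) + s.card ≤ n + 2 * x * m := by gcongr
        _ = n * (2 * x * m / n + 1) := by field_simp; ring
        _ ≤ _ := by gcongr
    calc ((n : ℝ) + s.card) ^ (L - 1) ≤ (n * Real.exp (2 * x * m / n)) ^ (L - 1) := by gcongr
      _ = (n : ℝ) ^ (L - 1) * Real.exp ((L - 1 : ℕ) * (2 * x * m / n)) := by
        rw [mul_pow, ← Real.exp_nat_mul]
      _ ≤ _ := by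
        gcongr
        rw [← mul_div_assoc, div_le_div_iff₀ hnR (by norm_num)]
        have : ((L - 1 : ℕ) : ℝ) ≤ L := by exact_mod_cast Nat.sub_le _ _
        calc ((L - 1 : ℕ) : ℝ) * (2 * x * m) * 2 ≤ L * (2 * x * m) * 2 := by gcongr
          _ = m * (L * (4 * x)) := by ring
          _ ≤ m * n := by gcongr
  have h3 : (n : ℝ) ^ L = n ^ (L - 1) * n := by rw [← pow_succ]; congr 1; omega
  have h2m : (0 : ℝ) < 2 ^ m := by positivity
  refine le_of_mul_le_mul_right (h1.trans ?_) h2m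
  calc 2 * (s.card : ℝ) * ((n : ℝ) + s.card) ^ (L - 1)
      ≤ 2 * (2 * x * m) * ((n : ℝ) ^ (L - 1) * Real.exp (m / 2)) := by gcongr
    _ = 4 * x * (n : ℝ) ^ (L - 1) * (m * Real.exp (m / 2)) := by ring
    _ ≤ 4 * x * (n : ℝ) ^ (L - 1) * (16 * (9 / 10) ^ m * 2 ^ m) := by
      exact mul_le_mul_of_nonneg_left (LPterm m) (by positivity)
    _ = _ := by rw [h3]; field_simp

lemma LPlarge {L n x : ℕ} (hn : 0 < n) (hL : L ≤ n / (4 * x)) (hx : 1 ≤ x)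
    (types : Fin L → Bool) (k : Fin L) (r : ℝ) (hr : 1 < r) :
    ((Finset.univ.filter (fun ω : Fin L → Fin n =>
      r * x ≤ (LPdisp x types k ω : ℝ))).card : ℝ) ≤
      640 * Real.exp (-(r / 20)) * (n : ℝ) ^ L := by
  set N := n / (2 * x) with hN
  set M := ⌈r / 2⌉₊ with hM
  set A : ℕ → ℕ → Finset (Fin L → Fin n) := fun i0 m =>
    Finset.univ.filter (fun ω : Fin L → Fin n =>
      (2 * x * i0 ≤ (ω k : ℕ) ∧ (ω k : ℕ) < 2 * x * i0 + 2 * x * m) ∧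
      m ≤ (Finset.univ.filter (fun i => 2 * x * i0 ≤ (ω i : ℕ) ∧
        (ω i : ℕ) < 2 * x * i0 + 2 * x * m)).card) with hA
  have hxR : (0 : ℝ) < x := by exact_mod_cast hx
  have hnR : (0 : ℝ) < n := by exact_mod_cast hn
  have hsub : Finset.univ.filter (fun ω : Fin L → Fin n => r * x ≤ (LPdisp x types k ω : ℝ)) ⊆
      (Finset.range (N + 1)).biUnion (fun i0 => (Finset.Ico M (N + 2)).biUnion (fun m => A i0 m)) := by
    intro ω hω
    rw [Finset.mem_filter] at hω
    have hd : 0 < LPdisp x types k ω := by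
      have : (0 : ℝ) < LPdisp x types k ω := lt_of_lt_of_le (by positivity) hω.2
      exact_mod_cast this
    obtain ⟨i0, m, h1, h2, h3, h4, h5, h6⟩ := LPevent hx types k ω hd
    simp only [Finset.mem_biUnion, Finset.mem_range, Finset.mem_Ico]
    refine ⟨i0, by omega, m, ⟨?_, by omega⟩, ?_⟩
    · rw [hM, Nat.ceil_le]
      have h3' : (LPdisp x types k ω : ℝ) ≤ 2 * x * m := by exact_mod_cast h3
      have : r * x ≤ (2 * m) * x := by linarith [hω.2]
      have := le_of_mul_le_mul_right this hxR
      linarith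
    · rw [mul_add] at h5 h6
      simp only [hA, Finset.mem_filter, Finset.mem_univ, true_and]
      exact ⟨⟨h4, h5⟩, h6⟩
  have hc1 : ((Finset.univ.filter (fun ω : Fin L → Fin n =>
      r * x ≤ (LPdisp x types k ω : ℝ))).card : ℝ) ≤
      ∑ i0 ∈ Finset.range (N + 1), ∑ m ∈ Finset.Ico M (N + 2), ((A i0 m).card : ℝ) := by
    have h := (Finset.card_le_card hsub).trans (Finset.card_biUnion_le.trans
      (Finset.sum_le_sum (fun i0 _ => Finset.card_biUnion_le)))
    exact_mod_cast h
  have hc2 : ∑ i0 ∈ Finset.range (N + 1), ∑ m ∈ Finset.Ico M (N + 2), ((A i0 m).card : ℝ) ≤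
      ∑ i0 ∈ Finset.range (N + 1), ∑ m ∈ Finset.Ico M (N + 2),
        (4 * x / n) * (16 * (9 / 10) ^ m) * (n : ℝ) ^ L :=
    Finset.sum_le_sum (fun i0 _ => Finset.sum_le_sum (fun m _ => LPA_bound hn hL hx k _ m))
  have hgeom : ∑ m ∈ Finset.Ico M (N + 2), (9 / 10 : ℝ) ^ m ≤ 10 * Real.exp (-(r / 20)) := by
    have h1 := geom_sum_Ico_le_of_lt_one (x := (9 / 10 : ℝ)) (m := M) (n := N + 2)
      (by norm_num) (by norm_num)
    have h2 : (9 / 10 : ℝ) ^ M ≤ Real.exp (-(r / 20)) := by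
      have e1 : (9 / 10 : ℝ) ≤ Real.exp (-(1 / 10)) := by
        have := Real.add_one_le_exp (-(1 / 10) : ℝ)
        linarith
      calc (9 / 10 : ℝ) ^ M ≤ Real.exp (-(1 / 10)) ^ M := by gcongr
        _ = Real.exp (M * (-(1 / 10))) := by rw [← Real.exp_nat_mul]
        _ ≤ _ := by
          gcongr
          have := Nat.le_ceil (r / 2)
          linarith
    have h3 : (9 / 10 : ℝ) ^ M / (1 - 9 / 10) = 10 * (9 / 10 : ℝ) ^ M := by
      norm_num
      ring
    linarith
  have hN4 : ((N + 1 : ℕ) : ℝ) * (4 * x / n) ≤ 4 := by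
    rw [← mul_div_assoc, div_le_iff₀ hnR]
    have h1 : N * (2 * x) ≤ n := Nat.div_mul_le_self _ _
    have h2 : L * (4 * x) ≤ n := (Nat.le_div_iff_mul_le (by omega)).1 hL
    have h3 : 1 * (4 * x) ≤ L * (4 * x) := Nat.mul_le_mul_right _ (by have := k.2; omega)
    have h4 : (N + 1) * (4 * x) ≤ 4 * n := by
      have : (N + 1) * (4 * x) = 2 * (N * (2 * x)) + 4 * x := by ring
      omega
    exact_mod_cast h4
  refine hc1.trans (hc2.trans ?_)
  rw [Finset.sum_const, Finset.card_range, nsmul_eq_mul]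
  have e : ∑ m ∈ Finset.Ico M (N + 2), (4 * x / n : ℝ) * (16 * (9 / 10) ^ m) * (n : ℝ) ^ L =
      (4 * x / n : ℝ) * (16 * (∑ m ∈ Finset.Ico M (N + 2), (9 / 10 : ℝ) ^ m) * (n : ℝ) ^ L) := by
    rw [Finset.mul_sum, Finset.sum_mul, Finset.mul_sum]
    apply Finset.sum_congr rfl
    intros; ring
  rw [e, ← mul_assoc]
  calc ((N + 1 : ℕ) : ℝ) * (4 * x / n) *
        (16 * (∑ m ∈ Finset.Ico M (N + 2), (9 / 10 : ℝ) ^ m) * (n : ℝ) ^ L)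
      ≤ 4 * (16 * (10 * Real.exp (-(r / 20))) * (n : ℝ) ^ L) := by gcongr
    _ = _ := by ring

/-- For fixed other hashes, at least a quarter of the hashes give displacement at most `x`. -/
lemma LPgood {L n x : ℕ} (hL : L ≤ n / (4 * x)) (hx : 1 ≤ x)
    (types : Fin L → Bool) (k : Fin L) (ω0 : Fin L → Fin n) :
    4 * (Finset.univ.filter (fun a : Fin n =>
      x < LPdisp x types k (Function.update ω0 k a))).card ≤ 3 * n := by
  set ops := (LPops types ω0).take k with hops
  set b := LPst (graveyardTombstones n x) ops with hb
  set S := LPsurv (graveyardTombstones n x) (LPprim n x) ops with hS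
  have hSsub : S ⊆ LPprim n x := LPsurv_subset _ _ _
  have hSb : ∀ v ∈ S, v ∈ b := LPsurv_mem _ _ _ (fun v hv => LPprim_mem.1 hv)
  have hcard : n / (2 * x) ≤ S.card + k := by
    have := LPsurv_card ops (graveyardTombstones n x) (LPprim n x)
    rw [LPprim_card hx, ← hS] at this
    have hl : ops.length ≤ k := by simp [hops]
    omega
  have hd : ∀ a, LPdisp x types k (Function.update ω0 k a) = LPpeak b a - a := by
    intro a
    have : (LPops types (Function.update ω0 k a)).take k = ops :=
      LPops_take_congr _ _ _ _ (fun i hi => by simp [hi])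
    simp [LPdisp, this, hb]
  set bad := Finset.univ.filter (fun a : Fin n =>
      x < LPdisp x types k (Function.update ω0 k a)) with hbad
  -- the good hashes
  set G : Finset ℕ := S.biUnion (fun t => Finset.Ico (t - x) t) with hG
  have htx : ∀ t ∈ S, 2 * x ≤ t := by
    intro t ht
    obtain ⟨i, ⟨h1, _⟩, rfl⟩ := LPprim_iff.1 (hSsub ht)
    nlinarith
  have hGcard : G.card = S.card * x := by
    rw [hG, Finset.card_biUnion]
    · rw [Finset.sum_congr rfl (g := fun _ => x)]
      · simp
      · intro t ht
        have := htx t ht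
        simp only [Nat.card_Ico]
        omega
    · intro s hs t ht hst
      obtain ⟨i, ⟨h1, _⟩, hi⟩ := LPprim_iff.1 (hSsub hs)
      obtain ⟨j, ⟨h2, _⟩, hj⟩ := LPprim_iff.1 (hSsub ht)
      change Disjoint (Finset.Ico (s - x) s) (Finset.Ico (t - x) t)
      rw [Finset.disjoint_left]
      intro v hv hv'
      rw [Finset.mem_Ico] at hv hv'
      rcases lt_trichotomy i j with h | h | h
      · have : 2 * (i + 1) * x ≤ 2 * j * x := Nat.mul_le_mul_right _ (by omega)
        have e : 2 * (i + 1) * x = 2 * i * x + 2 * x := by ring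
        omega
      · subst h
        exact hst (hi.symm.trans hj)
      · have : 2 * (j + 1) * x ≤ 2 * i * x := Nat.mul_le_mul_right _ (by omega)
        have e : 2 * (j + 1) * x = 2 * j * x + 2 * x := by ring
        omega
  have hdisj : Disjoint (bad.image (fun a : Fin n => (a : ℕ))) G := by
    rw [Finset.disjoint_left]
    intro v hv hv'
    rw [Finset.mem_image] at hv
    obtain ⟨a, ha, rfl⟩ := hv
    rw [hbad, Finset.mem_filter, hd] at ha
    rw [hG, Finset.mem_biUnion] at hv'
    obtain ⟨t, ht, hat⟩ := hv'
    rw [Finset.mem_Ico] at hat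
    have := LPpeak_le (hSb t ht) hat.2.le
    omega
  have hsub : bad.image (fun a : Fin n => (a : ℕ)) ∪ G ⊆ Finset.range n := by
    intro v hv
    rw [Finset.mem_range]
    rcases Finset.mem_union.1 hv with h | h
    · rw [Finset.mem_image] at h
      obtain ⟨a, _, rfl⟩ := h
      exact a.2
    · rw [hG, Finset.mem_biUnion] at h
      obtain ⟨t, ht, hat⟩ := h
      rw [Finset.mem_Ico] at hat
      have := LPprim_le (hSsub ht)
      omega
  have htot := Finset.card_le_card hsub
  rw [Finset.card_union_of_disjoint hdisj, Finset.card_image_of_injective _ Fin.val_injective,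
    Finset.card_range, hGcard] at htot
  have hk := k.2
  have h2L : 2 * L ≤ n / (2 * x) := by
    have h1 := (Nat.le_div_iff_mul_le (show 0 < 4 * x by omega)).1 hL
    rw [Nat.le_div_iff_mul_le (by omega)]
    calc 2 * L * (2 * x) = L * (4 * x) := by ring
      _ ≤ n := h1
  have hn : n < 2 * x * (n / (2 * x) + 1) := Nat.lt_mul_div_succ n (by omega)
  have hfin : n ≤ 4 * (S.card * x) := by
    have h1 : n / (2 * x) + 1 ≤ 2 * S.card := by omega
    have := Nat.mul_le_mul_left (2 * x) h1
    have e : 2 * x * (2 * S.card) = 4 * (S.card * x) := by ring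
    omega
  omega

lemma LPsmall {L n x : ℕ} (hn : 0 < n) (hL : L ≤ n / (4 * x)) (hx : 1 ≤ x)
    (types : Fin L → Bool) (k : Fin L) :
    ((Finset.univ.filter (fun ω : Fin L → Fin n =>
      x < LPdisp x types k ω)).card : ℝ) ≤ 3 / 4 * (n : ℝ) ^ L := by
  set g : (Fin L → Fin n) → ℕ := fun ω => if x < LPdisp x types k ω then 1 else 0 with hg
  set e := Equiv.funSplitAt k (Fin n)
  have z : Fin n := ⟨0, hn⟩
  have h1 : (Finset.univ.filter (fun ω : Fin L → Fin n => x < LPdisp x types k ω)).card =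
      ∑ η : ({i : Fin L // i ≠ k} → Fin n), ∑ a : Fin n, g (e.symm (a, η)) := by
    rw [Finset.card_filter, ← Equiv.sum_comp e.symm, Fintype.sum_prod_type_right]
  have h2 : ∀ η : ({i : Fin L // i ≠ k} → Fin n), 4 * ∑ a : Fin n, g (e.symm (a, η)) ≤ 3 * n := by
    intro η
    have h3 := LPgood hL hx types k (e.symm (z, η))
    rw [Finset.card_filter] at h3
    suffices h4 : ∀ a, e.symm (a, η) = Function.update (e.symm (z, η)) k a by
      rw [Finset.sum_congr rfl (fun a _ => congrArg g (h4 a))]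
      exact h3
    intro a
    funext i
    by_cases hi : i = k
    · subst hi; simp [e, Equiv.funSplitAt, Equiv.piSplitAt]
    · simp [e, Equiv.funSplitAt, Equiv.piSplitAt, hi]
  have h3 : 4 * (Finset.univ.filter (fun ω : Fin L → Fin n => x < LPdisp x types k ω)).card ≤
      n ^ (L - 1) * (3 * n) := by
    rw [h1, Finset.mul_sum]
    refine (Finset.sum_le_sum (fun η _ => h2 η)).trans ?_
    simp
  have h4 : n ^ (L - 1) * (3 * n) = 3 * n ^ L := by
    have : n ^ L = n ^ (L - 1) * n := by
      rw [← pow_succ]; congr 1; have := k.2; omega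
    rw [this]; ring
  rw [h4] at h3
  have h5 : (4 : ℝ) * (Finset.univ.filter
      (fun ω : Fin L → Fin n => x < LPdisp x types k ω)).card ≤ 3 * (n : ℝ) ^ L := by
    exact_mod_cast h3
  linarith

/-- In a graveyard hash table whose rebuild placed primitive
tombstones at every hash in `{2ix : i ∈ [n/(2x)]}`, run a window of at most
`n/(4x)` operations of arbitrary types with i.i.d. uniform hashes. For every `r > 1`
and every insertion of the window (the `j`-th one, say), its displacement
`d = peak − hash` satisfies `Pr[d ≥ rx] ≤ exp(-Ω(r))` (formalized by counting the
hash assignments `ω`). -/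
theorem stmt18 :
    ∃ c : ℝ, 0 < c ∧
      ∀ (n x L : ℕ) (types : Fin L → Bool) (j : ℕ) (r : ℝ),
        0 < n → 1 ≤ x → L ≤ n / (4 * x) → 1 < r →
        ((Finset.univ.filter (fun ω : Fin L → Fin n =>
            r * x ≤
              ((((LPtrace (graveyardTombstones n x)
                    (List.ofFn fun i =>
                      if types i then LPOp.ins (ω i : ℕ) else LPOp.del (ω i : ℕ))).getD
                  j (0, 0)).2 -
                ((LPtrace (graveyardTombstones n x)
                    (List.ofFn fun i =>
                      if types i then LPOp.ins (ω i : ℕ) else LPOp.del (ω i : ℕ))).getD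
                  j (0, 0)).1 : ℕ) : ℝ))).card : ℝ)
          ≤ Real.exp (-(c * r)) * (n : ℝ) ^ L := by

  refine ⟨1 / 1120, by norm_num, ?_⟩
  intro n x L types j r hn hx hL hr
  have hxR : (0 : ℝ) < x := by exact_mod_cast hx
  have hnR : (0 : ℝ) < n := by exact_mod_cast hn
  change ((Finset.univ.filter (fun ω : Fin L → Fin n => r * x ≤
    ((((LPtrace (graveyardTombstones n x) (LPops types ω)).getD j (0, 0)).2 -
      ((LPtrace (graveyardTombstones n x) (LPops types ω)).getD j (0, 0)).1 : ℕ) : ℝ))).card : ℝ)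
    ≤ _
  rcases LPtrace_spec n L types j with h | ⟨k, h⟩
  · have : (Finset.univ.filter (fun ω : Fin L → Fin n => r * x ≤
      ((((LPtrace (graveyardTombstones n x) (LPops types ω)).getD j (0, 0)).2 -
      ((LPtrace (graveyardTombstones n x) (LPops types ω)).getD j (0, 0)).1 : ℕ) : ℝ))) = ∅ := by
      apply Finset.filter_eq_empty_iff.2
      intro ω _
      rw [h]
      simp only [Nat.sub_self, Nat.cast_zero, not_le]
      positivity
    rw [this]
    simp only [Finset.card_empty, Nat.cast_zero]
    positivity
  · simp only [h]
    change ((Finset.univ.filter (fun ω : Fin L → Fin n =>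
      r * x ≤ (LPdisp x types k ω : ℝ))).card : ℝ) ≤ _
    by_cases hr2 : r ≤ 280
    · have h1 := LPsmall hn hL hx types k
      have h2 : Finset.univ.filter (fun ω : Fin L → Fin n => r * x ≤ (LPdisp x types k ω : ℝ)) ⊆
          Finset.univ.filter (fun ω : Fin L → Fin n => x < LPdisp x types k ω) := by
        intro ω hω
        rw [Finset.mem_filter] at hω ⊢
        refine ⟨hω.1, ?_⟩
        have : (x : ℝ) < LPdisp x types k ω := by nlinarith [hω.2]
        exact_mod_cast this
      have h3 : ((Finset.univ.filter (fun ω : Fin L → Fin n =>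
          r * x ≤ (LPdisp x types k ω : ℝ))).card : ℝ) ≤
          ((Finset.univ.filter (fun ω : Fin L → Fin n => x < LPdisp x types k ω)).card : ℝ) := by
        exact_mod_cast Finset.card_le_card h2
      refine (h3.trans h1).trans ?_
      gcongr
      have := Real.add_one_le_exp (-(1 / 1120 * r))
      linarith
    · push Not at hr2
      refine (LPlarge hn hL hx types k r hr).trans ?_
      gcongr
      have h7 : (640 : ℝ) ≤ Real.exp 7 := by
        have h1 := Real.exp_one_gt_d9
        have : Real.exp 7 = Real.exp 1 ^ 7 := by rw [← Real.exp_nat_mul]; norm_num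
        rw [this]
        calc (640 : ℝ) ≤ (27 / 10) ^ 7 := by norm_num
          _ ≤ _ := by gcongr; linarith
      calc 640 * Real.exp (-(r / 20)) ≤ Real.exp 7 * Real.exp (-(r / 20)) := by gcongr
        _ = Real.exp (7 + -(r / 20)) := by rw [Real.exp_add]
        _ ≤ _ := by
          gcongr
          linarith
end
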